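/- (Theorem 1.3, main correlation bound.) There exist absolute constants τ > 0 and c > 0 with the following property: for every depth d ∈ ℕ there exists n₀ such that for all n ≥ n₀ of the form n = m(k+1)r with m = r and k = ⌊0.0005·log₂ m⌋, every n-variable circuit C of size at most n^{τ·log₂ n} and depth d whose top gate is a SYM gate or a THR gate and whose remaining gates are unbounded fan-in AND/OR gates satisfies Pr_{x ← uniform on {0,1}^n}[ RW_{m,k,r}(x) = C(x) ] ≤ 1/2 + exp(−c·n^{0.499}). -/

import Mathlib

open Finset

/-! ### AC⁰ circuits: unbounded fan-in AND/OR gates over literals -/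

inductive AC0 (ι : Type) : Type
  | lit : ι → Bool → AC0 ι
  | and : (a : ℕ) → (Fin a → AC0 ι) → AC0 ι
  | or  : (a : ℕ) → (Fin a → AC0 ι) → AC0 ι

namespace AC0

variable {ι : Type}

def eval : AC0 ι → (ι → Bool) → Bool
  | .lit i b, x => if b then x i else !(x i)
  | .and _ f, x => decide (∀ j, (f j).eval x = true)
  | .or _ f, x => decide (∃ j, (f j).eval x = true)

/-- Number of gates, literals included in the count. -/
def size : AC0 ι → ℕ
  | .lit _ _ => 1
  | .and _ f => 1 + ∑ j, (f j).size
  | .or _ f => 1 + ∑ j, (f j).size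

def depth : AC0 ι → ℕ
  | .lit _ _ => 0
  | .and _ f => 1 + Finset.univ.sup fun j => (f j).depth
  | .or _ f => 1 + Finset.univ.sup fun j => (f j).depth

end AC0

/-- `g` is an arbitrary symmetric Boolean function: it depends only on the
number of `true`s among its inputs. -/
def IsSymFun {a : ℕ} (g : (Fin a → Bool) → Bool) : Prop :=
  ∃ φ : ℕ → Bool, ∀ y, g y = φ (Finset.univ.filter fun i => y i = true).card

/-- `g` is an arbitrary linear threshold function: `g y = 1` iff `∑ wᵢ yᵢ ≥ θ`. -/
def IsThrFun {a : ℕ} (g : (Fin a → Bool) → Bool) : Prop :=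
  ∃ (w : Fin a → ℝ) (θ : ℝ), ∀ y, g y = decide (θ ≤ ∑ i, if y i = true then w i else 0)

/-- `F` is computed by a SYM∘AC⁰ circuit: a symmetric output gate fed by
AC⁰ circuits of depth at most `d`, with at most `S` gates in total
(the top gate and all gates of the feeding circuits, literals included). -/
def SymOnAC0 {ι : Type} (S : ℝ) (d : ℕ) (F : (ι → Bool) → Bool) : Prop :=
  ∃ (a : ℕ) (g : (Fin a → Bool) → Bool) (C : Fin a → AC0 ι),
    IsSymFun g ∧ (∀ i, (C i).depth ≤ d) ∧ (((1 + ∑ i, (C i).size : ℕ) : ℝ) ≤ S) ∧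
    ∀ x, F x = g fun i => (C i).eval x

/-- `F` is computed by a THR∘AC⁰ circuit, analogously. -/
def ThrOnAC0 {ι : Type} (S : ℝ) (d : ℕ) (F : (ι → Bool) → Bool) : Prop :=
  ∃ (a : ℕ) (g : (Fin a → Bool) → Bool) (C : Fin a → AC0 ι),
    IsThrFun g ∧ (∀ i, (C i).depth ≤ d) ∧ (((1 + ∑ i, (C i).size : ℕ) : ℝ) ≤ S) ∧
    ∀ x, F x = g fun i => (C i).eval x

/-! ### General circuits with AND/OR gates and arbitrary SYM/THR gates -/

inductive GenCircuit (ι : Type) : Type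
  | lit : ι → Bool → GenCircuit ι
  | and : (a : ℕ) → (Fin a → GenCircuit ι) → GenCircuit ι
  | or  : (a : ℕ) → (Fin a → GenCircuit ι) → GenCircuit ι
  | sym : (a : ℕ) → (ℕ → Bool) → (Fin a → GenCircuit ι) → GenCircuit ι
  | thr : (a : ℕ) → (Fin a → ℝ) → ℝ → (Fin a → GenCircuit ι) → GenCircuit ι

namespace GenCircuit

variable {ι : Type}

noncomputable def eval : GenCircuit ι → (ι → Bool) → Bool
  | .lit i b, x => if b then x i else !(x i)
  | .and _ f, x => decide (∀ j, (f j).eval x = true)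
  | .or _ f, x => decide (∃ j, (f j).eval x = true)
  | .sym _ φ f, x => φ (Finset.univ.filter fun j => (f j).eval x = true).card
  | .thr _ w θ f, x => decide (θ ≤ ∑ j, if (f j).eval x = true then w j else 0)

/-- Number of gates, literals included in the count. -/
def size : GenCircuit ι → ℕ
  | .lit _ _ => 1
  | .and _ f => 1 + ∑ j, (f j).size
  | .or _ f => 1 + ∑ j, (f j).size
  | .sym _ _ f => 1 + ∑ j, (f j).size
  | .thr _ _ _ f => 1 + ∑ j, (f j).size

def depth : GenCircuit ι → ℕ
  | .lit _ _ => 0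
  | .and _ f => 1 + Finset.univ.sup fun j => (f j).depth
  | .or _ f => 1 + Finset.univ.sup fun j => (f j).depth
  | .sym _ _ f => 1 + Finset.univ.sup fun j => (f j).depth
  | .thr _ _ _ f => 1 + Finset.univ.sup fun j => (f j).depth

/-- The number of SYM and THR gates in the circuit. -/
def symThrCount : GenCircuit ι → ℕ
  | .lit _ _ => 0
  | .and _ f => ∑ j, (f j).symThrCount
  | .or _ f => ∑ j, (f j).symThrCount
  | .sym _ _ f => 1 + ∑ j, (f j).symThrCount
  | .thr _ _ _ f => 1 + ∑ j, (f j).symThrCount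

end GenCircuit

/-! ### Restrictions and distributions -/

/-- Apply a restriction (`none` = `*` = free) to an input. -/
def applyR {ι : Type} (ρ : ι → Option Bool) (x : ι → Bool) : ι → Bool :=
  fun i => (ρ i).getD (x i)

/-- The restricted function `f↾ρ`. -/
def restrictF {ι : Type} (f : (ι → Bool) → Bool) (ρ : ι → Option Bool) :
    (ι → Bool) → Bool :=
  fun x => f (applyR ρ x)

def freeCount {ι : Type} [Fintype ι] (ρ : ι → Option Bool) : ℕ :=
  (Finset.univ.filter fun i => ρ i = none).card

open Classical in
/-- Probability of the event `P` under the (finitely supported) density `R`. -/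
noncomputable def prOf {α : Type} [Fintype α] (R : α → ℝ) (P : α → Prop) : ℝ :=
  ∑ a, if P a then R a else 0

/-- A density `R` on restrictions is a fair distribution: it is a probability
distribution, and drawing `ρ ← R` and filling in all `*`s with independent
uniform bits yields the uniform distribution on `{0,1}^n`. -/
def IsFair {ι : Type} [Fintype ι] [DecidableEq ι] (R : (ι → Option Bool) → ℝ) : Prop :=
  (∀ ρ, 0 ≤ R ρ) ∧ ((∑ ρ : ι → Option Bool, R ρ) = 1) ∧
  ∀ x : ι → Bool,
    (∑ ρ : ι → Option Bool, R ρ * if applyR ρ x = x then ((1 : ℝ) / 2) ^ freeCount ρ else 0)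
      = ((1 : ℝ) / 2) ^ Fintype.card ι

/-- The density of the random restriction `R_p`: each coordinate independently
is `*` with probability `p`, and `0` or `1` each with probability `(1-p)/2`. -/
noncomputable def RpDensity {ι : Type} [Fintype ι] (p : ℝ) (ρ : ι → Option Bool) : ℝ :=
  ∏ i, (ρ i).elim p (fun _ => (1 - p) / 2)

/-- The density of the random subset `L ⊆_q ι` (as an indicator function):
each element is included independently with probability `q`. -/
noncomputable def subsetDensity {ι : Type} [Fintype ι] (q : ℝ) (L : ι → Bool) : ℝ :=
  ∏ i, if L i then q else 1 - q

/-- The fraction of inputs on which `F` and `H` agree. -/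
noncomputable def agreePr {ι : Type} [Fintype ι] [DecidableEq ι]
    (F H : (ι → Bool) → Bool) : ℝ :=
  ((Finset.univ.filter fun x : ι → Bool => F x = H x).card : ℝ) / 2 ^ Fintype.card ι

/-- `G : {0,1}^t → {0,1}^ι` ε-fools the Boolean function `f`. -/
def Fools {ι : Type} [Fintype ι] [DecidableEq ι] {t : ℕ}
    (G : (Fin t → Bool) → (ι → Bool)) (f : (ι → Bool) → Bool) (ε : ℝ) : Prop :=
  |(∑ s : Fin t → Bool, if f (G s) = true then (1 : ℝ) else 0) / 2 ^ t
    - (∑ x : ι → Bool, if f x = true then (1 : ℝ) else 0) / 2 ^ Fintype.card ι| ≤ ε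

/-! ### Decision trees -/

inductive DTree (ι : Type) (α : Type) : Type
  | leaf : α → DTree ι α
  | node : ι → DTree ι α → DTree ι α → DTree ι α

namespace DTree

variable {ι α : Type}

def depth : DTree ι α → ℕ
  | .leaf _ => 0
  | .node _ t0 t1 => 1 + max t0.depth t1.depth

def evalWith (ev : α → (ι → Bool) → Bool) : DTree ι α → (ι → Bool) → Bool
  | .leaf a, x => ev a x
  | .node i t0 t1, x => if x i then t1.evalWith ev x else t0.evalWith ev x

def leaves : DTree ι α → List α
  | .leaf a => [a]
  | .node _ t0 t1 => t0.leaves ++ t1.leaves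

end DTree

/-- Evaluation of an ordinary decision tree with Boolean leaves. -/
def evalDT {ι : Type} (T : DTree ι Bool) (x : ι → Bool) : Bool :=
  T.evalWith (fun b _ => b) x

/-- `F` is computed by a `(t, C)`-decision tree: a depth-`t` decision tree
whose leaves are labeled by functions from the class `C`. -/
def ComputedByClassDT {ι : Type} (t : ℕ) (C : ((ι → Bool) → Bool) → Prop)
    (F : (ι → Bool) → Bool) : Prop :=
  ∃ T : DTree ι ((ι → Bool) → Bool), T.depth ≤ t ∧ (∀ g ∈ T.leaves, C g) ∧
    ∀ x, F x = T.evalWith (fun g => g) x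

/-! ### SYM∘AND and THR∘AND circuits -/

/-- `F` is computed by a SYM∘AND circuit with at most `S` bottom AND gates
(terms), each a conjunction of at most `kb` literals. -/
def IsSymAnd {ι : Type} (S kb : ℝ) (F : (ι → Bool) → Bool) : Prop :=
  ∃ (a : ℕ) (g : (Fin a → Bool) → Bool) (T : Fin a → List (ι × Bool)),
    IsSymFun g ∧ ((a : ℝ) ≤ S) ∧ (∀ i, ((T i).length : ℝ) ≤ kb) ∧
    ∀ x, F x = g fun i => (T i).all fun l => x l.1 == l.2

/-- `F` is computed by a THR∘AND circuit, analogously. -/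
def IsThrAnd {ι : Type} (S kb : ℝ) (F : (ι → Bool) → Bool) : Prop :=
  ∃ (a : ℕ) (g : (Fin a → Bool) → Bool) (T : Fin a → List (ι × Bool)),
    IsThrFun g ∧ ((a : ℝ) ≤ S) ∧ (∀ i, ((T i).length : ℝ) ≤ kb) ∧
    ∀ x, F x = g fun i => (T i).all fun l => x l.1 == l.2

/-! ### The Razborov–Wigderson and generalized inner product functions -/

/-- Parity (XOR) of a finite family of bits. -/
def bparity {α : Type} [Fintype α] (f : α → Bool) : Bool :=
  decide ((Finset.univ.filter fun a => f a = true).card % 2 = 1)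

/-- `RW_{m,k,r}(x) = ⊕_{i∈[m]} ⋀_{j∈[k+1]} ⊕_{ℓ∈[r]} x_{i,j,ℓ}`. -/
def RW (m k r : ℕ) (x : Fin m × Fin (k + 1) × Fin r → Bool) : Bool :=
  bparity fun i : Fin m =>
    decide (∀ j : Fin (k + 1), bparity (fun ℓ : Fin r => x (i, j, ℓ)) = true)

/-- `GIP_{m',k'}(x) = ⊕_{i∈[m']} ⋀_{j∈[k']} x_{i,j}`. -/
def GIP (m' k' : ℕ) (x : Fin m' × Fin k' → Bool) : Bool :=
  bparity fun i : Fin m' => decide (∀ j : Fin k', x (i, j) = true)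

/-- `g` contains a perfect copy of `GIP_{m',k'}`: there is a restriction `κ`
whose free variables are exactly the range of an injection `e` from the GIP
index set, and bits `b`, `bb i j`, such that `g↾κ` is the corresponding
shifted/negated copy of GIP. -/
def ContainsGIP {ι : Type} (m' k' : ℕ) (g : (ι → Bool) → Bool) : Prop :=
  ∃ (κ : ι → Option Bool) (e : Fin m' × Fin k' → ι) (b : Bool)
    (bb : Fin m' × Fin k' → Bool),
    Function.Injective e ∧ (∀ v, κ v = none ↔ v ∈ Set.range e) ∧
    ∀ x : ι → Bool,
      g (applyR κ x) =
        xor b (bparity fun i : Fin m' =>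
          decide (∀ j : Fin k', xor (bb (i, j)) (x (e (i, j))) = true))

/-- `g` contains a perfect copy of `RW_{m',k',r'}`, analogously. -/
def ContainsRW {ι : Type} (m' k' r' : ℕ) (g : (ι → Bool) → Bool) : Prop :=
  ∃ (κ : ι → Option Bool) (e : Fin m' × Fin (k' + 1) × Fin r' → ι) (b : Bool)
    (bb : Fin m' × Fin (k' + 1) → Bool),
    Function.Injective e ∧ (∀ v, κ v = none ↔ v ∈ Set.range e) ∧
    ∀ x : ι → Bool,
      g (applyR κ x) =
        xor b (bparity fun i : Fin m' =>
          decide (∀ j : Fin (k' + 1),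
            xor (bb (i, j)) (bparity fun ℓ : Fin r' => x (e (i, j, ℓ))) = true))

/-! ### Restrictions, trees -/

section CTsec

variable {ι : Type} [DecidableEq ι]

/-- Compose restrictions: first `κ`, then `ρ` on the remaining variables. -/
def compR (κ ρ : ι → Option Bool) : ι → Option Bool := fun v => (κ v).elim (ρ v) some

/-- Set the variables in `K` according to `x`. -/
def setR (ρ : ι → Option Bool) (K : Finset ι) (x : ι → Bool) : ι → Option Bool :=
  fun v => if v ∈ K then some (x v) else ρ v

/-- there is a decision tree of depth at most `D` from `σ`, all of whose leaves satisfy `Q`. -/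
def CT (Q : (ι → Option Bool) → Prop) : ℕ → (ι → Option Bool) → Prop
  | 0, σ => Q σ
  | D + 1, σ => Q σ ∨ ∃ v, σ v = none ∧ ∀ b, CT Q D (Function.update σ v (some b))

def ConstR (f : (ι → Bool) → Bool) (σ : ι → Option Bool) : Prop :=
  ∃ b, ∀ x, f (applyR σ x) = b

/-- decision tree depth of `f` restricted to `σ` is at most `w`. -/
def DD (f : (ι → Bool) → Bool) (w : ℕ) (σ : ι → Option Bool) : Prop := CT (ConstR f) w σ

theorem CT_of {Q : (ι → Option Bool) → Prop} {D : ℕ} {σ} (h : Q σ) : CT Q D σ := by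
  cases D with
  | zero => exact h
  | succ D => exact Or.inl h

theorem CT_succ {Q : (ι → Option Bool) → Prop} {D : ℕ} : ∀ {σ}, CT Q D σ → CT Q (D + 1) σ := by
  induction D with
  | zero => intro σ h; exact Or.inl h
  | succ D ih =>
    rintro σ (h | ⟨v, hv, h⟩)
    · exact Or.inl h
    · exact Or.inr ⟨v, hv, fun b => ih (h b)⟩

theorem CT_mono {Q : (ι → Option Bool) → Prop} {D D' : ℕ} (hD : D ≤ D') {σ} (h : CT Q D σ) :
    CT Q D' σ := by
  induction hD with
  | refl => exact h
  | step _ ih => exact CT_succ ih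

theorem CT_imp {Q Q' : (ι → Option Bool) → Prop} (hQ : ∀ σ, Q σ → Q' σ) {D : ℕ} :
    ∀ {σ}, CT Q D σ → CT Q' D σ := by
  induction D with
  | zero => intro σ h; exact hQ _ h
  | succ D ih =>
    rintro σ (h | ⟨v, hv, h⟩)
    · exact Or.inl (hQ _ h)
    · exact Or.inr ⟨v, hv, fun b => ih (h b)⟩

theorem compR_update_left {κ ρ : ι → Option Bool} {v : ι} (hv : κ v = none) (b : Bool) :
    Function.update (compR κ ρ) v (some b) = compR κ (Function.update ρ v (some b)) := by
  funext u
  by_cases h : u = v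
  · subst h; simp [compR, hv]
  · simp [compR, h]

theorem compR_update_fixed {κ ρ : ι → Option Bool} {v : ι} {c : Bool} (hv : κ v = some c) (o) :
    compR κ (Function.update ρ v o) = compR κ ρ := by
  funext u
  by_cases h : u = v
  · subst h; simp [compR, hv]
  · simp [compR, h]

theorem CT_map {Q Q' : (ι → Option Bool) → Prop} {κ : ι → Option Bool}
    (hQ : ∀ σ, Q σ → Q' (compR κ σ)) {D : ℕ} :
    ∀ {σ}, CT Q D σ → CT Q' D (compR κ σ) := by
  induction D with
  | zero => intro σ h; exact hQ _ h
  | succ D ih =>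
    rintro σ (h | ⟨v, hv, h⟩)
    · exact Or.inl (hQ _ h)
    · cases hk : κ v with
      | none =>
        refine Or.inr ⟨v, by simp [compR, hk, hv], fun b => ?_⟩
        rw [compR_update_left hk]
        exact ih (h b)
      | some c =>
        have := ih (h true)
        rw [compR_update_fixed hk] at this
        exact CT_succ this

theorem setR_insert (σ : ι → Option Bool) {K : Finset ι} {v : ι} (hv : v ∉ K) (x : ι → Bool) :
    setR σ (insert v K) x = setR (Function.update σ v (some (x v))) K x := by
  funext u
  by_cases h : u = v
  · subst h; simp [setR, hv]
  · simp [setR, h]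

theorem setR_congr (σ : ι → Option Bool) {K : Finset ι} {x y : ι → Bool}
    (h : ∀ v ∈ K, x v = y v) : setR σ K x = setR σ K y := by
  funext u
  by_cases hu : u ∈ K
  · simp [setR, hu, h u hu]
  · simp [setR, hu]

theorem CT_set {Q : (ι → Option Bool) → Prop} {a : ℕ} (K : Finset ι) :
    ∀ {σ : ι → Option Bool}, (∀ v ∈ K, σ v = none) → (∀ x, CT Q a (setR σ K x)) →
      CT Q (a + K.card) σ := by
  induction K using Finset.induction_on with
  | empty =>
    intro σ _ h
    have := h (fun _ => true)
    have e : setR σ ∅ (fun _ => true) = σ := by funext u; simp [setR]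
    rw [e] at this
    simpa using this
  | insert v K hv ih =>
    intro σ hf h
    rw [card_insert_of_notMem hv]
    refine Or.inr ⟨v, hf v (by simp), fun b => ?_⟩
    apply ih
    · intro u hu
      have : u ≠ v := by rintro rfl; exact hv hu
      simp [this, hf u (by simp [hu])]
    · intro x
      have := h (Function.update x v b)
      rw [setR_insert _ hv] at this
      simp only [Function.update_self] at this
      rwa [setR_congr _ (y := x)] at this
      intro u hu
      have : u ≠ v := by rintro rfl; exact hv hu
      simp [this]

theorem applyR_compR (κ ρ : ι → Option Bool) (x : ι → Bool) :
    applyR (compR κ ρ) x = applyR κ (applyR ρ x) := by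
  funext v
  simp only [applyR, compR]
  cases κ v <;> simp

theorem DD_comp {f : (ι → Bool) → Bool} {κ : ι → Option Bool} {w : ℕ} {σ}
    (h : DD (fun x => f (applyR κ x)) w σ) : DD f w (compR κ σ) := by
  refine CT_map ?_ h
  rintro σ ⟨b, hb⟩
  exact ⟨b, fun x => by rw [applyR_compR]; exact hb x⟩

theorem DD_not {f : (ι → Bool) → Bool} {w : ℕ} {σ}
    (h : DD f w σ) : DD (fun x => !(f x)) w σ := by
  refine CT_imp ?_ h
  rintro σ ⟨b, hb⟩
  exact ⟨!b, fun x => by simp [hb x]⟩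

/-! DNFs -/

def termSat (T : Finset ι × (ι → Bool)) (x : ι → Bool) : Prop := ∀ v ∈ T.1, x v = T.2 v

def dnfSat (L : List (Finset ι × (ι → Bool))) (x : ι → Bool) : Prop := ∃ T ∈ L, termSat T x

/-- A function of small decision depth at `κ` is a small width DNF there. -/
theorem DD_dnf {f : (ι → Bool) → Bool} {w : ℕ} : ∀ {κ}, DD f w κ →
    ∃ L : List (Finset ι × (ι → Bool)), (∀ T ∈ L, T.1.card ≤ w ∧ ∀ v ∈ T.1, κ v = none) ∧
      ∀ x, (f (applyR κ x) = true ↔ dnfSat L x) := by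
  have base : ∀ {w κ}, ConstR f κ →
      ∃ L : List (Finset ι × (ι → Bool)), (∀ T ∈ L, T.1.card ≤ w ∧ ∀ v ∈ T.1, κ v = none) ∧
      ∀ x, (f (applyR κ x) = true ↔ dnfSat L x) := by
    rintro w κ ⟨b, hb⟩
    cases b with
    | false => exact ⟨[], by simp, fun x => by simp [hb x, dnfSat]⟩
    | true => exact ⟨[(∅, fun _ => true)], by simp, fun x => by simp [hb x, dnfSat, termSat]⟩
  induction w with
  | zero => intro κ h; exact base h
  | succ w ih =>
    rintro κ (h | ⟨v, hv, h⟩)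
    · exact base h
    · obtain ⟨L0, h0, h0'⟩ := ih (h false)
      obtain ⟨L1, h1, h1'⟩ := ih (h true)
      refine ⟨L0.map (fun T => (insert v T.1, Function.update T.2 v false)) ++
        L1.map (fun T => (insert v T.1, Function.update T.2 v true)), ?_, ?_⟩
      · have key : ∀ b, ∀ L : List (Finset ι × (ι → Bool)),
          (∀ T ∈ L, T.1.card ≤ w ∧ ∀ u ∈ T.1, Function.update κ v (some b) u = none) →
          ∀ T ∈ L.map (fun T => (insert v T.1, Function.update T.2 v b)),
            T.1.card ≤ w + 1 ∧ ∀ v ∈ T.1, κ v = none := by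
          intro b L hL T hT
          obtain ⟨T', hT', rfl⟩ := List.mem_map.1 hT
          obtain ⟨h1, h2⟩ := hL T' hT'
          refine ⟨(card_insert_le _ _).trans (by omega), ?_⟩
          intro u hu
          rcases mem_insert.1 hu with rfl | hu
          · exact hv
          · have := h2 u hu
            by_cases huv : u = v
            · subst huv; exact hv
            · simpa [huv] using this
        intro T hT
        rcases List.mem_append.1 hT with hT | hT
        · exact key _ _ h0 T hT
        · exact key _ _ h1 T hT
      · intro x
        have e : applyR κ x = applyR (Function.update κ v (some (x v))) x := by
          funext u
          by_cases huv : u = v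
          · subst huv; simp [applyR, hv]
          · simp [applyR, huv]
        have key : ∀ b, ∀ L : List (Finset ι × (ι → Bool)),
          (∀ T ∈ L, T.1.card ≤ w ∧ ∀ u ∈ T.1, Function.update κ v (some b) u = none) →
          (dnfSat (L.map (fun T => (insert v T.1, Function.update T.2 v b))) x ↔
            x v = b ∧ dnfSat L x) := by
          intro b L hL
          simp only [dnfSat, List.mem_map]
          constructor
          · rintro ⟨_, ⟨T, hT, rfl⟩, hs⟩
            have hvT : v ∉ T.1 := by
              intro hvT
              have := (hL T hT).2 v hvT
              simp at this
            refine ⟨by simpa using hs v (by simp), T, hT, fun u hu => ?_⟩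
            have huv : u ≠ v := by rintro rfl; exact hvT hu
            simpa [huv] using hs u (by simp [hu])
          · rintro ⟨hb, T, hT, hs⟩
            refine ⟨_, ⟨T, hT, rfl⟩, fun u hu => ?_⟩
            by_cases huv : u = v
            · subst huv; simp [hb]
            · have hu : u ∈ T.1 := by simpa [huv] using hu
              simpa [huv] using hs u hu
        have app : ∀ A B : List (Finset ι × (ι → Bool)), dnfSat (A ++ B) x ↔ dnfSat A x ∨ dnfSat B x := by
          intro A B
          simp only [dnfSat, List.mem_append]
          constructor
          · rintro ⟨T, hT | hT, h⟩
            · exact Or.inl ⟨T, hT, h⟩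
            · exact Or.inr ⟨T, hT, h⟩
          · rintro (⟨T, hT, h⟩ | ⟨T, hT, h⟩)
            · exact ⟨T, Or.inl hT, h⟩
            · exact ⟨T, Or.inr hT, h⟩
        rw [app, key _ _ h0, key _ _ h1, e]
        cases hxv : x v with
        | false => simpa using h0' x
        | true => simpa using h1' x

end CTsec

/-! ### Multi-switching: canonical paths -/

section MSsec

variable {ι : Type} [DecidableEq ι]

def falsT (ρ : ι → Option Bool) (T : Finset ι × (ι → Bool)) : Prop :=
  ∃ v ∈ T.1, ρ v = some (!T.2 v)

open Classical in
noncomputable def firstT (L : List (Finset ι × (ι → Bool))) (ρ : ι → Option Bool) :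
    Option (Finset ι × (ι → Bool)) := L.find? (fun T => decide (¬ falsT ρ T))

def freeV (T : Finset ι × (ι → Bool)) (ρ : ι → Option Bool) : Finset ι :=
  T.1.filter (fun v => ρ v = none)

inductive CPath (L : List (Finset ι × (ι → Bool))) : (ι → Option Bool) → Finset ι → Prop
  | nil (ρ) : CPath L ρ ∅
  | step {ρ : ι → Option Bool} {T : Finset ι × (ι → Bool)} {K2 : Finset ι} (x : ι → Bool) :
      firstT L ρ = some T → (freeV T ρ).Nonempty →
      CPath L (setR ρ (freeV T ρ) x) K2 → CPath L ρ (freeV T ρ ∪ K2)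

theorem setR_none {ρ : ι → Option Bool} {K : Finset ι} {x : ι → Bool} {v : ι}
    (h : setR ρ K x v = none) : v ∉ K ∧ ρ v = none := by
  unfold setR at h
  split_ifs at h with hv
  exact ⟨hv, h⟩

theorem CPath.free {L : List (Finset ι × (ι → Bool))} {ρ K} (h : CPath L ρ K) :
    ∀ v ∈ K, ρ v = none := by
  induction h with
  | nil => simp
  | step x h1 h2 h3 ih =>
    intro v hv
    rcases mem_union.1 hv with hv | hv
    · exact (mem_filter.1 hv).2
    · exact (setR_none (ih v hv)).2

theorem CPath.disj {L : List (Finset ι × (ι → Bool))} {ρ : ι → Option Bool} {K1 K2 x}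
    (h : CPath L (setR ρ K1 x) K2) : Disjoint K1 K2 := by
  rw [disjoint_left]
  intro v h1 h2
  exact (setR_none (h.free v h2)).1 h1

theorem firstT_some {L : List (Finset ι × (ι → Bool))} {ρ T} (h : firstT L ρ = some T) :
    T ∈ L ∧ ¬ falsT ρ T := by
  classical
  unfold firstT at h
  have h1 := List.find?_some h
  exact ⟨List.mem_of_find?_eq_some h, by simpa using h1⟩

theorem firstT_none {L : List (Finset ι × (ι → Bool))} {ρ} (h : firstT L ρ = none) :
    ∀ T ∈ L, falsT ρ T := by
  classical
  unfold firstT at h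
  rw [List.find?_eq_none] at h
  intro T hT
  simpa using h T hT

def extR (ρ τ : ι → Option Bool) : Prop := ∀ v b, ρ v = some b → τ v = some b

theorem firstT_ext {L : List (Finset ι × (ι → Bool))} {ρ τ T} (hρ : extR ρ τ)
    (h : firstT L ρ = some T) (hT : ¬ falsT τ T) : firstT L τ = some T := by
  classical
  have mono : ∀ T, falsT ρ T → falsT τ T := fun T ⟨v, hv, h⟩ => ⟨v, hv, hρ _ _ h⟩
  unfold firstT at h ⊢
  induction L with
  | nil => simp at h
  | cons A L ih =>
    rw [List.find?_cons] at h ⊢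
    by_cases hA : falsT ρ A
    · simp only [hA, not_true, decide_false] at h
      simp only [mono _ hA, not_true, decide_false]
      exact ih h
    · simp only [hA, not_false_eq_true, decide_true] at h
      obtain rfl : A = T := by simpa using h
      simp [hT]

theorem DD_of_noPath {f : (ι → Bool) → Bool} {L : List (Finset ι × (ι → Bool))}
    (hf : ∀ x, f x = true ↔ dnfSat L x) (l : ℕ) : ∀ {ρ : ι → Option Bool},
    (∀ K, CPath L ρ K → K.card ≤ l) → DD f l ρ := by
  induction l using Nat.strong_induction_on with
  | _ l ih =>
    intro ρ h
    cases hT : firstT L ρ with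
    | none =>
      apply CT_of
      refine ⟨false, fun x => ?_⟩
      rw [← Bool.not_eq_true, hf]
      rintro ⟨T, hTL, hs⟩
      obtain ⟨v, hv, hv'⟩ := firstT_none hT T hTL
      have := hs v hv
      simp [applyR, hv'] at this
    | some T =>
      obtain ⟨hTL, hnf⟩ := firstT_some hT
      by_cases hK : (freeV T ρ).Nonempty
      · have hc := h _ (CPath.step (fun _ => true) hT hK (CPath.nil _))
        rw [union_empty] at hc
        have hpos := hK.card_pos
        have : CT (ConstR f) (l - (freeV T ρ).card + (freeV T ρ).card) ρ := by
          apply CT_set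
          · intro v hv; exact (mem_filter.1 hv).2
          · intro x
            apply ih _ (by omega)
            intro K hp
            have := h _ (CPath.step x hT hK hp)
            rw [card_union_of_disjoint hp.disj] at this
            omega
        rwa [Nat.sub_add_cancel hc] at this
      · apply CT_of
        refine ⟨true, fun x => ?_⟩
        rw [hf]
        refine ⟨T, hTL, fun v hv => ?_⟩
        cases hρ : ρ v with
        | none => exact absurd ⟨v, mem_filter.2 ⟨hv, hρ⟩⟩ hK
        | some b =>
          simp only [applyR, hρ, Option.getD_some]
          by_contra hb
          exact hnf ⟨v, hv, by rw [hρ]; cases b <;> cases h2 : T.2 v <;> simp_all⟩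

inductive BadP {I : Type} (F : I → List (Finset ι × (ι → Bool))) (l : ℕ) :
    ℕ → (ι → Option Bool) → Finset ι → Prop
  | zero (ρ) : BadP F l 0 ρ ∅
  | step {s : ℕ} {ρ : ι → Option Bool} {K1 K2 : Finset ι} (i : I) (x : ι → Bool) :
      0 < s → CPath (F i) ρ K1 → l < K1.card →
      BadP F l (s - K1.card) (setR ρ K1 x) K2 → BadP F l s ρ (K1 ∪ K2)

theorem BadP.free {I : Type} {F : I → List (Finset ι × (ι → Bool))} {l s ρ K}
    (h : BadP F l s ρ K) : ∀ v ∈ K, ρ v = none := by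
  induction h with
  | zero => simp
  | step i x h0 h1 h2 h3 ih =>
    intro v hv
    rcases mem_union.1 hv with hv | hv
    · exact h1.free v hv
    · exact (setR_none (ih v hv)).2

theorem BadP.disj {I : Type} {F : I → List (Finset ι × (ι → Bool))} {l s}
    {ρ : ι → Option Bool} {K1 K2 x}
    (h : BadP F l s (setR ρ K1 x) K2) : Disjoint K1 K2 := by
  rw [disjoint_left]
  intro v h1 h2
  exact (setR_none (h.free v h2)).1 h1

theorem BadP.card_le {I : Type} {F : I → List (Finset ι × (ι → Bool))} {l s ρ K}
    (h : BadP F l s ρ K) : s ≤ K.card := by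
  induction h with
  | zero => simp
  | step i x h0 h1 h2 h3 ih =>
    rw [card_union_of_disjoint h3.disj]
    omega

theorem CT_of_noBad {I : Type} {f : I → (ι → Bool) → Bool} {F : I → List (Finset ι × (ι → Bool))}
    (hf : ∀ i x, f i x = true ↔ dnfSat (F i) x) (l t : ℕ) : ∀ {ρ : ι → Option Bool},
    (∀ K, ¬ BadP F l (t + 1) ρ K) → CT (fun σ => ∀ i, DD (f i) l σ) t ρ := by
  induction t using Nat.strong_induction_on with
  | _ t ih =>
    intro ρ h
    by_cases hall : ∀ i, ∀ K, CPath (F i) ρ K → K.card ≤ l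
    · exact CT_of (fun i => DD_of_noPath (hf i) l (hall i))
    · push Not at hall
      obtain ⟨i, K, hp, hl⟩ := hall
      have hc : K.card ≤ t := by
        by_contra hc
        refine h _ (BadP.step (K2 := ∅) i (fun _ => true) (by omega) hp hl ?_)
        have : t + 1 - K.card = 0 := by omega
        rw [this]
        exact BadP.zero _
      have : CT (fun σ => ∀ i, DD (f i) l σ) (t - K.card + K.card) ρ := by
        apply CT_set
        · exact hp.free
        · intro x
          apply ih _ (by omega)
          intro K2 hb
          refine h _ (BadP.step (K2 := K2) i x (by omega) hp hl ?_)
          have e : t + 1 - K.card = t - K.card + 1 := by omega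
          rwa [e]
      rwa [Nat.sub_add_cancel hc] at this

/-! weights -/

def indB (X : Finset ι) : ι → Bool := fun v => decide (v ∈ X)

noncomputable def pathW (L : List (Finset ι × (ι → Bool))) (u : ℝ) :
    ℕ → (ι → Option Bool) → (Finset ι → ℝ) → ℝ
  | 0, _, Φ => Φ ∅
  | N + 1, τ, Φ => Φ ∅ + ∑ P ∈ ((firstT L τ).elim ∅ (fun T => T.1.powerset.erase ∅)),
      ∑ X ∈ P.powerset, u ^ P.card * pathW L u N (setR τ P (indB X)) (fun K2 => Φ (P ∪ K2))

theorem pathW_nonneg (L : List (Finset ι × (ι → Bool))) {u : ℝ} (hu : 0 ≤ u) (N : ℕ) :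
    ∀ τ (Φ : Finset ι → ℝ), (∀ K, 0 ≤ Φ K) → 0 ≤ pathW L u N τ Φ := by
  induction N with
  | zero => intro τ Φ h; exact h _
  | succ N ih =>
    intro τ Φ h
    exact add_nonneg (h _) (sum_nonneg fun P _ => sum_nonneg fun X _ =>
      mul_nonneg (pow_nonneg hu _) (ih _ _ fun K => h _))

theorem pathW_ge_empty (L : List (Finset ι × (ι → Bool))) {u : ℝ} (hu : 0 ≤ u) (N : ℕ)
    (τ) (Φ : Finset ι → ℝ) (h : ∀ K, 0 ≤ Φ K) : Φ ∅ ≤ pathW L u N τ Φ := by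
  cases N with
  | zero => exact le_rfl
  | succ N =>
    exact le_add_of_nonneg_right (sum_nonneg fun P _ => sum_nonneg fun X _ =>
      mul_nonneg (pow_nonneg hu _) (pathW_nonneg _ hu _ _ _ fun K => h _))

theorem pathW_sum (L : List (Finset ι × (ι → Bool))) (u : ℝ) {A : Type} (s : Finset A) (N : ℕ) :
    ∀ τ (Φ : A → Finset ι → ℝ),
      pathW L u N τ (fun K => ∑ a ∈ s, Φ a K) = ∑ a ∈ s, pathW L u N τ (Φ a) := by
  induction N with
  | zero => intro τ Φ; rfl
  | succ N ih =>
    intro τ Φ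
    simp only [pathW]
    rw [sum_add_distrib]
    congr 1
    rw [sum_comm]
    refine sum_congr rfl fun P _ => ?_
    rw [sum_comm]
    refine sum_congr rfl fun X _ => ?_
    rw [ih _ (fun a K2 => Φ a (P ∪ K2)), mul_sum]

theorem sum_sub_pow (V : Finset ι) (u : ℝ) :
    ∑ P ∈ V.powerset.erase ∅, ∑ _X ∈ P.powerset, u ^ P.card = (1 + 2 * u) ^ V.card - 1 := by
  have h : ∑ P ∈ V.powerset, (2 * u) ^ P.card = (1 + 2 * u) ^ V.card := by
    have := Finset.prod_add (fun _ : ι => (2 * u)) (fun _ => (1:ℝ)) V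
    simp only [prod_const, one_pow, mul_one] at this
    rw [← this, add_comm]
  have e : ∀ P ∈ V.powerset.erase ∅, ∑ _X ∈ P.powerset, u ^ P.card = (2 * u) ^ P.card := by
    intro P _
    rw [sum_const, card_powerset, nsmul_eq_mul, mul_pow]; push_cast; rfl
  rw [sum_congr rfl e, ← h, ← add_sum_erase V.powerset _ (empty_mem_powerset V)]
  simp

theorem pathW_le (L : List (Finset ι × (ι → Bool))) {u : ℝ} (hu : 0 ≤ u) {w : ℕ}
    (hw : ∀ T ∈ L, T.1.card ≤ w) (huw : (1 + 2 * u) ^ w ≤ 5 / 3) {C : ℝ} (hC : 0 ≤ C) (N : ℕ) :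
    ∀ τ (Φ : Finset ι → ℝ), (∀ K, Φ K ≤ C) → pathW L u N τ Φ ≤ 3 * C := by
  induction N with
  | zero => intro τ Φ h; have := h ∅; simp only [pathW]; linarith
  | succ N ih =>
    intro τ Φ h
    simp only [pathW]
    cases hT : firstT L τ with
    | none => simp; have := h ∅; linarith
    | some T =>
      simp only [Option.elim]
      have h1 : ∑ P ∈ T.1.powerset.erase ∅, ∑ X ∈ P.powerset,
          u ^ P.card * pathW L u N (setR τ P (indB X)) (fun K2 => Φ (P ∪ K2)) ≤
          ∑ P ∈ T.1.powerset.erase ∅, ∑ X ∈ P.powerset, u ^ P.card * (3 * C) := by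
        refine sum_le_sum fun P _ => sum_le_sum fun X _ => ?_
        exact mul_le_mul_of_nonneg_left (ih _ _ fun K => h _) (pow_nonneg hu _)
      simp_rw [← sum_mul] at h1
      rw [sum_sub_pow] at h1
      have h2 : (1 + 2 * u) ^ T.1.card ≤ 5 / 3 :=
        (pow_le_pow_right₀ (by linarith) (hw T (firstT_some hT).1)).trans huw
      have := h ∅
      nlinarith

theorem setR_ind (τ : ι → Option Bool) (K : Finset ι) (x : ι → Bool) :
    setR τ K x = setR τ K (indB (K.filter (fun v => x v = true))) := by
  apply setR_congr
  intro v hv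
  cases h : x v <;> simp [indB, hv, h]

theorem enc_path {L : List (Finset ι × (ι → Bool))} {u : ℝ} (hu : 0 ≤ u) {ρ K}
    (h : CPath L ρ K) : ∃ y : ι → Bool, ∀ τ, extR (setR ρ K y) τ → ∀ N, K.card ≤ N →
      ∀ Φ : Finset ι → ℝ, (∀ K, 0 ≤ Φ K) → u ^ K.card * Φ K ≤ pathW L u N τ Φ := by
  induction h with
  | nil ρ =>
    refine ⟨fun _ => true, fun τ _ N _ Φ hΦ => ?_⟩
    simpa using pathW_ge_empty L hu N τ Φ hΦ
  | @step ρ T K2 x hT hK hp ih =>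
    obtain ⟨y2, hy2⟩ := ih
    set K1 := freeV T ρ with hK1
    have hd : Disjoint K1 K2 := hp.disj
    refine ⟨fun v => if v ∈ K1 then T.2 v else y2 v, fun τ hτ N hN Φ hΦ => ?_⟩
    rw [card_union_of_disjoint hd] at hN ⊢
    have hpos := hK.card_pos
    obtain ⟨N, rfl⟩ : ∃ N', N = N' + 1 := ⟨N - 1, by omega⟩
    have hρτ : extR ρ τ := by
      intro v b hv
      apply hτ
      have : v ∉ K1 ∪ K2 := by
        intro hm
        rcases mem_union.1 hm with hm | hm
        · rw [hK1] at hm; simp [(mem_filter.1 hm).2] at hv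
        · simp [(setR_none (hp.free v hm)).2] at hv
      simp [setR, this, hv]
    have hTs : ∀ v ∈ T.1, τ v = some (T.2 v) := by
      intro v hv
      cases hρ : ρ v with
      | none =>
        have : v ∈ K1 := mem_filter.2 ⟨hv, hρ⟩
        apply hτ
        simp [setR, this]
      | some b =>
        rw [hρτ _ _ hρ]
        by_contra hb
        exact (firstT_some hT).2 ⟨v, hv, by rw [hρ]; cases b <;> cases h2 : T.2 v <;> simp_all⟩
    have hTτ : firstT L τ = some T := by
      apply firstT_ext hρτ hT
      rintro ⟨v, hv, hv'⟩
      rw [hTs v hv] at hv'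
      simp at hv'
    simp only [pathW, hTτ, Option.elim]
    have e1 : extR (setR (setR ρ K1 x) K2 y2) (setR τ K1 x) := by
      intro v b hv
      by_cases h1 : v ∈ K1
      · have h2 : v ∉ K2 := disjoint_left.1 hd h1
        simpa [setR, h1, h2] using hv
      · by_cases h2 : v ∈ K2
        · simp only [setR, h2, if_true, h1, if_false] at hv ⊢
          apply hτ
          simp [setR, h1, h2, ← hv]
        · simp only [setR, h2, h1, if_false] at hv ⊢
          exact hρτ _ _ hv
    have e2 := hy2 _ e1 N (by omega) (fun K2 => Φ (K1 ∪ K2)) (fun K => hΦ _)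
    rw [setR_ind] at e2
    have e3 : u ^ K1.card * pathW L u N (setR τ K1 (indB (K1.filter (fun v => x v = true))))
        (fun K2 => Φ (K1 ∪ K2)) ≤ ∑ P ∈ T.1.powerset.erase ∅, ∑ X ∈ P.powerset,
          u ^ P.card * pathW L u N (setR τ P (indB X)) (fun K2 => Φ (P ∪ K2)) := by
      have nn : ∀ P X : Finset ι, 0 ≤ u ^ P.card * pathW L u N (setR τ P (indB X))
          (fun K2 => Φ (P ∪ K2)) := fun P X =>
        mul_nonneg (pow_nonneg hu _) (pathW_nonneg _ hu _ _ _ fun K => hΦ _)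
      have hm : K1 ∈ T.1.powerset.erase ∅ :=
        mem_erase.2 ⟨hK.ne_empty, mem_powerset.2 (filter_subset _ _)⟩
      refine le_trans ?_ (single_le_sum (f := fun P => ∑ X ∈ P.powerset,
          u ^ P.card * pathW L u N (setR τ P (indB X)) (fun K2 => Φ (P ∪ K2)))
          (fun P _ => sum_nonneg fun X _ => nn P X) hm)
      exact single_le_sum (f := fun X => u ^ K1.card * pathW L u N (setR τ K1 (indB X))
        (fun K2 => Φ (K1 ∪ K2))) (fun X _ => nn K1 X) (mem_powerset.2 (filter_subset _ _))
    have e4 : u ^ (K1.card + K2.card) * Φ (K1 ∪ K2) ≤ u ^ K1.card * pathW L u N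
        (setR τ K1 (indB (K1.filter (fun v => x v = true)))) (fun K2 => Φ (K1 ∪ K2)) := by
      rw [pow_add, mul_assoc]
      exact mul_le_mul_of_nonneg_left e2 (pow_nonneg hu _)
    have := hΦ ∅
    linarith

variable [Fintype ι]

noncomputable def stW {I : Type} [Fintype I] (F : I → List (Finset ι × (ι → Bool))) (u : ℝ) :
    ℕ → (ι → Option Bool) → (Finset ι → ℝ) → ℝ
  | 0, _, Φ => Φ ∅
  | j + 1, τ, Φ => Φ ∅ + ∑ i, pathW (F i) u (Fintype.card ι) τ (fun K =>
      ∑ X ∈ K.powerset, (1/2 : ℝ) ^ K.card * stW F u j (setR τ K (indB X)) (fun K2 => Φ (K ∪ K2)))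

theorem stW_nonneg {I : Type} [Fintype I] (F : I → List (Finset ι × (ι → Bool))) {u : ℝ}
    (hu : 0 ≤ u) (j : ℕ) :
    ∀ τ (Φ : Finset ι → ℝ), (∀ K, 0 ≤ Φ K) → 0 ≤ stW F u j τ Φ := by
  induction j with
  | zero => intro τ Φ h; exact h _
  | succ j ih =>
    intro τ Φ h
    exact add_nonneg (h _) (sum_nonneg fun i _ => pathW_nonneg _ hu _ _ _ fun K =>
      sum_nonneg fun X _ => mul_nonneg (by positivity) (ih _ _ fun K => h _))

theorem stW_sum {I : Type} [Fintype I] (F : I → List (Finset ι × (ι → Bool))) (u : ℝ)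
    {A : Type} (s : Finset A) (j : ℕ) :
    ∀ τ (Φ : A → Finset ι → ℝ),
      stW F u j τ (fun K => ∑ a ∈ s, Φ a K) = ∑ a ∈ s, stW F u j τ (Φ a) := by
  induction j with
  | zero => intro τ Φ; rfl
  | succ j ih =>
    intro τ Φ
    simp only [stW]
    rw [sum_add_distrib]
    congr 1
    rw [sum_comm]
    refine sum_congr rfl fun i _ => ?_
    rw [← pathW_sum]
    congr 1
    funext K
    rw [sum_comm]
    refine sum_congr rfl fun X _ => ?_
    rw [ih _ (fun a K2 => Φ a (K ∪ K2)), mul_sum]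

theorem stW_le {I : Type} [Fintype I] (F : I → List (Finset ι × (ι → Bool))) {u : ℝ}
    (hu : 0 ≤ u) {w : ℕ} (hw : ∀ i, ∀ T ∈ F i, T.1.card ≤ w) (huw : (1 + 2 * u) ^ w ≤ 5 / 3)
    {C : ℝ} (hC : 0 ≤ C) (j : ℕ) :
    ∀ τ (Φ : Finset ι → ℝ), (∀ K, Φ K ≤ C) →
      stW F u j τ Φ ≤ (3 * (Fintype.card I : ℝ) + 1) ^ j * C := by
  induction j with
  | zero => intro τ Φ h; simpa [stW] using h ∅
  | succ j ih =>
    intro τ Φ h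
    simp only [stW]
    set B : ℝ := (3 * (Fintype.card I : ℝ) + 1) ^ j * C with hB
    have hB0 : 0 ≤ B := by positivity
    have hCB : C ≤ B := by
      rw [hB]
      exact le_mul_of_one_le_left hC (one_le_pow₀ (by
        have : (0:ℝ) ≤ Fintype.card I := by positivity
        linarith))
    have h1 : ∑ i, pathW (F i) u (Fintype.card ι) τ (fun K =>
        ∑ X ∈ K.powerset, (1/2 : ℝ) ^ K.card * stW F u j (setR τ K (indB X))
          (fun K2 => Φ (K ∪ K2))) ≤ ∑ _i : I, 3 * B := by
      refine sum_le_sum fun i _ => pathW_le _ hu (hw i) huw hB0 _ _ _ fun K => ?_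
      calc _ ≤ ∑ X ∈ K.powerset, (1/2 : ℝ) ^ K.card * B :=
            sum_le_sum fun X _ => mul_le_mul_of_nonneg_left (ih _ _ fun K => h _) (by positivity)
        _ = B := by
            rw [sum_const, card_powerset, nsmul_eq_mul, ← mul_assoc]
            push_cast
            rw [← mul_pow]; norm_num
    rw [sum_const, card_univ, nsmul_eq_mul] at h1
    have := h ∅
    have e : (3 * (Fintype.card I : ℝ) + 1) ^ (j + 1) * C = (3 * (Fintype.card I : ℝ) + 1) * B := by
      rw [hB]; ring
    rw [e]
    linarith

theorem enc_bad {I : Type} [Fintype I] {F : I → List (Finset ι × (ι → Bool))} {u : ℝ}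
    (hu : 0 ≤ u) {l s ρ K}
    (h : BadP F l s ρ K) : ∃ y : ι → Bool, ∀ τ, extR (setR ρ K y) τ → ∀ j, s ≤ (l + 1) * j →
      ∀ Φ : Finset ι → ℝ, (∀ K, 0 ≤ Φ K) → (u / 2) ^ K.card * Φ K ≤ stW F u j τ Φ := by
  induction h with
  | zero ρ =>
    refine ⟨fun _ => true, fun τ _ j _ Φ hΦ => ?_⟩
    cases j with
    | zero => simp [stW]
    | succ j =>
      simp only [stW, card_empty, pow_zero, one_mul]
      exact le_add_of_nonneg_right (sum_nonneg fun i _ => pathW_nonneg _ hu _ _ _ fun K =>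
        sum_nonneg fun X _ => mul_nonneg (by positivity) (stW_nonneg _ hu _ _ _ fun K => hΦ _))
  | @step s ρ K1 K2 i x h0 hp hl hb ih =>
    obtain ⟨y2, hy2⟩ := ih
    obtain ⟨y1, hy1⟩ := enc_path hu hp
    have hd : Disjoint K1 K2 := hb.disj
    refine ⟨fun v => if v ∈ K1 then y1 v else y2 v, fun τ hτ j hj Φ hΦ => ?_⟩
    rw [card_union_of_disjoint hd]
    obtain ⟨j, rfl⟩ : ∃ j', j = j' + 1 := by
      refine ⟨j - 1, ?_⟩
      rcases j with _ | j
      · omega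
      · omega
    have hρτ : extR ρ τ := by
      intro v b hv
      apply hτ
      have : v ∉ K1 ∪ K2 := by
        intro hm
        rcases mem_union.1 hm with hm | hm
        · simp [hp.free v hm] at hv
        · simp [(setR_none (hb.free v hm)).2] at hv
      simp [setR, this, hv]
    simp only [stW]
    have e0 : extR (setR ρ K1 y1) τ := by
      intro v b hv
      by_cases h1 : v ∈ K1
      · apply hτ
        simpa [setR, h1] using hv
      · simp only [setR, h1, if_false] at hv
        exact hρτ _ _ hv
    have e1 : extR (setR (setR ρ K1 x) K2 y2) (setR τ K1 x) := by
      intro v b hv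
      by_cases h1 : v ∈ K1
      · have h2 : v ∉ K2 := disjoint_left.1 hd h1
        simpa [setR, h1, h2] using hv
      · by_cases h2 : v ∈ K2
        · simp only [setR, h2, if_true, h1, if_false] at hv ⊢
          apply hτ
          simp [setR, h1, h2, ← hv]
        · simp only [setR, h2, h1, if_false] at hv ⊢
          exact hρτ _ _ hv
    have e2 := hy2 _ e1 j (by
      have : (l + 1) * (j + 1) = (l + 1) * j + (l + 1) := by ring
      omega) (fun K2 => Φ (K1 ∪ K2)) (fun K => hΦ _)
    rw [setR_ind] at e2
    set Ψ : Finset ι → ℝ := fun K => ∑ X ∈ K.powerset, (1/2 : ℝ) ^ K.card *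
      stW F u j (setR τ K (indB X)) (fun K2 => Φ (K ∪ K2)) with hΨ
    have nn : ∀ K X : Finset ι, 0 ≤ (1/2 : ℝ) ^ K.card *
      stW F u j (setR τ K (indB X)) (fun K2 => Φ (K ∪ K2)) := fun K X =>
        mul_nonneg (by positivity) (stW_nonneg _ hu _ _ _ fun K => hΦ _)
    have hΨ0 : ∀ K, 0 ≤ Ψ K := fun K => sum_nonneg fun X _ => nn K X
    have e3 := hy1 τ e0 (Fintype.card ι) (card_le_univ _) Ψ hΨ0
    have e4 : (1/2 : ℝ) ^ K1.card * ((u / 2) ^ K2.card * Φ (K1 ∪ K2)) ≤ Ψ K1 := by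
      refine le_trans (mul_le_mul_of_nonneg_left e2 (by positivity)) ?_
      exact single_le_sum (f := fun X => (1/2 : ℝ) ^ K1.card *
        stW F u j (setR τ K1 (indB X)) (fun K2 => Φ (K1 ∪ K2))) (fun X _ => nn K1 X)
        (mem_powerset.2 (filter_subset _ _))
    have e5 : pathW (F i) u (Fintype.card ι) τ Ψ ≤ ∑ i, pathW (F i) u (Fintype.card ι) τ Ψ :=
      single_le_sum (f := fun i => pathW (F i) u (Fintype.card ι) τ Ψ)
        (fun i _ => pathW_nonneg _ hu _ _ _ hΨ0) (mem_univ i)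
    have e6 : (u / 2) ^ (K1.card + K2.card) * Φ (K1 ∪ K2) ≤ u ^ K1.card * Ψ K1 := by
      have : (u / 2) ^ (K1.card + K2.card) * Φ (K1 ∪ K2) =
        u ^ K1.card * ((1/2 : ℝ) ^ K1.card * ((u / 2) ^ K2.card * Φ (K1 ∪ K2))) := by
        rw [pow_add, ← mul_assoc, ← mul_assoc, ← mul_pow]; ring
      rw [this]
      exact mul_le_mul_of_nonneg_left e4 (pow_nonneg hu _)
    have := hΦ ∅
    linarith

theorem sum_codes {I : Type} [Fintype I] {F : I → List (Finset ι × (ι → Bool))} {u : ℝ}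
    (hu : 0 ≤ u) {w : ℕ} (hw : ∀ i, ∀ T ∈ F i, T.1.card ≤ w) (huw : (1 + 2 * u) ^ w ≤ 5 / 3)
    (j : ℕ) (τ : ι → Option Bool) (S : Finset (Finset ι))
    (hS : ∀ K ∈ S, ∀ Φ : Finset ι → ℝ, (∀ K, 0 ≤ Φ K) →
      (u / 2) ^ K.card * Φ K ≤ stW F u j τ Φ) :
    ∑ K ∈ S, (u / 2) ^ K.card ≤ (3 * (Fintype.card I : ℝ) + 1) ^ j := by
  calc ∑ K ∈ S, (u / 2) ^ K.card ≤ ∑ K ∈ S, stW F u j τ (fun K' => if K = K' then 1 else 0) := by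
        refine sum_le_sum fun K hK => ?_
        have := hS K hK (fun K' => if K = K' then 1 else 0) (fun K' => by split_ifs <;> norm_num)
        simpa using this
    _ = stW F u j τ (fun K' => ∑ K ∈ S, if K = K' then 1 else 0) := (stW_sum _ _ _ _ _ _).symm
    _ ≤ (3 * (Fintype.card I : ℝ) + 1) ^ j * 1 := by
        refine stW_le F hu hw huw zero_le_one j τ _ fun K' => ?_
        rw [sum_ite_eq' S K']
        split_ifs <;> norm_num
    _ = _ := mul_one _

end MSsec

/-! ### Random restrictions -/

section Prsec

variable {ι : Type} [DecidableEq ι] [Fintype ι]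

theorem prod_push {A B C : Type} [Fintype A] [Fintype B] [Fintype C] [DecidableEq C]
    (f : A → ℝ) (g : B → ℝ) (φ : A → B → C) (h : C → ℝ)
    (hh : ∀ c, h c = ∑ ab : A × B, if φ ab.1 ab.2 = c then f ab.1 * g ab.2 else 0)
    (G : (ι → C) → ℝ) :
    ∑ a : ι → A, ∑ b : ι → B, (∏ v, f (a v)) * (∏ v, g (b v)) * G (fun v => φ (a v) (b v)) =
      ∑ c : ι → C, (∏ v, h (c v)) * G c := by
  have e1 : ∀ c : ι → C, ∏ v, h (c v) = ∑ ab : ι → A × B,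
      if (fun v => φ (ab v).1 (ab v).2) = c then ∏ v, (f (ab v).1 * g (ab v).2) else 0 := by
    intro c
    simp_rw [hh]
    rw [Finset.prod_univ_sum, Fintype.piFinset_univ]
    refine sum_congr rfl fun ab _ => ?_
    rw [Finset.prod_ite_zero]
    congr 1
    simp [funext_iff]
  simp_rw [e1, sum_mul]
  symm
  rw [sum_comm]
  simp only [ite_mul, zero_mul, sum_ite_eq, mem_univ, if_true]
  rw [← (Equiv.arrowProdEquivProdArrow ι (fun _ => A) (fun _ => B)).symm.sum_comp, Fintype.sum_prod_type]
  refine sum_congr rfl fun a _ => sum_congr rfl fun b _ => ?_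
  simp [Equiv.arrowProdEquivProdArrow, prod_mul_distrib]

theorem Rp_nonneg {p : ℝ} (h0 : 0 ≤ p) (h1 : p ≤ 1) (ρ : ι → Option Bool) :
    0 ≤ RpDensity p ρ := by
  unfold RpDensity
  refine prod_nonneg fun i _ => ?_
  cases ρ i with
  | none => exact h0
  | some b => simp; linarith

theorem Rp_prod_sum (p : ℝ) (g : ι → Option Bool → ℝ) :
    ∑ ρ : ι → Option Bool, RpDensity p ρ * ∏ v, g v (ρ v) =
      ∏ v, (p * g v none + (1 - p) / 2 * g v (some true) + (1 - p) / 2 * g v (some false)) := by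
  have : ∀ v, (p * g v none + (1 - p) / 2 * g v (some true) + (1 - p) / 2 * g v (some false)) =
      ∑ o : Option Bool, (o.elim p (fun _ => (1 - p) / 2)) * g v o := by
    intro v
    rw [Fintype.sum_option, Fintype.sum_bool]; simp [add_assoc]
  simp_rw [this]
  rw [Finset.prod_univ_sum, Fintype.piFinset_univ]
  refine sum_congr rfl fun ρ _ => ?_
  rw [RpDensity, ← prod_mul_distrib]

theorem Rp_sum (p : ℝ) : ∑ ρ : ι → Option Bool, RpDensity p ρ = 1 := by
  have := Rp_prod_sum (ι := ι) p (fun _ _ => 1)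
  simp only [prod_const_one, mul_one] at this
  rw [this]
  apply prod_eq_one
  intro v _
  ring

theorem Rp_comp (p q : ℝ) (G : (ι → Option Bool) → ℝ) :
    ∑ ρ : ι → Option Bool, ∑ ρ' : ι → Option Bool,
      RpDensity p ρ * RpDensity q ρ' * G (compR ρ ρ') =
      ∑ ρ : ι → Option Bool, RpDensity (p * q) ρ * G ρ := by
  unfold RpDensity
  refine prod_push (fun o : Option Bool => o.elim p (fun _ => (1 - p) / 2))
    (fun o : Option Bool => o.elim q (fun _ => (1 - q) / 2)) (fun a b => a.elim b some)
    (fun o : Option Bool => o.elim (p * q) (fun _ => (1 - p * q) / 2)) ?_ G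
  intro c
  rw [Fintype.sum_prod_type]
  simp only [Fintype.sum_option, Fintype.sum_bool]
  rcases c with _ | _ | _ <;> simp <;> ring

noncomputable def avg (G : (ι → Bool) → ℝ) : ℝ := ∑ x : ι → Bool, (1/2 : ℝ) ^ Fintype.card ι * G x

theorem Rp_fair (p : ℝ) (G : (ι → Bool) → ℝ) :
    ∑ ρ : ι → Option Bool, RpDensity p ρ * avg (fun x => G (applyR ρ x)) = avg G := by
  have := prod_push (ι := ι) (fun o : Option Bool => o.elim p (fun _ => (1 - p) / 2))
    (fun _ : Bool => (1/2 : ℝ)) (fun a b => a.getD b) (fun _ : Bool => (1/2 : ℝ)) (by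
      intro c
      rw [Fintype.sum_prod_type]
      simp only [Fintype.sum_option, Fintype.sum_bool]
      rcases c with _ | _ <;> simp <;> ring) G
  simp only [prod_const, card_univ] at this
  unfold avg
  rw [← this]
  refine sum_congr rfl fun ρ _ => ?_
  rw [mul_sum]
  refine sum_congr rfl fun x _ => ?_
  rw [RpDensity, mul_assoc]; rfl

theorem prOf_nonneg {α : Type} [Fintype α] {R : α → ℝ} (hR : ∀ a, 0 ≤ R a) (P : α → Prop) :
    0 ≤ prOf R P := by
  classical
  exact sum_nonneg fun a _ => by split_ifs; exacts [hR a, le_rfl]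

theorem prOf_mono {α : Type} [Fintype α] {R : α → ℝ} (hR : ∀ a, 0 ≤ R a) {P P' : α → Prop}
    (h : ∀ a, P a → P' a) : prOf R P ≤ prOf R P' := by
  classical
  refine sum_le_sum fun a _ => ?_
  by_cases h1 : P a
  · simp [h1, h a h1]
  · simp only [h1, if_false]; split_ifs; exacts [hR a, le_rfl]

theorem prOf_or {α : Type} [Fintype α] {R : α → ℝ} (hR : ∀ a, 0 ≤ R a) (P P' : α → Prop) :
    prOf R (fun a => P a ∨ P' a) ≤ prOf R P + prOf R P' := by
  classical
  unfold prOf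
  rw [← sum_add_distrib]
  refine sum_le_sum fun a _ => ?_
  have := hR a
  by_cases h1 : P a <;> by_cases h2 : P' a <;> simp [h1, h2, this]

theorem prOf_exists {α β : Type} [Fintype α] [Fintype β] {R : α → ℝ} (hR : ∀ a, 0 ≤ R a)
    (P : β → α → Prop) :
    prOf R (fun a => ∃ b, P b a) ≤ ∑ b, prOf R (P b) := by
  classical
  unfold prOf
  rw [sum_comm]
  refine sum_le_sum fun a _ => ?_
  have nn : ∀ b ∈ univ, 0 ≤ (if P b a then R a else 0) := fun b _ => by
    split_ifs; exacts [hR a, le_rfl]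
  split_ifs with h
  · obtain ⟨b, hb⟩ := h
    have := single_le_sum nn (mem_univ b)
    simpa [hb] using this
  · exact sum_nonneg nn

theorem round_lemma {Q1 Q2 : (ι → Option Bool) → Prop} {t2 : ℕ} {ε p : ℝ} (h0 : 0 ≤ p)
    (h1 : p ≤ 1)
    (h : ∀ σ, Q1 σ → prOf (RpDensity p) (fun ρ => ¬ CT Q2 t2 (compR σ ρ)) ≤ ε) (t1 : ℕ) :
    ∀ σ, CT Q1 t1 σ → prOf (RpDensity p) (fun ρ => ¬ CT Q2 (t1 + t2) (compR σ ρ)) ≤ 2 ^ t1 * ε := by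
  have base : ∀ t1 σ, Q1 σ →
      prOf (RpDensity p) (fun ρ => ¬ CT Q2 (t1 + t2) (compR σ ρ)) ≤ 2 ^ t1 * ε := by
    intro t1 σ hσ
    have hε : 0 ≤ ε := le_trans (prOf_nonneg (Rp_nonneg h0 h1) _) (h σ hσ)
    refine le_trans (prOf_mono (Rp_nonneg h0 h1) ?_) ((h σ hσ).trans
      (le_mul_of_one_le_left hε (one_le_pow₀ (by norm_num))))
    intro ρ hρ hc
    exact hρ (CT_mono (by omega) hc)
  induction t1 with
  | zero => intro σ hσ; exact base 0 σ hσ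
  | succ t1 ih =>
    rintro σ (hσ | ⟨v, hv, hb⟩)
    · exact base _ σ hσ
    · have := (prOf_or (Rp_nonneg h0 h1)
        (fun ρ => ¬ CT Q2 (t1 + t2) (compR (Function.update σ v (some false)) ρ))
        (fun ρ => ¬ CT Q2 (t1 + t2) (compR (Function.update σ v (some true)) ρ))).trans
        (add_le_add (ih _ (hb false)) (ih _ (hb true)))
      refine le_trans (prOf_mono (Rp_nonneg h0 h1) ?_) (this.trans (by rw [pow_succ]; linarith))
      intro ρ hρ
      by_contra hcon
      push Not at hcon
      apply hρ
      have hcb : ∀ b, CT Q2 (t1 + t2) (compR (Function.update σ v (some b)) ρ) := by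
        intro b; cases b; exacts [hcon.1, hcon.2]
      have e : t1 + 1 + t2 = t1 + t2 + 1 := by omega
      rw [e]
      cases hρv : ρ v with
      | none =>
        refine Or.inr ⟨v, by simp [compR, hv, hρv], fun b => ?_⟩
        convert hcb b using 1
        funext u
        by_cases huv : u = v
        · subst huv; simp [compR]
        · simp [compR, huv]
      | some b =>
        apply CT_succ
        convert hcb b using 1
        funext u
        by_cases huv : u = v
        · subst huv; simp [compR, hv, hρv]
        · simp [compR, huv]

theorem star_lemma {p : ℝ} (h0 : 0 ≤ p) (h1 : p ≤ 1) (B : Finset ι) (D : ℕ) :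
    prOf (RpDensity p) (fun ρ => (B.filter (fun v => ρ v = none)).card ≤ D) ≤
      2 ^ D * Real.exp (-(p * B.card / 2)) := by
  classical
  have e := Rp_prod_sum p (fun (v : ι) (o : Option Bool) => if v ∈ B then (if o = none then (1/2:ℝ) else 1) else 1)
  have e2 : ∀ v, (p * (if v ∈ B then (if (none : Option Bool) = none then (1/2:ℝ) else 1) else 1) +
      (1 - p) / 2 * (if v ∈ B then (if (some true : Option Bool) = none then (1/2:ℝ) else 1) else 1) +
      (1 - p) / 2 * (if v ∈ B then (if (some false : Option Bool) = none then (1/2:ℝ) else 1) else 1)) =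
      if v ∈ B then (1 - p / 2) else 1 := by
    intro v
    by_cases hv : v ∈ B <;> simp [hv] <;> ring
  rw [prod_congr rfl (fun v _ => e2 v)] at e
  rw [prod_ite_mem, univ_inter, prod_const] at e
  have e3 : (1 - p / 2) ^ B.card ≤ Real.exp (-(p * B.card / 2)) := by
    have := Real.add_one_le_exp (-(p/2))
    calc (1 - p / 2) ^ B.card ≤ (Real.exp (-(p/2))) ^ B.card :=
          pow_le_pow_left₀ (by linarith) (by linarith) _
      _ = _ := by rw [← Real.exp_nat_mul]; ring_nf
  refine le_trans ?_ (mul_le_mul_of_nonneg_left e3 (by positivity))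
  rw [← e, mul_sum]
  unfold prOf
  refine sum_le_sum fun ρ _ => ?_
  have hnn := Rp_nonneg h0 h1 ρ
  have e4 : (∏ v, if v ∈ B then (if ρ v = none then (1/2:ℝ) else 1) else 1) =
      (1/2) ^ (B.filter (fun v => ρ v = none)).card := by
    rw [prod_ite_mem, univ_inter, prod_ite, prod_const_one, mul_one, prod_const]
  rw [e4]
  split_ifs with hc
  · have : (1:ℝ) ≤ 2 ^ D * (1/2) ^ (B.filter (fun v => ρ v = none)).card := by
      calc (1:ℝ) = 2 ^ D * (1/2) ^ D := by rw [← mul_pow]; norm_num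
        _ ≤ _ := mul_le_mul_of_nonneg_left
          (pow_le_pow_of_le_one (by norm_num) (by norm_num) hc) (by positivity)
    nlinarith
  · positivity

theorem Rp_set {p : ℝ} (h1 : p < 1) {ρ : ι → Option Bool} {K : Finset ι}
    (hK : ∀ v ∈ K, ρ v = none) (y : ι → Bool) :
    RpDensity p ρ = (2 * p / (1 - p)) ^ K.card * RpDensity p (setR ρ K y) := by
  have h2 : (1 - p) ≠ 0 := by linarith
  have : (2 * p / (1 - p)) ^ K.card = ∏ v, if v ∈ K then (2 * p / (1 - p)) else 1 := by
    rw [prod_ite_mem, univ_inter, prod_const]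
  rw [this, RpDensity, RpDensity, ← prod_mul_distrib]
  refine prod_congr rfl fun v _ => ?_
  by_cases hv : v ∈ K
  · simp only [hv, if_true, hK v hv, setR, Option.elim]
    field_simp
  · simp [hv, setR]

theorem multi_switching {I : Type} [Fintype I] {F : I → List (Finset ι × (ι → Bool))} {w : ℕ}
    (hw0 : 0 < w) (hw : ∀ i, ∀ T ∈ F i, T.1.card ≤ w) {p : ℝ} (hp0 : 0 < p) (hp : p ≤ 1 / 2)
    (hpw : 32 * w * p ≤ 1) {l t j : ℕ} (hj : t + 1 ≤ (l + 1) * j) :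
    prOf (RpDensity p) (fun ρ : ι → Option Bool => ∃ K, BadP F l (t + 1) ρ K) ≤
      (32 * w * p) ^ (t + 1) * (3 * (Fintype.card I : ℝ) + 1) ^ j := by
  classical
  set u : ℝ := 1 / (4 * w) with hu
  have hw1 : (1:ℝ) ≤ w := by exact_mod_cast hw0
  have hu0 : 0 < u := by positivity
  have huw : (1 + 2 * u) ^ w ≤ 5 / 3 := by
    have h1 := Real.add_one_le_exp (2 * u)
    have h2 : (1 + 2 * u) ^ w ≤ Real.exp (1/2) := by
      calc (1 + 2 * u) ^ w ≤ (Real.exp (2 * u)) ^ w :=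
            pow_le_pow_left₀ (by positivity) (by linarith) _
        _ = Real.exp (1/2) := by
            rw [← Real.exp_nat_mul]; congr 1; rw [hu]; field_simp; norm_num
    have h3 : Real.exp (1/2) ≤ 5 / 3 := by
      have h4 : Real.exp (1/2) ^ 2 = Real.exp 1 := by
        rw [← Real.exp_nat_mul]; norm_num
      have h5 := Real.exp_one_lt_d9
      have h6 := Real.exp_pos (1/2)
      nlinarith
    linarith
  set q : ℝ := 2 * p / (1 - p) with hq
  have h1p : 0 < 1 - p := by linarith
  have hq0 : 0 ≤ q := by positivity
  have hqle : q ≤ 4 * p := by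
    rw [hq, div_le_iff₀ h1p]; nlinarith
  set δ : ℝ := 32 * w * p with hδ
  have hqd : q ≤ (u / 2) * δ := by
    have : (u / 2) * δ = 4 * p := by rw [hu, hδ]; field_simp; ring
    rw [this]; exact hqle
  have hδ0 : 0 ≤ δ := by positivity
  have hex : ∀ ρ : ι → Option Bool, ∃ K : Finset ι, ∃ y : ι → Bool, (∃ K, BadP F l (t + 1) ρ K) →
      BadP F l (t + 1) ρ K ∧ ∀ Φ : Finset ι → ℝ, (∀ K, 0 ≤ Φ K) →
        (u / 2) ^ K.card * Φ K ≤ stW F u j (setR ρ K y) Φ := by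
    intro ρ
    by_cases hb : ∃ K, BadP F l (t + 1) ρ K
    · obtain ⟨K, hK⟩ := hb
      obtain ⟨y, hy⟩ := enc_bad hu0.le hK
      exact ⟨K, y, fun _ => ⟨hK, fun Φ hΦ => hy _ (fun _ _ h => h) j hj Φ hΦ⟩⟩
    · exact ⟨∅, fun _ => true, fun h => absurd h hb⟩
  choose K y hKy using hex
  set Bad : Finset (ι → Option Bool) := univ.filter (fun ρ => ∃ K, BadP F l (t + 1) ρ K) with hBad
  have hprob : prOf (RpDensity p) (fun ρ : ι → Option Bool => ∃ K, BadP F l (t + 1) ρ K) =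
      ∑ ρ ∈ Bad, RpDensity p ρ := by
    unfold prOf
    rw [hBad, sum_filter]
    refine sum_congr rfl fun a _ => ?_
    congr 1
  rw [hprob]
  have hmem : ∀ ρ ∈ Bad, BadP F l (t + 1) ρ (K ρ) ∧ ∀ Φ : Finset ι → ℝ, (∀ K, 0 ≤ Φ K) →
        (u / 2) ^ (K ρ).card * Φ (K ρ) ≤ stW F u j (setR ρ (K ρ) (y ρ)) Φ := by
    intro ρ hρ
    exact hKy ρ (mem_filter.1 hρ).2
  calc ∑ ρ ∈ Bad, RpDensity p ρ
      ≤ ∑ ρ ∈ Bad, δ ^ (t + 1) * ((u / 2) ^ (K ρ).card * RpDensity p (setR ρ (K ρ) (y ρ))) := by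
        refine sum_le_sum fun ρ hρ => ?_
        obtain ⟨hb, -⟩ := hmem ρ hρ
        rw [Rp_set (by linarith) hb.free (y ρ), ← mul_assoc]
        refine mul_le_mul_of_nonneg_right ?_ (Rp_nonneg hp0.le (by linarith) _)
        calc q ^ (K ρ).card ≤ ((u / 2) * δ) ^ (K ρ).card := pow_le_pow_left₀ hq0 hqd _
          _ = δ ^ (K ρ).card * (u / 2) ^ (K ρ).card := by rw [mul_pow, mul_comm]
          _ ≤ _ := mul_le_mul_of_nonneg_right (pow_le_pow_of_le_one hδ0 hpw hb.card_le)
              (by positivity)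
    _ = δ ^ (t + 1) * ∑ τ, ∑ ρ ∈ Bad with setR ρ (K ρ) (y ρ) = τ,
          ((u / 2) ^ (K ρ).card * RpDensity p (setR ρ (K ρ) (y ρ))) := by
        rw [← mul_sum, sum_fiberwise]
    _ ≤ δ ^ (t + 1) * ∑ τ : ι → Option Bool, RpDensity p τ * (3 * (Fintype.card I : ℝ) + 1) ^ j := by
        refine mul_le_mul_of_nonneg_left (sum_le_sum fun τ _ => ?_) (by positivity)
        have e : ∑ ρ ∈ Bad with setR ρ (K ρ) (y ρ) = τ,
          ((u / 2) ^ (K ρ).card * RpDensity p (setR ρ (K ρ) (y ρ))) =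
          RpDensity p τ * ∑ ρ ∈ Bad with setR ρ (K ρ) (y ρ) = τ, (u / 2) ^ (K ρ).card := by
          rw [mul_sum]
          refine sum_congr rfl fun ρ hρ => ?_
          rw [(mem_filter.1 hρ).2, mul_comm]
        rw [e]
        refine mul_le_mul_of_nonneg_left ?_ (Rp_nonneg hp0.le (by linarith) _)
        have hinj : Set.InjOn K ((Bad.filter (fun ρ => setR ρ (K ρ) (y ρ) = τ) :
            Finset (ι → Option Bool)) : Set (ι → Option Bool)) := by
          intro ρ hρ ρ' hρ' hKK
          rw [mem_coe, mem_filter] at hρ hρ'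
          funext v
          by_cases hv : v ∈ K ρ
          · rw [(hmem ρ hρ.1).1.free v hv, (hmem ρ' hρ'.1).1.free v (hKK ▸ hv)]
          · have h1 := congrFun hρ.2 v
            have h2 := congrFun hρ'.2 v
            have hv' : v ∉ K ρ' := hKK ▸ hv
            simp only [setR, hv, hv', if_false] at h1 h2
            rw [h1, h2]
        rw [← sum_image (f := fun K : Finset ι => (u / 2) ^ K.card) hinj]
        refine sum_codes hu0.le hw huw j τ _ ?_
        intro K' hK'
        obtain ⟨ρ, hρ, rfl⟩ := mem_image.1 hK'
        rw [mem_filter] at hρ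
        have := (hmem ρ hρ.1).2
        rwa [hρ.2] at this
    _ = _ := by rw [← sum_mul, Rp_sum, one_mul]

end Prsec

/-! ### Circuits -/

section Circ

variable {ι : Type} [DecidableEq ι]

def AC0.subs : AC0 ι → List (AC0 ι)
  | .lit i b => [.lit i b]
  | .and a f => .and a f :: (List.ofFn fun j => (f j).subs).flatten
  | .or a f => .or a f :: (List.ofFn fun j => (f j).subs).flatten

theorem subs_length (C : AC0 ι) : C.subs.length = C.size := by
  induction C with
  | lit i b => simp [AC0.subs, AC0.size]
  | and a f ih => simp [AC0.subs, AC0.size, List.length_flatten, List.map_ofFn, List.sum_ofFn, Function.comp_def, ih, add_comm]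
  | or a f ih => simp [AC0.subs, AC0.size, List.length_flatten, List.map_ofFn, List.sum_ofFn, Function.comp_def, ih, add_comm]

theorem self_subs (C : AC0 ι) : C ∈ C.subs := by
  cases C <;> simp [AC0.subs]

theorem subs_closed (C : AC0 ι) : (∀ a f, AC0.and a f ∈ C.subs → ∀ j, f j ∈ C.subs) ∧
    (∀ a f, AC0.or a f ∈ C.subs → ∀ j, f j ∈ C.subs) := by
  induction C with
  | lit i b => simp [AC0.subs]
  | and a f ih =>
    constructor
    · intro a' f' h j
      simp only [AC0.subs, List.mem_cons, List.mem_flatten, List.mem_ofFn] at h ⊢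
      rcases h with h | ⟨l, ⟨i, rfl⟩, h⟩
      · cases h
        exact Or.inr ⟨_, ⟨j, rfl⟩, self_subs _⟩
      · exact Or.inr ⟨_, ⟨i, rfl⟩, (ih i).1 _ _ h j⟩
    · intro a' f' h j
      simp only [AC0.subs, List.mem_cons, List.mem_flatten, List.mem_ofFn] at h ⊢
      rcases h with h | ⟨l, ⟨i, rfl⟩, h⟩
      · cases h
      · exact Or.inr ⟨_, ⟨i, rfl⟩, (ih i).2 _ _ h j⟩
  | or a f ih =>
    constructor
    · intro a' f' h j
      simp only [AC0.subs, List.mem_cons, List.mem_flatten, List.mem_ofFn] at h ⊢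
      rcases h with h | ⟨l, ⟨i, rfl⟩, h⟩
      · cases h
      · exact Or.inr ⟨_, ⟨i, rfl⟩, (ih i).1 _ _ h j⟩
    · intro a' f' h j
      simp only [AC0.subs, List.mem_cons, List.mem_flatten, List.mem_ofFn] at h ⊢
      rcases h with h | ⟨l, ⟨i, rfl⟩, h⟩
      · cases h
        exact Or.inr ⟨_, ⟨j, rfl⟩, self_subs _⟩
      · exact Or.inr ⟨_, ⟨i, rfl⟩, (ih i).2 _ _ h j⟩

theorem size_pos (C : AC0 ι) : 1 ≤ C.size := by
  cases C <;> simp [AC0.size]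

theorem DD_lit (i : ι) (b : Bool) {w : ℕ} (hw : 0 < w) (σ : ι → Option Bool) :
    DD (AC0.lit i b).eval w σ := by
  obtain ⟨w, rfl⟩ : ∃ w', w = w' + 1 := ⟨w - 1, by omega⟩
  have key : ∀ (τ : ι → Option Bool) c, τ i = some c → ConstR (AC0.lit i b).eval τ := by
    intro τ c h
    exact ⟨if b then c else !c, fun x => by simp [AC0.eval, applyR, h]⟩
  cases h : σ i with
  | some c => exact CT_of (key σ c h)
  | none => exact Or.inr ⟨i, h, fun c => CT_of (key _ c (by simp))⟩

/-- `f` restricted to `κ` has a DNF of width at most `w`. -/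
def WD (f : (ι → Bool) → Bool) (w : ℕ) (κ : ι → Option Bool) : Prop :=
  ∃ L : List (Finset ι × (ι → Bool)), (∀ T ∈ L, T.1.card ≤ w) ∧
      ∀ x, (f (applyR κ x) = true ↔ dnfSat L x)

theorem WD_of_DD {f : (ι → Bool) → Bool} {w : ℕ} {κ : ι → Option Bool} (h : DD f w κ) :
    WD f w κ := by
  obtain ⟨L, h1, h2⟩ := DD_dnf h
  exact ⟨L, fun T hT => (h1 T hT).1, h2⟩

theorem WD_or {a : ℕ} {f : Fin a → (ι → Bool) → Bool} {w : ℕ} {κ : ι → Option Bool}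
    (h : ∀ j, WD (f j) w κ) : WD (fun x => decide (∃ j, f j x = true)) w κ := by
  choose L h1 h2 using h
  refine ⟨(List.ofFn L).flatten, ?_, ?_⟩
  · intro T hT
    simp only [List.mem_flatten, List.mem_ofFn] at hT
    obtain ⟨l, ⟨i, rfl⟩, h⟩ := hT
    exact h1 i T h
  · intro x
    simp only [decide_eq_true_eq, h2, dnfSat, List.mem_flatten, List.mem_ofFn]
    constructor
    · rintro ⟨j, T, hT, hs⟩
      exact ⟨T, ⟨_, ⟨j, rfl⟩, hT⟩, hs⟩
    · rintro ⟨T, ⟨_, ⟨j, rfl⟩, hT⟩, hs⟩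
      exact ⟨j, T, hT, hs⟩

variable [Fintype ι]

theorem one_round {I : Type} [Fintype I] {f : I → (ι → Bool) → Bool} {κ : ι → Option Bool} {w : ℕ}
    (hw0 : 0 < w) (hf : ∀ i, WD (f i) w κ ∨ WD (fun x => !(f i x)) w κ)
    {p : ℝ} (hp0 : 0 < p) (hp : p ≤ 1 / 2)
    (hpw : 32 * w * p ≤ 1) {l t j : ℕ} (hj : t + 1 ≤ (l + 1) * j) :
    prOf (RpDensity p) (fun ρ : ι → Option Bool =>
      ¬ CT (fun σ => ∀ i, DD (f i) l σ) t (compR κ ρ)) ≤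
      (32 * w * p) ^ (t + 1) * (3 * (Fintype.card I : ℝ) + 1) ^ j := by
  have : ∀ i, ∃ g : (ι → Bool) → Bool, WD g w κ ∧ (∀ σ, DD g l σ → DD (f i) l σ) := by
    intro i
    rcases hf i with h | h
    · exact ⟨_, h, fun σ h => h⟩
    · exact ⟨_, h, fun σ h => by simpa using DD_not h⟩
  choose g hg1 hg2 using this
  choose L hL1 hL2 using hg1
  refine le_trans (prOf_mono (Rp_nonneg hp0.le (by linarith)) ?_)
    (multi_switching hw0 hL1 hp0 hp hpw hj)
  intro ρ hρ
  by_contra hno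
  push Not at hno
  apply hρ
  have := CT_of_noBad (f := fun i x => g i (applyR κ x)) hL2 l t hno
  refine CT_map ?_ this
  intro σ hσ i
  exact hg2 i _ (DD_comp (hσ i))

theorem comp_round {Q1 Q2 : (ι → Option Bool) → Prop} {t1 t2 : ℕ} {E ε p q : ℝ} (h0 : 0 ≤ p)
    (h1 : p ≤ 1) (q0 : 0 ≤ q) (q1 : q ≤ 1) (hε : 0 ≤ ε)
    (hE : prOf (RpDensity p) (fun ρ : ι → Option Bool => ¬ CT Q1 t1 ρ) ≤ E)
    (h : ∀ σ, Q1 σ → prOf (RpDensity q) (fun ρ => ¬ CT Q2 t2 (compR σ ρ)) ≤ ε) :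
    prOf (RpDensity (p * q)) (fun ρ : ι → Option Bool => ¬ CT Q2 (t1 + t2) ρ) ≤
      E + 2 ^ t1 * ε := by
  classical
  have e := Rp_comp p q (fun ρ : ι → Option Bool => if ¬ CT Q2 (t1 + t2) ρ then (1:ℝ) else 0)
  have e1 : prOf (RpDensity (p * q)) (fun ρ : ι → Option Bool => ¬ CT Q2 (t1 + t2) ρ) =
      ∑ ρ : ι → Option Bool, RpDensity (p * q) ρ *
        (if ¬ CT Q2 (t1 + t2) ρ then (1:ℝ) else 0) := by
    unfold prOf
    refine sum_congr rfl fun ρ _ => ?_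
    split_ifs <;> simp
  rw [e1, ← e]
  have e2 : ∀ ρ : ι → Option Bool, ∑ ρ' : ι → Option Bool, RpDensity p ρ * RpDensity q ρ' *
      (if ¬ CT Q2 (t1 + t2) (compR ρ ρ') then (1:ℝ) else 0) =
      RpDensity p ρ * prOf (RpDensity q) (fun ρ' => ¬ CT Q2 (t1 + t2) (compR ρ ρ')) := by
    intro ρ
    unfold prOf
    rw [mul_sum]
    refine sum_congr rfl fun ρ' _ => ?_
    by_cases hc : CT Q2 (t1 + t2) (compR ρ ρ') <;> simp [hc]
  have hone : ∀ ρ : ι → Option Bool,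
      prOf (RpDensity q) (fun ρ' => ¬ CT Q2 (t1 + t2) (compR ρ ρ')) ≤ 1 := by
    intro ρ
    rw [← Rp_sum (ι := ι) q]
    refine sum_le_sum fun a _ => ?_
    split_ifs
    · exact le_rfl
    · exact Rp_nonneg q0 q1 _
  have hbd : ∀ ρ : ι → Option Bool, ∑ ρ' : ι → Option Bool, RpDensity p ρ * RpDensity q ρ' *
      (if ¬ CT Q2 (t1 + t2) (compR ρ ρ') then (1:ℝ) else 0) ≤
      (if ¬ CT Q1 t1 ρ then RpDensity p ρ else 0) + RpDensity p ρ * (2 ^ t1 * ε) := by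
    intro ρ
    rw [e2]
    have hn := Rp_nonneg h0 h1 ρ
    by_cases hc : CT Q1 t1 ρ
    · have := round_lemma q0 q1 h t1 ρ hc
      simp only [hc, not_true_eq_false, if_false, zero_add]
      exact mul_le_mul_of_nonneg_left this hn
    · simp only [hc, not_false_eq_true, if_true]
      have h3 := mul_le_mul_of_nonneg_left (hone ρ) hn
      have : 0 ≤ RpDensity p ρ * (2 ^ t1 * ε) := by positivity
      linarith
  refine (sum_le_sum fun ρ _ => hbd ρ).trans ?_
  rw [sum_add_distrib, ← sum_mul, Rp_sum, one_mul]
  have : (∑ ρ : ι → Option Bool, if ¬ CT Q1 t1 ρ then RpDensity p ρ else 0) ≤ E := by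
    refine le_trans (le_of_eq ?_) hE
    unfold prOf
    refine sum_congr rfl fun ρ _ => ?_
    congr
  linarith

def QG (G : List (AC0 ι)) (w h : ℕ) (σ : ι → Option Bool) : Prop :=
  ∀ g ∈ G, g.depth ≤ h → DD g.eval w σ

theorem WD_gate {G : List (AC0 ι)} (hG1 : ∀ a f, AC0.and a f ∈ G → ∀ j, f j ∈ G)
    (hG2 : ∀ a f, AC0.or a f ∈ G → ∀ j, f j ∈ G) {w h : ℕ} (hw : 0 < w) {κ : ι → Option Bool}
    (hQ : QG G w h κ) {g : AC0 ι} (hg : g ∈ G) (hd : g.depth ≤ h + 1) :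
    WD g.eval w κ ∨ WD (fun x => !(g.eval x)) w κ := by
  cases g with
  | lit i b => exact Or.inl (WD_of_DD (DD_lit i b hw κ))
  | and a f =>
    right
    have hc : ∀ j, WD (fun x => !((f j).eval x)) w κ := by
      intro j
      refine WD_of_DD (DD_not (hQ _ (hG1 a f hg j) ?_))
      have : (f j).depth ≤ univ.sup fun j => (f j).depth :=
        Finset.le_sup (f := fun j => (f j).depth) (mem_univ j)
      simp only [AC0.depth] at hd
      omega
    have := WD_or hc
    convert this using 2 with x
    simp only [AC0.eval]
    rw [← decide_not]
    simp
  | or a f =>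
    left
    have hc : ∀ j, WD ((f j).eval) w κ := by
      intro j
      refine WD_of_DD (hQ _ (hG2 a f hg j) ?_)
      have : (f j).depth ≤ univ.sup fun j => (f j).depth :=
        Finset.le_sup (f := fun j => (f j).depth) (mem_univ j)
      simp only [AC0.depth] at hd
      omega
    exact WD_or hc

theorem mid_rounds {G : List (AC0 ι)} (hG1 : ∀ a f, AC0.and a f ∈ G → ∀ j, f j ∈ G)
    (hG2 : ∀ a f, AC0.or a f ∈ G → ∀ j, f j ∈ G) {w : ℕ} (hw : 0 < w)
    {p : ℝ} (hp0 : 0 < p) (hp : p ≤ 1 / 2)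
    (hpw : 32 * w * p ≤ 1) {t j : ℕ} (hj : t + 1 ≤ (w + 1) * j) (h : ℕ) :
    prOf (RpDensity (p ^ h)) (fun ρ : ι → Option Bool => ¬ CT (QG G w h) (h * t) ρ) ≤
      h * (2 ^ (h * t) * ((32 * w * p) ^ (t + 1) * (3 * (G.length : ℝ) + 1) ^ j)) := by
  set ε : ℝ := (32 * w * p) ^ (t + 1) * (3 * (G.length : ℝ) + 1) ^ j with hε
  have hε0 : 0 ≤ ε := by positivity
  induction h with
  | zero =>
    have : ∀ ρ : ι → Option Bool, CT (QG G w 0) (0 * t) ρ := by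
      intro ρ
      refine CT_of ?_
      intro g hg hd
      cases g with
      | lit i b => exact DD_lit i b hw ρ
      | and a f => simp [AC0.depth] at hd
      | or a f => simp [AC0.depth] at hd
    have e : (fun ρ : ι → Option Bool => ¬ CT (QG G w 0) (0 * t) ρ) = fun _ => False := by
      funext ρ
      exact eq_false (not_not.2 (this ρ))
    rw [e]
    simp [prOf]
  | succ h ih =>
    rw [pow_succ, add_mul, one_mul]
    refine (comp_round (by positivity) (pow_le_one₀ hp0.le (by linarith)) hp0.le (by linarith) hε0
      ih ?_).trans ?_
    · intro σ hσ
      have := one_round (f := fun (i : Fin G.length) =>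
        if (G.get i).depth ≤ h + 1 then (G.get i).eval else fun _ => false) (κ := σ) hw ?_
        hp0 hp hpw (l := w) (t := t) (j := j) hj
      · rw [Fintype.card_fin] at this
        refine le_trans (prOf_mono (Rp_nonneg hp0.le (by linarith)) ?_) this
        intro ρ hρ hc
        apply hρ
        refine CT_imp ?_ hc
        intro τ hτ g hg hd
        obtain ⟨i, rfl⟩ := List.get_of_mem hg
        have := hτ i
        rwa [if_pos hd] at this
      · intro i
        split_ifs with hd
        · exact WD_gate hG1 hG2 hw hσ (List.get_mem _ _) hd
        · exact Or.inl ⟨[], by simp, fun x => by simp [dnfSat]⟩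
    · have h1 : (2:ℝ) ^ (h * t) ≤ 2 ^ (h * t + t) :=
        pow_le_pow_right₀ (by norm_num) (by omega)
      push_cast
      have h2 : (2:ℝ) ^ (h * t) * ε ≤ 2 ^ (h * t + t) * ε := mul_le_mul_of_nonneg_right h1 hε0
      have h3 : (h:ℝ) * (2 ^ (h * t) * ε) ≤ h * (2 ^ (h * t + t) * ε) :=
        mul_le_mul_of_nonneg_left h2 (by positivity)
      linarith

theorem switch_total {a : ℕ} (C : Fin a → AC0 ι) {d : ℕ} (hd : ∀ i, (C i).depth ≤ d)
    {N : ℕ} (hN : ∑ i, (C i).size ≤ N) {w : ℕ} (hw : 0 < w) {p q : ℝ} (hp0 : 0 < p)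
    (hp : p ≤ 1 / 2) (hpw : 32 * w * p ≤ 1) (hq0 : 0 < q) (hq : q ≤ 1 / 2) (hqw : 32 * w * q ≤ 1)
    {t j k j' : ℕ} (hj : t + 1 ≤ (w + 1) * j) (hj' : t + 1 ≤ (k + 1) * j') :
    prOf (RpDensity (p ^ d * q))
      (fun ρ : ι → Option Bool => ¬ CT (fun σ => ∀ i, DD (C i).eval k σ) (d * t + t) ρ) ≤
      d * (2 ^ (d * t) * ((32 * w * p) ^ (t + 1) * (3 * (N : ℝ) + 1) ^ j)) +
      2 ^ (d * t) * ((32 * w * q) ^ (t + 1) * (3 * (N : ℝ) + 1) ^ j') := by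
  set G : List (AC0 ι) := (List.ofFn fun i => (C i).subs).flatten with hG
  have hmem : ∀ g, g ∈ G ↔ ∃ i, g ∈ (C i).subs := by
    intro g
    simp only [hG, List.mem_flatten, List.mem_ofFn]
    constructor
    · rintro ⟨_, ⟨i, rfl⟩, h⟩; exact ⟨i, h⟩
    · rintro ⟨i, h⟩; exact ⟨_, ⟨i, rfl⟩, h⟩
  have hlen : G.length ≤ N := by
    refine le_trans (le_of_eq ?_) hN
    simp [hG, List.length_flatten, List.map_ofFn, List.sum_ofFn, Function.comp_def, subs_length]
  have haN : a ≤ N := by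
    refine le_trans ?_ hN
    calc a = ∑ i : Fin a, 1 := by simp
      _ ≤ _ := sum_le_sum fun i _ => size_pos _
  have hG1 : ∀ a f, AC0.and a f ∈ G → ∀ j, f j ∈ G := by
    intro a f h j
    obtain ⟨i, h⟩ := (hmem _).1 h
    exact (hmem _).2 ⟨i, (subs_closed _).1 _ _ h j⟩
  have hG2 : ∀ a f, AC0.or a f ∈ G → ∀ j, f j ∈ G := by
    intro a f h j
    obtain ⟨i, h⟩ := (hmem _).1 h
    exact (hmem _).2 ⟨i, (subs_closed _).2 _ _ h j⟩
  have hCG : ∀ i, C i ∈ G := fun i => (hmem _).2 ⟨i, self_subs _⟩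
  refine (comp_round (by positivity) (pow_le_one₀ hp0.le (by linarith)) hq0.le (by linarith)
    (by positivity) (mid_rounds hG1 hG2 hw hp0 hp hpw hj d)
    (ε := (32 * w * q) ^ (t + 1) * (3 * (a : ℝ) + 1) ^ j') ?_).trans ?_
  · intro σ hσ
    have := one_round (f := fun i => (C i).eval) (κ := σ) hw
      (fun i => Or.inl (WD_of_DD (hσ _ (hCG i) (hd i)))) hq0 hq hqw (l := k) (t := t) (j := j') hj'
    rwa [Fintype.card_fin] at this
  · have h1 : (G.length : ℝ) ≤ N := by exact_mod_cast hlen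
    have h2 : (a : ℝ) ≤ N := by exact_mod_cast haN
    gcongr

end Circ

/-! ### Integer weights for threshold functions -/

section Weights

/-- simultaneous approximation with an exact coordinate -/
theorem simul_approx {n : ℕ} (w : Fin n → ℝ) (hw : ∀ i, |w i| ≤ 1) :
    ∃ (q : ℕ) (p : Fin n → ℤ), 1 ≤ q ∧ (∀ i, |q * w i - p i| < 1 / (n + 1)) ∧
      (∀ i, |p i| ≤ (n + 1) ^ n + 1) ∧ (∀ i, (w i = 0 ∨ |w i| = 1) → q * w i - p i = 0) := by
  classical
  have hfr : ∀ x : ℝ, ⌊Int.fract x * ((n:ℝ) + 1)⌋₊ < n + 1 := by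
    intro x
    rw [Nat.floor_lt (by have := Int.fract_nonneg x; positivity)]
    have := Int.fract_lt_one x
    push_cast
    nlinarith
  let φ : Fin ((n + 1) ^ n + 1) → (Fin n → Fin (n + 1)) := fun q i =>
    ⟨⌊Int.fract ((q : ℕ) * w i) * ((n:ℝ) + 1)⌋₊, hfr _⟩
  obtain ⟨q1, q2, hne, heq⟩ := Fintype.exists_ne_map_eq_of_card_lt φ (by simp)
  wlog hlt : q1 < q2 generalizing q1 q2
  · exact this q2 q1 hne.symm heq.symm (lt_of_le_of_ne (not_lt.1 hlt) hne.symm)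
  have hlt' : (q1 : ℕ) < q2 := hlt
  have hq2 : (q2 : ℕ) ≤ (n + 1) ^ n := Nat.lt_succ_iff.1 q2.2
  refine ⟨q2 - q1, fun i => ⌊((q2:ℕ):ℝ) * w i⌋ - ⌊((q1:ℕ):ℝ) * w i⌋, by omega, ?_, ?_, ?_⟩
  · intro i
    have h := congrFun heq i
    simp only [φ, Fin.mk.injEq] at h
    push_cast [Nat.cast_sub hlt'.le]
    have e : (((q2:ℕ):ℝ) - ((q1:ℕ):ℝ)) * w i - ((⌊((q2:ℕ):ℝ) * w i⌋:ℝ) - (⌊((q1:ℕ):ℝ) * w i⌋:ℝ)) =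
        Int.fract (((q2:ℕ):ℝ) * w i) - Int.fract (((q1:ℕ):ℝ) * w i) := by
      simp only [Int.fract]; ring
    rw [e]
    set a := Int.fract (((q2:ℕ):ℝ) * w i)
    set b := Int.fract (((q1:ℕ):ℝ) * w i)
    have ha : 0 ≤ a * ((n:ℝ) + 1) := by have := Int.fract_nonneg (((q2:ℕ):ℝ) * w i); positivity
    have hb : 0 ≤ b * ((n:ℝ) + 1) := by have := Int.fract_nonneg (((q1:ℕ):ℝ) * w i); positivity
    have h1 := Nat.floor_le ha
    have h2 := Nat.lt_floor_add_one (a * ((n:ℝ) + 1))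
    have h3 := Nat.floor_le hb
    have h4 := Nat.lt_floor_add_one (b * ((n:ℝ) + 1))
    rw [h] at h3 h4
    have hn : (0:ℝ) < n + 1 := by positivity
    rw [lt_div_iff₀ hn, ← abs_of_pos hn, ← abs_mul, abs_lt]
    constructor <;> nlinarith
  · intro i
    have h1 := Int.floor_le (((q2:ℕ):ℝ) * w i)
    have h2 := Int.lt_floor_add_one (((q2:ℕ):ℝ) * w i)
    have h3 := Int.floor_le (((q1:ℕ):ℝ) * w i)
    have h4 := Int.lt_floor_add_one (((q1:ℕ):ℝ) * w i)
    have hw' := abs_le.1 (hw i)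
    have hq : ((q2:ℕ):ℝ) - ((q1:ℕ):ℝ) ≤ (n + 1) ^ n := by
      have : ((q2:ℕ):ℝ) ≤ (n + 1) ^ n := by exact_mod_cast hq2
      have h0 : (0:ℝ) ≤ ((q1:ℕ):ℝ) := by positivity
      linarith
    have hq0 : 0 ≤ ((q2:ℕ):ℝ) - ((q1:ℕ):ℝ) := by
      have : ((q1:ℕ):ℝ) ≤ ((q2:ℕ):ℝ) := by exact_mod_cast hlt'.le
      linarith
    have h5 : (((q2:ℕ):ℝ) - ((q1:ℕ):ℝ)) * w i ≤ (n + 1) ^ n := by nlinarith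
    have h6 : -((n + 1 : ℝ) ^ n) ≤ (((q2:ℕ):ℝ) - ((q1:ℕ):ℝ)) * w i := by nlinarith
    have h7 : |((⌊((q2:ℕ):ℝ) * w i⌋ - ⌊((q1:ℕ):ℝ) * w i⌋ : ℤ) : ℝ)| ≤ (n + 1) ^ n + 1 := by
      push_cast
      rw [abs_le]
      constructor <;> linarith
    exact_mod_cast h7
  · intro i hi
    have hintz : ∃ z : ℤ, w i = z := by
      rcases hi with h | h
      · exact ⟨0, by simp [h]⟩
      · rcases eq_or_eq_neg_of_abs_eq h with h | h
        · exact ⟨1, by simp [h]⟩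
        · exact ⟨-1, by simp [h]⟩
    obtain ⟨z, hz⟩ := hintz
    simp only [hz]
    have e : ∀ q : ℕ, ⌊(q:ℝ) * (z:ℝ)⌋ = q * z := by
      intro q
      have : ((q:ℝ) * (z:ℝ)) = ((q * z : ℤ) : ℝ) := by push_cast; ring
      rw [this, Int.floor_intCast]
    rw [e, e, Nat.cast_sub hlt'.le]
    push_cast
    ring

theorem int_weights {n : ℕ} (s : ℕ) : ∀ w : Fin n → ℝ,
    (univ.filter (fun i => w i ≠ 0)).card ≤ s →
    ∃ v : Fin n → ℤ, (∀ i, |v i| + 1 ≤ (((n:ℤ) + 1) ^ n + 2) ^ s * ((n:ℤ) + 1) ^ s) ∧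
      ∀ b : Fin n → ℤ, (∀ i, |b i| ≤ 1) →
        ((0 < ∑ i, w i * b i → 0 < ∑ i, v i * b i) ∧ (0 = ∑ i, w i * b i → 0 = ∑ i, v i * b i)) := by
  have hzero : ∀ (s : ℕ) (w : Fin n → ℝ), (∀ i, w i = 0) →
    ∃ v : Fin n → ℤ, (∀ i, |v i| + 1 ≤ (((n:ℤ) + 1) ^ n + 2) ^ s * ((n:ℤ) + 1) ^ s) ∧
      ∀ b : Fin n → ℤ, (∀ i, |b i| ≤ 1) →
        ((0 < ∑ i, w i * b i → 0 < ∑ i, v i * b i) ∧ (0 = ∑ i, w i * b i → 0 = ∑ i, v i * b i)) := by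
    intro s w hw
    refine ⟨fun _ => 0, fun i => ?_, fun b _ => ?_⟩
    · have h1 : (1:ℤ) ≤ (((n:ℤ) + 1) ^ n + 2) ^ s := one_le_pow₀ (by
        have : (0:ℤ) ≤ ((n:ℤ) + 1) ^ n := by positivity
        linarith)
      have h2 : (1:ℤ) ≤ ((n:ℤ) + 1) ^ s := one_le_pow₀ (by linarith [Int.natCast_nonneg n])
      simp only [abs_zero, zero_add]
      nlinarith
    · simp [hw]
  induction s with
  | zero =>
    intro w hs
    apply hzero
    intro i
    by_contra h
    have : i ∈ univ.filter (fun i => w i ≠ 0) := by simp [h]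
    rw [card_eq_zero.1 (Nat.le_zero.1 hs)] at this
    simp at this
  | succ s ih =>
    intro w hs
    by_cases hw0 : ∀ i, w i = 0
    · exact hzero _ w hw0
    push Not at hw0
    obtain ⟨i1, hi1⟩ := hw0
    obtain ⟨i0, -, hmax⟩ := exists_max_image univ (fun i => |w i|) ⟨i1, mem_univ _⟩
    have hpos : 0 < |w i0| := lt_of_lt_of_le (abs_pos.2 hi1) (hmax i1 (mem_univ _))
    set u : Fin n → ℝ := fun i => w i / |w i0| with hu
    have hu1 : ∀ i, |u i| ≤ 1 := by
      intro i
      simp only [hu, abs_div, abs_abs]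
      rw [div_le_one hpos]
      exact hmax i (mem_univ _)
    obtain ⟨q, p, hq, hqp, hp, hex⟩ := simul_approx u hu1
    set r : Fin n → ℝ := fun i => q * u i - p i with hr
    have hri0 : r i0 = 0 := hex i0 (Or.inr (by
      simp only [hu, abs_div, abs_abs]; exact div_self hpos.ne'))
    have hrz : ∀ i, w i = 0 → r i = 0 := fun i hi => hex i (Or.inl (by simp [hu, hi]))
    have hcard : (univ.filter (fun i => r i ≠ 0)).card ≤ s := by
      have hss : (univ.filter (fun i => r i ≠ 0)) ⊂ (univ.filter (fun i => w i ≠ 0)) := by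
        rw [ssubset_iff_of_subset]
        · refine ⟨i0, by simpa using hpos, by simp [hri0]⟩
        · intro i hi
          simp only [mem_filter, mem_univ, true_and] at hi ⊢
          exact fun h => hi (hrz i h)
      have := card_lt_card hss
      omega
    obtain ⟨v', hv', hb'⟩ := ih r hcard
    set B : ℤ := (((n:ℤ) + 1) ^ n + 2) ^ s * ((n:ℤ) + 1) ^ s with hB
    have hn0 : (0:ℤ) ≤ n := Int.natCast_nonneg n
    have hB1 : 1 ≤ B := by
      have := hv' i0
      have := abs_nonneg (v' i0)
      linarith
    set A : ℤ := n * (B - 1) + 1 with hA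
    have hA0 : 0 ≤ A := by nlinarith
    refine ⟨fun i => p i * A + v' i, ?_, ?_⟩
    · intro i
      have e : (((n:ℤ) + 1) ^ n + 2) ^ (s + 1) * ((n:ℤ) + 1) ^ (s + 1) =
        (((n:ℤ) + 1) ^ n + 2) * ((n:ℤ) + 1) * B := by rw [hB]; ring
      rw [e]
      set X : ℤ := ((n:ℤ) + 1) ^ n with hX
      have hX0 : 0 ≤ X := by positivity
      have h1 : |p i * A + v' i| ≤ |p i| * A + |v' i| := by
        refine (abs_add_le _ _).trans ?_
        rw [abs_mul, abs_of_nonneg hA0]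
      have h2 : |p i| * A ≤ (X + 1) * A := mul_le_mul_of_nonneg_right (hp i) hA0
      have h3 := hv' i
      have h4 : A ≤ (n + 1) * B := by nlinarith
      have h5 : (X + 1) * A ≤ (X + 1) * ((n + 1) * B) := mul_le_mul_of_nonneg_left h4 (by linarith)
      have h6 : B ≤ (n + 1) * B := by nlinarith
      nlinarith
    · intro b hb
      have hsplit : (q:ℝ) / |w i0| * ∑ i, w i * b i = ((∑ i, p i * b i : ℤ) : ℝ) + ∑ i, r i * b i := by
        rw [mul_sum]
        push_cast
        rw [← sum_add_distrib]
        refine sum_congr rfl fun i _ => ?_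
        simp only [hr, hu]
        ring
      have hqpos : 0 < (q:ℝ) / |w i0| := by
        have : (0:ℝ) < q := by exact_mod_cast hq
        positivity
      have hrb : |∑ i, r i * b i| < 1 := by
        have hnr : (0:ℝ) < (n:ℝ) + 1 := by positivity
        calc |∑ i, r i * b i| ≤ ∑ i, |r i * b i| := abs_sum_le_sum_abs _ _
          _ ≤ ∑ i : Fin n, 1 / ((n:ℝ) + 1) := by
              refine sum_le_sum fun i _ => ?_
              rw [abs_mul]
              have hbi : |(b i : ℝ)| ≤ 1 := by exact_mod_cast hb i
              have := (hqp i).le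
              calc |r i| * |(b i : ℝ)| ≤ |r i| * 1 := mul_le_mul_of_nonneg_left hbi (abs_nonneg _)
                _ ≤ _ := by rw [mul_one]; exact this
          _ < 1 := by
              simp only [sum_const, card_univ, Fintype.card_fin, nsmul_eq_mul]
              rw [mul_one_div, div_lt_one hnr]
              linarith
      have hvb : |∑ i, v' i * b i| ≤ n * (B - 1) := by
        calc |∑ i, v' i * b i| ≤ ∑ i, |v' i * b i| := abs_sum_le_sum_abs _ _
          _ ≤ ∑ i : Fin n, (B - 1) := by
              refine sum_le_sum fun i _ => ?_
              rw [abs_mul]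
              have h1 := hb i
              have h2 := hv' i
              nlinarith [abs_nonneg (v' i), abs_nonneg (b i)]
          _ = _ := by simp only [sum_const, card_univ, Fintype.card_fin, nsmul_eq_mul]
      have hv : ∑ i, (p i * A + v' i) * b i = A * (∑ i, p i * b i) + ∑ i, v' i * b i := by
        rw [mul_sum, ← sum_add_distrib]
        exact sum_congr rfl fun i _ => by ring
      rw [hv]
      obtain ⟨hb1, hb2⟩ := hb' b hb
      set P : ℤ := ∑ i, p i * b i
      rw [abs_lt] at hrb
      rw [abs_le] at hvb
      constructor
      · intro hpos'
        have h1 : 0 < (P:ℝ) + ∑ i, r i * b i := by rw [← hsplit]; positivity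
        have h2 : (-1:ℝ) < P := by linarith
        have h3 : -1 < P := by exact_mod_cast h2
        rcases (show P = 0 ∨ 1 ≤ P by omega) with h | h
        · rw [h] at h1 ⊢
          have := hb1 (by simpa using h1)
          simpa using this
        · nlinarith
      · intro hz
        rw [← hz, mul_zero] at hsplit
        have h2 : (-1:ℝ) < P := by linarith
        have h2' : (P:ℝ) < 1 := by linarith
        have h3 : -1 < P := by exact_mod_cast h2
        have h4 : P < 1 := by exact_mod_cast h2'
        have h5 : P = 0 := by omega
        rw [h5] at hsplit ⊢
        have := hb2 (by simpa using hsplit)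
        rw [← this]; simp

end Weights

/-! ### Exponential sums for SYM and THR gates -/

section Four

def chi (b : Bool) : ℂ := if b then -1 else 1

theorem dft_inv {M : ℕ} (hM : 0 < M) {ζ : ℂ} (hζ : IsPrimitiveRoot ζ M) (h : ℕ → ℂ) {t : ℕ}
    (ht : t < M) :
    h t = ∑ ξ ∈ range M, (1 / (M:ℂ) * ∑ s ∈ range M, h s * ((ζ ^ ξ)⁻¹) ^ s) * (ζ ^ ξ) ^ t := by
  have hM' : (M:ℂ) ≠ 0 := by exact_mod_cast hM.ne'
  have hz0 : ζ ≠ 0 := hζ.ne_zero hM.ne'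
  have key : ∀ s ∈ range M, ∑ ξ ∈ range M, ((ζ ^ ξ)⁻¹) ^ s * (ζ ^ ξ) ^ t = if s = t then (M:ℂ) else 0 := by
    intro s hs
    rw [mem_range] at hs
    have e : ∀ ξ, ((ζ ^ ξ)⁻¹) ^ s * (ζ ^ ξ) ^ t = (ζ ^ t / ζ ^ s) ^ ξ := by
      intro ξ
      rw [div_pow, inv_pow, ← pow_mul, ← pow_mul, ← pow_mul, ← pow_mul, mul_comm ξ s, mul_comm ξ t]
      field_simp
    simp_rw [e]
    split_ifs with hst
    · subst hst
      simp [hz0]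
    · have hr : ζ ^ t / ζ ^ s ≠ 1 := by
        intro hr
        rw [div_eq_one_iff_eq (pow_ne_zero _ hz0)] at hr
        exact hst (hζ.pow_inj ht hs hr).symm
      have h1 : (ζ ^ t / ζ ^ s) ^ M = 1 := by
        rw [div_pow, ← pow_mul, ← pow_mul, mul_comm t, mul_comm s, pow_mul, pow_mul, hζ.pow_eq_one]
        simp
      have := mul_geom_sum (ζ ^ t / ζ ^ s) M
      rw [h1, sub_self] at this
      exact (mul_eq_zero.1 this).resolve_left (sub_ne_zero.2 hr)
  have e2 : ∀ ξ, (1 / (M:ℂ) * ∑ s ∈ range M, h s * ((ζ ^ ξ)⁻¹) ^ s) * (ζ ^ ξ) ^ t =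
      ∑ s ∈ range M, 1 / (M:ℂ) * h s * (((ζ ^ ξ)⁻¹) ^ s * (ζ ^ ξ) ^ t) := by
    intro ξ
    rw [mul_sum, sum_mul]
    exact sum_congr rfl fun s _ => by ring
  simp_rw [e2]
  rw [sum_comm]
  simp_rw [← mul_sum]
  rw [sum_congr rfl (fun s hs => by rw [key s hs])]
  simp only [mul_ite, mul_zero]
  rw [sum_ite_eq', if_pos (mem_range.2 ht)]
  field_simp

theorem coef_le {M : ℕ} (hM : 0 < M) {R ξ : ℕ} (hR : R ≤ M) (h0 : 0 < ξ) (h1 : ξ < M)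
    {ζ : ℂ} (hζ : ζ = Complex.exp (2 * Real.pi * Complex.I / M)) :
    ‖1 / (M:ℂ) * ∑ s ∈ range M, (chi (decide (R ≤ s))) * ((ζ ^ ξ)⁻¹) ^ s‖ ≤
      1 / (ξ:ℝ) + 1 / ((M:ℝ) - ξ) := by
  have hp : IsPrimitiveRoot ζ M := by rw [hζ]; exact Complex.isPrimitiveRoot_exp M hM.ne'
  have hMr : (0:ℝ) < M := by exact_mod_cast hM
  have hz0 : ζ ≠ 0 := hp.ne_zero hM.ne'
  have hzn : ‖ζ‖ = 1 := hp.norm'_eq_one hM.ne'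
  set z : ℂ := (ζ ^ ξ)⁻¹ with hz
  have hzN : ‖z‖ = 1 := by simp [hz, hzn]
  have hz1 : z ^ M = 1 := by
    rw [hz, inv_pow, ← pow_mul, mul_comm, pow_mul, hp.pow_eq_one]; simp
  have hne : ζ ^ ξ ≠ 1 := hp.pow_ne_one_of_pos_of_lt h0.ne' h1
  have hne' : z ≠ 1 := by rw [hz]; simpa using hne
  have hS : ∑ s ∈ range M, z ^ s = 0 := by
    have := mul_geom_sum z M
    rw [hz1, sub_self] at this
    exact (mul_eq_zero.1 this).resolve_left (sub_ne_zero.2 hne')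
  have hzsub : ‖z - 1‖ = ‖ζ ^ ξ - 1‖ := by
    have : z - 1 = -(z * (ζ ^ ξ - 1)) := by
      rw [hz]; field_simp; ring
    rw [this, norm_neg, norm_mul, hzN, one_mul]
  have hζξ : ζ ^ ξ = Complex.exp (Complex.I * ((2 * Real.pi * ξ / M : ℝ) : ℂ)) := by
    rw [hζ, ← Complex.exp_nat_mul]; congr 1; push_cast; ring
  have hsin : ‖ζ ^ ξ - 1‖ = 2 * |Real.sin (Real.pi * ξ / M)| := by
    rw [hζξ, Complex.norm_exp_I_mul_ofReal_sub_one]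
    rw [Real.norm_eq_abs, abs_mul, abs_two]
    congr 3
    ring
  have hξr : (0:ℝ) < ξ := by exact_mod_cast h0
  have hξM : (ξ:ℝ) < M := by exact_mod_cast h1
  have hpi := Real.pi_pos
  have hsl : ∀ u : ℝ, 0 < u → u ≤ M / 2 → 4 * u / M ≤ 2 * Real.sin (Real.pi * u / M) := by
    intro u hu0 hu
    have := Real.mul_le_sin (x := Real.pi * u / M) (by positivity) (by
      rw [div_le_iff₀ hMr]; nlinarith)
    have e : 2 / Real.pi * (Real.pi * u / M) = 2 * u / M := by field_simp
    rw [e] at this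
    have e' : 4 * u / M = 2 * (2 * u / M) := by ring
    linarith
  have hlow : 4 / ((M:ℝ) * (1 / (ξ:ℝ) + 1 / ((M:ℝ) - ξ))) ≤ ‖z - 1‖ := by
    rw [hzsub, hsin]
    have hd : 0 < (M:ℝ) - ξ := by linarith
    rcases le_total (ξ:ℝ) (M / 2) with hc | hc
    · have := hsl ξ hξr hc
      refine le_trans ?_ (this.trans (mul_le_mul_of_nonneg_left (le_abs_self _) (by norm_num)))
      rw [div_le_div_iff₀ (by positivity) hMr]
      have : (1:ℝ) ≤ ξ * (1 / (ξ:ℝ) + 1 / ((M:ℝ) - ξ)) := by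
        rw [mul_add, mul_one_div_cancel hξr.ne']
        have : 0 < (ξ:ℝ) * (1 / ((M:ℝ) - ξ)) := by positivity
        linarith
      nlinarith
    · have := hsl (M - ξ) hd (by linarith)
      have e : Real.pi * (M - ξ) / M = Real.pi - Real.pi * ξ / M := by field_simp
      rw [e, Real.sin_pi_sub] at this
      refine le_trans ?_ (this.trans (mul_le_mul_of_nonneg_left (le_abs_self _) (by norm_num)))
      rw [div_le_div_iff₀ (by positivity) hMr]
      have : (1:ℝ) ≤ (M - ξ) * (1 / (ξ:ℝ) + 1 / ((M:ℝ) - ξ)) := by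
        rw [mul_add, mul_one_div_cancel hd.ne']
        have : 0 < ((M:ℝ) - ξ) * (1 / (ξ:ℝ)) := by positivity
        linarith
      nlinarith
  -- the sum
  have hsplit : ∑ s ∈ range M, (chi (decide (R ≤ s))) * z ^ s = 2 * ∑ s ∈ range R, z ^ s := by
    have e1 : ∀ s, chi (decide (R ≤ s)) * z ^ s = 2 * (if s < R then z ^ s else 0) - z ^ s := by
      intro s
      by_cases hs : R ≤ s
      · simp [chi, hs, not_lt.2 hs]
      · simp [chi, hs, not_le.1 hs]; ring
    simp_rw [e1]
    rw [sum_sub_distrib, hS, sub_zero, ← mul_sum, ← sum_filter]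
    congr 2
    ext s
    simp only [mem_filter, mem_range]
    omega
  have hgeo := mul_geom_sum z R
  have hzpos : 0 < ‖z - 1‖ := norm_pos_iff.2 (sub_ne_zero.2 hne')
  have hsum : ‖∑ s ∈ range R, z ^ s‖ * ‖z - 1‖ ≤ 2 := by
    rw [← norm_mul, mul_comm, hgeo]
    refine (norm_sub_le _ _).trans ?_
    rw [norm_pow, hzN]; norm_num
  rw [hsplit, norm_mul, norm_mul, norm_div, norm_one, Complex.norm_natCast, Complex.norm_ofNat]
  have hd : 0 < (M:ℝ) - ξ := by linarith
  set X := 1 / (ξ:ℝ) + 1 / ((M:ℝ) - ξ) with hX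
  have hX0 : 0 < X := by positivity
  set Y := ‖∑ s ∈ range R, z ^ s‖
  have hY : Y * (4 / (M * X)) ≤ 2 :=
    (mul_le_mul_of_nonneg_left hlow (norm_nonneg _)).trans hsum
  rw [mul_div_assoc', div_le_iff₀ (by positivity)] at hY
  rw [div_mul_eq_mul_div, one_mul, div_le_iff₀ hMr]
  nlinarith

theorem coef_sum {M : ℕ} (hM : 0 < M) {R : ℕ} (hR : R ≤ M)
    {ζ : ℂ} (hζ : ζ = Complex.exp (2 * Real.pi * Complex.I / M)) :
    ∑ ξ ∈ range M, ‖1 / (M:ℂ) * ∑ s ∈ range M, (chi (decide (R ≤ s))) * ((ζ ^ ξ)⁻¹) ^ s‖ ≤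
      3 + 2 * Real.log M := by
  have hp : IsPrimitiveRoot ζ M := by rw [hζ]; exact Complex.isPrimitiveRoot_exp M hM.ne'
  have hMr : (0:ℝ) < M := by exact_mod_cast hM
  obtain ⟨N, rfl⟩ : ∃ N, M = N + 1 := ⟨M - 1, by omega⟩
  rw [sum_range_succ']
  have h0 : ‖1 / ((N + 1 : ℕ):ℂ) * ∑ s ∈ range (N + 1), (chi (decide (R ≤ s))) * ((ζ ^ 0)⁻¹) ^ s‖ ≤ 1 := by
    rw [norm_mul, norm_div, norm_one, Complex.norm_natCast, div_mul_eq_mul_div, one_mul, div_le_iff₀ hMr]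
    refine (norm_sum_le _ _).trans ?_
    calc _ ≤ ∑ s ∈ range (N + 1), (1:ℝ) := by
          refine sum_le_sum fun s _ => ?_
          rw [pow_zero, inv_one, one_pow, mul_one, chi]
          split_ifs <;> simp
      _ = _ := by simp
  have h1 : ∑ ξ ∈ range N, ‖1 / ((N + 1 : ℕ):ℂ) * ∑ s ∈ range (N + 1), (chi (decide (R ≤ s))) *
      ((ζ ^ (ξ + 1))⁻¹) ^ s‖ ≤ ∑ ξ ∈ range N, (1 / ((ξ:ℝ) + 1) + 1 / ((N:ℝ) - ξ)) := by
    refine sum_le_sum fun ξ hξ => ?_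
    rw [mem_range] at hξ
    refine (coef_le hM hR (Nat.succ_pos ξ) (by omega) hζ).trans (le_of_eq ?_)
    push_cast
    congr 2
    ring
  have h2 : ∑ ξ ∈ range N, 1 / ((N:ℝ) - ξ) = ∑ ξ ∈ range N, 1 / ((ξ:ℝ) + 1) := by
    rw [← sum_range_reflect]
    refine sum_congr rfl fun ξ hξ => ?_
    rw [mem_range] at hξ
    congr 1
    have : ((N - 1 - ξ : ℕ) : ℝ) = N - 1 - ξ := by
      rw [Nat.cast_sub (by omega), Nat.cast_sub (by omega)]; simp
    rw [this]; ring
  have h3 : ∑ ξ ∈ range N, 1 / ((ξ:ℝ) + 1) ≤ 1 + Real.log (N + 1 : ℕ) := by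
    have := harmonic_le_one_add_log N
    have e : ((harmonic N : ℚ) : ℝ) = ∑ ξ ∈ range N, 1 / ((ξ:ℝ) + 1) := by
      rw [harmonic]; push_cast
      exact sum_congr rfl fun s _ => by rw [one_div]
    rw [e] at this
    refine this.trans ?_
    rcases Nat.eq_zero_or_pos N with rfl | hN
    · simp
    · have : Real.log N ≤ Real.log (N + 1 : ℕ) :=
        Real.log_le_log (by exact_mod_cast hN) (by push_cast; linarith)
      linarith
  rw [sum_add_distrib, h2] at h1
  linarith

def IsExpSum {a : ℕ} (g : (Fin a → Bool) → Bool) (K : ℝ) : Prop :=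
  ∃ (M : ℕ) (c ω : ℕ → ℂ) (w : Fin a → ℤ), (∀ ξ, ‖ω ξ‖ = 1) ∧ (∑ ξ ∈ range M, ‖c ξ‖ ≤ K) ∧
    ∀ y, chi (g y) = ∑ ξ ∈ range M, c ξ * (ω ξ) ^ (∑ i, if y i = true then w i else 0)

theorem sym_expSum {a : ℕ} {g : (Fin a → Bool) → Bool} (hg : IsSymFun g) :
    IsExpSum g (((a:ℝ) + 10) ^ 4) := by
  obtain ⟨φ, hφ⟩ := hg
  have hM : 0 < a + 1 := by omega
  have hMr : (0:ℝ) < (a + 1 : ℕ) := by exact_mod_cast hM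
  set ζ := Complex.exp (2 * Real.pi * Complex.I / ((a + 1 : ℕ) : ℂ)) with hζ
  have hp : IsPrimitiveRoot ζ (a + 1) := Complex.isPrimitiveRoot_exp (a + 1) hM.ne'
  have hzn : ‖ζ‖ = 1 := hp.norm'_eq_one hM.ne'
  refine ⟨a + 1, fun ξ => 1 / ((a + 1 : ℕ):ℂ) * ∑ s ∈ range (a + 1), chi (φ s) * ((ζ ^ ξ)⁻¹) ^ s,
    fun ξ => ζ ^ ξ, fun _ => 1, fun ξ => by simp [hzn], ?_, ?_⟩
  · calc _ ≤ ∑ ξ ∈ range (a + 1), (1:ℝ) := by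
          refine sum_le_sum fun ξ _ => ?_
          rw [norm_mul, norm_div, norm_one, Complex.norm_natCast, div_mul_eq_mul_div, one_mul,
            div_le_iff₀ hMr]
          refine (norm_sum_le _ _).trans ?_
          calc _ ≤ ∑ s ∈ range (a + 1), (1:ℝ) := by
                refine sum_le_sum fun s _ => ?_
                rw [norm_mul, norm_pow, norm_inv, norm_pow, hzn]
                simp only [one_pow, inv_one, mul_one, chi]
                split_ifs <;> simp
            _ = _ := by simp
      _ = (a:ℝ) + 1 := by simp
      _ ≤ _ := by
        have : (0:ℝ) ≤ a := by positivity
        nlinarith [sq_nonneg ((a:ℝ)), mul_nonneg this this, pow_nonneg this 3, pow_nonneg this 4]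
  · intro y
    have e : (∑ i, if y i = true then (1:ℤ) else 0) =
        ((univ.filter (fun i => y i = true)).card : ℤ) := by
      rw [card_filter]; push_cast; rfl
    rw [e, hφ]
    have hlt : (univ.filter (fun i => y i = true)).card < a + 1 := by
      have := card_le_univ (univ.filter (fun i => y i = true))
      rw [Fintype.card_fin] at this
      omega
    have := dft_inv hM hp (fun s => chi (φ s)) hlt
    rw [this]
    simp only [zpow_natCast]

theorem thr_expSum {a : ℕ} {g : (Fin a → Bool) → Bool} (hg : IsThrFun g) :
    IsExpSum g (((a:ℝ) + 10) ^ 4) := by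
  obtain ⟨w, θ, hg⟩ := hg
  set n := a + 1 with hn
  obtain ⟨v, hv, hb⟩ := int_weights n (Fin.cons (-θ) w : Fin n → ℝ)
    ((card_le_univ _).trans (by simp [hn]))
  set B : ℤ := (((n:ℤ) + 1) ^ n + 2) ^ n * ((n:ℤ) + 1) ^ n with hB
  have hn1 : (1:ℤ) ≤ n := by rw [hn]; push_cast; linarith [Int.natCast_nonneg a]
  have hB1 : 1 ≤ B := by
    have := hv 0
    have := abs_nonneg (v 0)
    linarith
  -- the linear form
  have hform : ∀ y : Fin a → Bool, g y = decide (0 ≤ v 0 + ∑ i, if y i = true then v (Fin.succ i) else 0) := by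
    intro y
    have h1 := hb (Fin.cons 1 fun i => if y i = true then 1 else 0) (by
      intro i
      refine Fin.cases ?_ (fun i => ?_) i
      · simp
      · simp only [Fin.cons_succ]; split_ifs <;> simp)
    have h2 := hb (fun i => -((Fin.cons 1 fun i => if y i = true then 1 else 0 : Fin (a + 1) → ℤ) i)) (by
      intro i
      rw [abs_neg]
      refine Fin.cases ?_ (fun i => ?_) i
      · simp
      · simp only [Fin.cons_succ]; split_ifs <;> simp)
    simp only [mul_neg, sum_neg_distrib, Int.cast_neg] at h2
    have e1 : ∑ i, (Fin.cons (-θ) w : Fin (a + 1) → ℝ) i *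
        (((Fin.cons 1 fun i => if y i = true then 1 else 0 : Fin (a + 1) → ℤ) i : ℤ) : ℝ) =
        -θ + ∑ i, if y i = true then w i else 0 := by
      rw [Fin.sum_univ_succ]
      simp only [Fin.cons_zero, Fin.cons_succ, Int.cast_one, mul_one, Int.cast_ite, Int.cast_zero,
        mul_ite, mul_zero]
    have e2 : ∑ i, v i * (Fin.cons 1 fun i => if y i = true then 1 else 0 : Fin (a + 1) → ℤ) i =
        v 0 + ∑ i, if y i = true then v (Fin.succ i) else 0 := by
      rw [Fin.sum_univ_succ]
      simp only [Fin.cons_zero, Fin.cons_succ, mul_one, mul_ite, mul_zero]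
    rw [e1, e2] at h1 h2
    rw [hg]
    congr 1
    apply propext
    constructor
    · intro h
      rcases h.lt_or_eq with h | h
      · exact (h1.1 (by linarith)).le
      · exact (h1.2 (by linarith)).le
    · intro h
      by_contra hc
      push Not at hc
      have := h2.1 (by linarith)
      linarith
  set R : ℕ := (n * B).toNat with hRdef
  have hRB : (R : ℤ) = n * B := by rw [hRdef, Int.toNat_of_nonneg]; positivity
  have hbound : ∀ y : Fin a → Bool, |v 0 + ∑ i, if y i = true then v (Fin.succ i) else 0| ≤ R := by
    intro y
    rw [hRB]
    have h1 : ∀ i, |v i| ≤ B := fun i => by have := hv i; linarith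
    calc _ ≤ |v 0| + |∑ i, if y i = true then v (Fin.succ i) else 0| := abs_add_le _ _
      _ ≤ B + ∑ i : Fin a, B := by
          refine add_le_add (h1 0) ((abs_sum_le_sum_abs _ _).trans (sum_le_sum fun i _ => ?_))
          split_ifs
          · exact h1 _
          · simp; linarith
      _ = _ := by rw [sum_const, card_univ, Fintype.card_fin, nsmul_eq_mul, hn]; push_cast; ring
  set M := 2 * R + 1 with hMdef
  have hM : 0 < M := by omega
  set ζ := Complex.exp (2 * Real.pi * Complex.I / (M : ℂ)) with hζ
  have hp : IsPrimitiveRoot ζ M := Complex.isPrimitiveRoot_exp M hM.ne'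
  have hzn : ‖ζ‖ = 1 := hp.norm'_eq_one hM.ne'
  have hz0 : ζ ≠ 0 := hp.ne_zero hM.ne'
  refine ⟨M, fun ξ => (1 / (M:ℂ) * ∑ s ∈ range M, chi (decide (R ≤ s)) * ((ζ ^ ξ)⁻¹) ^ s) *
      (ζ ^ ξ) ^ (v 0 + R), fun ξ => ζ ^ ξ, fun i => v (Fin.succ i), fun ξ => by simp [hzn], ?_, ?_⟩
  · have h1 := coef_sum hM (R := R) (by omega) hζ
    have h2 : Real.log M ≤ ((n:ℝ) ^ 2 + 3 * n + 2) * n := by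
      have hMB : (M:ℤ) ≤ ((n:ℤ) + 1) ^ (n ^ 2 + 3 * n + 2) := by
        have hX : ((n:ℤ) + 1) ^ n + 2 ≤ ((n:ℤ) + 1) ^ (n + 2) := by
          have : (1:ℤ) ≤ ((n:ℤ) + 1) ^ n := one_le_pow₀ (by linarith)
          have h4 : (4:ℤ) ≤ ((n:ℤ) + 1) ^ 2 := by nlinarith
          rw [pow_add _ n 2]
          have := mul_le_mul_of_nonneg_left h4 (by linarith : (0:ℤ) ≤ ((n:ℤ) + 1) ^ n)
          linarith
        have hB2 : B ≤ ((n:ℤ) + 1) ^ (n ^ 2 + 3 * n) := by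
          calc B ≤ (((n:ℤ) + 1) ^ (n + 2)) ^ n * ((n:ℤ) + 1) ^ n := by rw [hB]; gcongr
            _ = _ := by rw [← pow_mul, ← pow_add]; congr 1; ring
        rw [pow_add]
        have : (M:ℤ) = 2 * (n * B) + 1 := by rw [hMdef]; push_cast; rw [hRB]
        rw [this]
        have h3 : B * ((n:ℤ) + 1) ^ 2 ≤ ((n:ℤ) + 1) ^ (n ^ 2 + 3 * n) * ((n:ℤ) + 1) ^ 2 := by gcongr
        nlinarith
      have hMR : (M:ℝ) ≤ ((n:ℝ) + 1) ^ (n ^ 2 + 3 * n + 2) := by exact_mod_cast hMB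
      have hMr : (0:ℝ) < M := by exact_mod_cast hM
      have h4 := Real.log_le_log hMr hMR
      rw [Real.log_pow] at h4
      refine h4.trans ?_
      push_cast
      refine mul_le_mul_of_nonneg_left ?_ (by positivity)
      have := Real.log_le_sub_one_of_pos (x := (n:ℝ) + 1) (by positivity)
      linarith
    calc _ = ∑ ξ ∈ range M, ‖1 / (M:ℂ) * ∑ s ∈ range M, chi (decide (R ≤ s)) * ((ζ ^ ξ)⁻¹) ^ s‖ := by
          refine sum_congr rfl fun ξ _ => ?_
          rw [norm_mul _ ((ζ ^ ξ) ^ (v 0 + (R:ℤ))), norm_zpow, norm_pow, hzn]; simp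
      _ ≤ 3 + 2 * Real.log M := h1
      _ ≤ 3 + 2 * (((n:ℝ) ^ 2 + 3 * n + 2) * n) := by linarith
      _ ≤ _ := by
        have h0 : (0:ℝ) ≤ a := by positivity
        rw [hn]; push_cast
        nlinarith [mul_nonneg h0 h0, pow_nonneg h0 3, pow_nonneg h0 4]
  · intro y
    rw [hform]
    set T : ℤ := ∑ i, if y i = true then v (Fin.succ i) else 0 with hT
    have hb' := abs_le.1 (hbound y)
    obtain ⟨s, hs⟩ : ∃ s : ℕ, (s:ℤ) = v 0 + T + R := ⟨(v 0 + T + R).toNat, Int.toNat_of_nonneg (by linarith)⟩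
    have hsM : s < M := by rw [hMdef]; omega
    have := dft_inv hM hp (fun s => chi (decide (R ≤ s))) hsM
    have e : decide (0 ≤ v 0 + T) = decide (R ≤ s) := by
      congr 1; apply propext; constructor <;> intro h <;> omega
    rw [e, this]
    refine sum_congr rfl fun ξ _ => ?_
    dsimp only
    rw [mul_assoc _ ((ζ ^ ξ) ^ (v 0 + (R:ℤ))), ← zpow_add₀ (pow_ne_zero _ hz0),
      ← zpow_natCast (ζ ^ ξ) s, hs]
    congr 2
    ring

end Four

/-! ### The Babai, Nisan and Szegedy bound -/

section BNS

variable {m : ℕ}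

/-- masked and shifted GIP -/
noncomputable def mgip {K : ℕ} (c : Fin m → Bool) (b z : Fin K → Fin m → Bool) : ℂ :=
  ∏ i, if c i = true ∧ ∀ j, (xor (b j i) (z j i)) = true then (-1:ℂ) else 1

noncomputable def bet (k : ℕ) : ℝ := 1 - 1 / 4 ^ k

theorem bet_nonneg (k : ℕ) : 0 ≤ bet k := by
  unfold bet
  have : (1:ℝ) / 4 ^ k ≤ 1 := by
    rw [div_le_one (by positivity)]; exact one_le_pow₀ (by norm_num)
  linarith

theorem bet_step (k : ℕ) : (1 + bet k) / 2 ≤ bet (k + 1) ^ 2 := by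
  unfold bet
  have : (1:ℝ) / 4 ^ (k + 1) = 1 / 4 ^ k / 4 := by rw [pow_succ]; field_simp
  rw [this]
  nlinarith [sq_nonneg ((1:ℝ) / 4 ^ k)]

noncomputable def betW (k : ℕ) (c : Fin m → Bool) : ℝ := ∏ i, if c i = true then bet k else 1

theorem sum_fin_cons {X : Type} [Fintype X] {K : ℕ} (F : (Fin (K + 1) → X) → ℂ) :
    ∑ z, F z = ∑ x, ∑ z', F (Fin.cons x z') := by
  rw [← (Fin.consEquiv (fun _ : Fin (K + 1) => X)).sum_comp, Fintype.sum_prod_type]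
  rfl

theorem mgip_mul {K : ℕ} (c : Fin m → Bool) (b : Fin (K + 1) → Fin m → Bool)
    (x y : Fin m → Bool) (z : Fin K → Fin m → Bool) :
    mgip c b (Fin.cons x z) * mgip c b (Fin.cons y z) =
      mgip (fun i => c i && (xor (x i) (y i))) (fun j => b (Fin.succ j)) z := by
  unfold mgip
  rw [← prod_mul_distrib]
  refine prod_congr rfl fun i _ => ?_
  simp only [Fin.forall_fin_succ, Fin.cons_zero, Fin.cons_succ]
  by_cases h : ∀ j : Fin K, (xor (b (Fin.succ j) i) (z j i)) = true
  · have h' := eq_true h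
    simp only [h', and_true]
    cases c i <;> cases b 0 i <;> cases x i <;> cases y i <;> simp
  · have h' := eq_false h
    simp only [h', and_false]
    simp

theorem star_mgip {K : ℕ} (c : Fin m → Bool) (b z : Fin K → Fin m → Bool) :
    star (mgip c b z) = mgip c b z := by
  unfold mgip
  rw [star_prod]
  refine prod_congr rfl fun i _ => ?_
  split_ifs <;> simp

theorem betW_sum (k : ℕ) (c x : Fin m → Bool) :
    ∑ y : Fin m → Bool, betW k (fun i => c i && (xor (x i) (y i))) ≤
      2 ^ m * betW (k + 1) c ^ 2 := by
  unfold betW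
  have e := (Finset.prod_univ_sum (fun _ : Fin m => (univ : Finset Bool))
    (fun i t => if (c i && (xor (x i) t)) = true then bet k else 1)).symm
  rw [Fintype.piFinset_univ] at e
  rw [e]
  have e2 : (2:ℝ) ^ m = ∏ _i : Fin m, (2:ℝ) := by simp
  rw [e2, ← prod_pow, ← prod_mul_distrib]
  have hb := bet_nonneg k
  refine prod_le_prod (fun i _ => ?_) (fun i _ => ?_)
  · refine sum_nonneg fun t _ => ?_
    split_ifs <;> linarith
  · have := bet_step k
    rw [Fintype.sum_bool]
    cases c i <;> cases x i <;> simp <;> linarith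

theorem bns (k : ℕ) : ∀ (c : Fin m → Bool) (b : Fin (k + 1) → Fin m → Bool)
    (φ : Fin (k + 1) → (Fin (k + 1) → Fin m → Bool) → ℂ) (_ : ∀ j z, ‖φ j z‖ ≤ 1)
    (_ : ∀ j z y, φ j (Function.update z j y) = φ j z),
    ‖∑ z, mgip c b z * ∏ j, φ j z‖ ≤ (2 ^ m) ^ (k + 1) * betW k c := by
  induction k with
  | zero =>
    intro c b φ h1 h2
    have hc : ∀ z : Fin 1 → Fin m → Bool, φ 0 z = φ 0 (fun _ _ => true) := by
      intro z
      rw [← h2 0 (fun _ _ => true) (z 0)]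
      congr 1
      funext j
      have : j = 0 := Subsingleton.elim _ _
      subst this; simp
    have e0 : ∀ z, ∏ j : Fin (0 + 1), φ j z = φ 0 (fun _ _ => true) := fun z => by
      rw [Fin.prod_univ_succ]; simp [hc z]
    simp_rw [e0]
    rw [← sum_mul, norm_mul, sum_fin_cons]
    have e : ∑ x : Fin m → Bool, ∑ z' : Fin 0 → Fin m → Bool, mgip c b (Fin.cons x z') =
        ∏ i : Fin m, if c i = true then (0:ℂ) else 2 := by
      simp only [univ_unique, sum_singleton, mgip]
      have e := (Finset.prod_univ_sum (fun _ : Fin m => (univ : Finset Bool))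
        (fun i t => if c i = true ∧ (xor (b 0 i) t) = true then (-1:ℂ) else 1)).symm
      rw [Fintype.piFinset_univ] at e
      simp only [Fin.forall_fin_succ, Fin.cons_zero, IsEmpty.forall_iff, and_true]
      refine Eq.trans e (prod_congr rfl fun i _ => ?_)
      rw [Fintype.sum_bool]
      cases c i <;> cases b 0 i <;> simp <;> norm_num
    rw [e]
    have e3 : ‖∏ i : Fin m, if c i = true then (0:ℂ) else 2‖ = 2 ^ m * betW 0 c := by
      have e2 : (2:ℝ) ^ m = ∏ _i : Fin m, (2:ℝ) := by simp
      rw [norm_prod, betW, e2, ← prod_mul_distrib]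
      refine prod_congr rfl fun i _ => ?_
      cases c i <;> simp [bet]
    rw [e3, pow_one]
    have : 0 ≤ (2:ℝ) ^ m * betW 0 c := by rw [← e3]; positivity
    exact mul_le_of_le_one_right this (h1 _ _)
  | succ k ih =>
    intro c b φ h1 h2
    set N : ℝ := 2 ^ m with hN
    have hN0 : 0 < N := by positivity
    have hbn : ∀ k (c : Fin m → Bool), 0 ≤ betW k c := by
      intro k c
      refine prod_nonneg fun i _ => ?_
      split_ifs
      · exact bet_nonneg k
      · norm_num
    set z0 : Fin m → Bool := fun _ => true with hz0
    set G : (Fin m → Bool) → (Fin (k + 1) → Fin m → Bool) → ℂ := fun x z =>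
      mgip c b (Fin.cons x z) * ∏ j : Fin (k + 1), φ (Fin.succ j) (Fin.cons x z) with hG
    have e1 : ∑ z, mgip c b z * ∏ j, φ j z = ∑ z', φ 0 (Fin.cons z0 z') * ∑ x, G x z' := by
      rw [sum_fin_cons, sum_comm]
      refine sum_congr rfl fun z' _ => ?_
      rw [mul_sum]
      refine sum_congr rfl fun x _ => ?_
      rw [Fin.prod_univ_succ, hG]
      have : φ 0 (Fin.cons x z') = φ 0 (Fin.cons z0 z') := by
        rw [← h2 0 (Fin.cons z0 z') x, Fin.update_cons_zero]
      rw [this]; ring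
    have e2 : ‖∑ z, mgip c b z * ∏ j, φ j z‖ ≤ ∑ z', ‖∑ x, G x z'‖ := by
      rw [e1]
      refine (norm_sum_le _ _).trans (sum_le_sum fun z' _ => ?_)
      rw [norm_mul]
      exact mul_le_of_le_one_left (norm_nonneg _) (h1 _ _)
    have e3 : (∑ z' : Fin (k + 1) → Fin m → Bool, ‖∑ x, G x z'‖) ^ 2 ≤
        N ^ (k + 1) * ∑ z', ‖∑ x, G x z'‖ ^ 2 := by
      have := sq_sum_le_card_mul_sum_sq (s := (univ : Finset (Fin (k + 1) → Fin m → Bool)))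
        (f := fun z' => ‖∑ x, G x z'‖)
      refine this.trans (le_of_eq ?_)
      rw [card_univ]
      simp [hN]
    have e4 : ((∑ z', ‖∑ x, G x z'‖ ^ 2 : ℝ) : ℂ) =
        ∑ x, ∑ y, ∑ z', G x z' * star (G y z') := by
      push_cast
      have : ∀ z' : Fin (k + 1) → Fin m → Bool, ((‖∑ x, G x z'‖ : ℂ)) ^ 2 =
          ∑ x, ∑ y, G x z' * star (G y z') := by
        intro z'
        rw [← Complex.mul_conj', starRingEnd_apply, star_sum, sum_mul_sum]
      simp_rw [this]
      rw [sum_comm]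
      refine sum_congr rfl fun x _ => ?_
      rw [sum_comm]
    have e5 : ∀ x y, ‖∑ z', G x z' * star (G y z')‖ ≤
        N ^ (k + 1) * betW k (fun i => c i && (xor (x i) (y i))) := by
      intro x y
      have := ih (fun i => c i && (xor (x i) (y i))) (fun j => b (Fin.succ j))
        (fun j z => φ (Fin.succ j) (Fin.cons x z) * star (φ (Fin.succ j) (Fin.cons y z)))
        (by
          intro j z
          rw [norm_mul, norm_star]
          exact mul_le_one₀ (h1 _ _) (norm_nonneg _) (h1 _ _))
        (by
          intro j z t
          rw [Fin.cons_update, Fin.cons_update, h2, h2])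
      refine le_trans (le_of_eq ?_) this
      congr 1
      refine sum_congr rfl fun z _ => ?_
      rw [← mgip_mul, hG]
      simp only [star_mul', star_mgip, star_prod]
      rw [prod_mul_distrib]
      ring
    have e6 : ∑ z', ‖∑ x, G x z'‖ ^ 2 ≤ N * (N ^ (k + 1) * (N * betW (k + 1) c ^ 2)) := by
      have hre : (∑ z', ‖∑ x, G x z'‖ ^ 2 : ℝ) = ‖∑ x, ∑ y, ∑ z', G x z' * star (G y z')‖ := by
        rw [← e4, Complex.norm_real, Real.norm_of_nonneg]
        positivity
      rw [hre]
      refine (norm_sum_le _ _).trans ?_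
      calc _ ≤ ∑ x : Fin m → Bool, N ^ (k + 1) * (N * betW (k + 1) c ^ 2) := by
            refine sum_le_sum fun x _ => (norm_sum_le _ _).trans ?_
            refine (sum_le_sum fun y _ => e5 x y).trans ?_
            rw [← mul_sum]
            exact mul_le_mul_of_nonneg_left (betW_sum k c x) (by positivity)
        _ = _ := by rw [sum_const, card_univ]; simp [hN]
    have h7 : ‖∑ z, mgip c b z * ∏ j, φ j z‖ ^ 2 ≤ (N ^ (k + 1 + 1) * betW (k + 1) c) ^ 2 := by
      calc _ ≤ (∑ z' : Fin (k + 1) → Fin m → Bool, ‖∑ x, G x z'‖) ^ 2 :=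
            pow_le_pow_left₀ (norm_nonneg _) e2 2
        _ ≤ N ^ (k + 1) * ∑ z', ‖∑ x, G x z'‖ ^ 2 := e3
        _ ≤ N ^ (k + 1) * (N * (N ^ (k + 1) * (N * betW (k + 1) c ^ 2))) :=
            mul_le_mul_of_nonneg_left e6 (by positivity)
        _ = _ := by ring
    exact le_of_sq_le_sq h7 (mul_nonneg (by positivity) (hbn _ _))

theorem betW_one_le (k : ℕ) : betW k (fun _ : Fin m => true) ≤ Real.exp (-((m:ℝ) / 4 ^ k)) := by
  have h1 := Real.add_one_le_exp (-(1 / (4:ℝ) ^ k))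
  unfold betW
  simp only [if_true, prod_const, card_univ, Fintype.card_fin]
  calc bet k ^ m ≤ (Real.exp (-(1 / (4:ℝ) ^ k))) ^ m :=
        pow_le_pow_left₀ (bet_nonneg k) (by unfold bet; linarith) _
    _ = _ := by rw [← Real.exp_nat_mul]; congr 1; ring

end BNS

/-! ### Correlation at the leaves -/

section Leaf

/-- `s` does not depend on the variables of party `j`. -/
def indepOf {ι : Type} {K : ℕ} (party : ι → Fin K) (j : Fin K) (s : (ι → Bool) → ℤ) : Prop :=
  ∀ x x', (∀ v, party v ≠ j → x v = x' v) → s x = s x'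

theorem tree_decomp {ι : Type} [DecidableEq ι] {k : ℕ} (party : ι → Fin (k + 1))
    (f : (ι → Bool) → Bool) (w : ℕ) : ∀ (σ : ι → Option Bool) (_ : DD f w σ)
    (P : Finset (Fin (k + 1))) (_ : P.card + w ≤ k) (u : (ι → Bool) → ℤ)
    (_ : ∀ j, j ∉ P → indepOf party j u),
    ∃ s : Fin (k + 1) → (ι → Bool) → ℤ, (∀ j, indepOf party j (s j)) ∧
      ∀ x, u x * (if f (applyR σ x) = true then 1 else 0) = ∑ j, s j x := by
  have base : ∀ (σ : ι → Option Bool) (_ : ConstR f σ)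
    (P : Finset (Fin (k + 1))) (_ : P.card ≤ k) (u : (ι → Bool) → ℤ)
    (_ : ∀ j, j ∉ P → indepOf party j u),
    ∃ s : Fin (k + 1) → (ι → Bool) → ℤ, (∀ j, indepOf party j (s j)) ∧
      ∀ x, u x * (if f (applyR σ x) = true then 1 else 0) = ∑ j, s j x := by
    rintro σ ⟨b, hb⟩ P hP u hu
    obtain ⟨j0, hj0⟩ : ∃ j0, j0 ∉ P := by
      by_contra hcon
      push Not at hcon
      have : P = univ := by ext; simp [hcon]
      rw [this, card_univ, Fintype.card_fin] at hP
      omega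
    refine ⟨fun j x => if j = j0 then u x * (if b = true then 1 else 0) else 0, ?_, ?_⟩
    · intro j x x' hx
      by_cases h : j = j0
      · subst h
        simp only [if_true]
        rw [hu j hj0 x x' hx]
      · simp [h]
    · intro x
      simp [hb x]
  induction w with
  | zero => intro σ h P hP u hu; exact base σ h P (by omega) u hu
  | succ w ih =>
    rintro σ (h | ⟨v, hv, h⟩) P hP u hu
    · exact base σ h P (by omega) u hu
    · have hP' : (insert (party v) P).card + w ≤ k := by
        have := card_insert_le (party v) P
        omega
      have key : ∀ b, ∃ s : Fin (k + 1) → (ι → Bool) → ℤ, (∀ j, indepOf party j (s j)) ∧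
          ∀ x, (u x * (if x v = b then 1 else 0)) *
            (if f (applyR (Function.update σ v (some b)) x) = true then 1 else 0) =
              ∑ j, s j x := by
        intro b
        refine ih _ (h b) (insert (party v) P) hP' _ ?_
        intro j hj x x' hx
        simp only [mem_insert, not_or] at hj
        have e1 := hu j hj.2 x x' hx
        have e2 := hx v (fun h => hj.1 h.symm)
        simp only
        rw [e1, e2]
      obtain ⟨s0, hs0, hs0'⟩ := key false
      obtain ⟨s1, hs1, hs1'⟩ := key true
      refine ⟨fun j x => s0 j x + s1 j x, ?_, ?_⟩
      · intro j x x' hx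
        simp only
        rw [hs0 j x x' hx, hs1 j x x' hx]
      · intro x
        rw [sum_add_distrib, ← hs0' x, ← hs1' x]
        have e : applyR σ x = applyR (Function.update σ v (some (x v))) x := by
          funext u
          by_cases huv : u = v
          · subst huv; simp [applyR, hv]
          · simp [applyR, huv]
        rw [e]
        cases x v <;> simp

theorem chi_xor (a b : Bool) : chi (xor a b) = chi a * chi b := by
  cases a <;> cases b <;> simp [chi]

theorem chi_inj {a b : Bool} (h : chi a = chi b) : a = b := by
  cases a <;> cases b <;> simp [chi] at h ⊢ <;> norm_num [Complex.ext_iff] at h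

theorem chi_bparity {α : Type} [Fintype α] (f : α → Bool) : chi (bparity f) = ∏ a, chi (f a) := by
  have : ∏ a, chi (f a) = (-1) ^ (univ.filter fun a => f a = true).card := by
    unfold chi
    rw [prod_ite]; simp
  rw [this]
  unfold bparity chi
  rcases Nat.mod_two_eq_zero_or_one (univ.filter fun a => f a = true).card with h | h
  · have h2 := Nat.even_iff.2 h
    simp [h, h2.neg_one_pow]
  · have h2 := Nat.odd_iff.2 h
    simp [h, h2.neg_one_pow]

variable {m k r : ℕ}

/-- shift the input at the selected positions -/
def shiftZ (e : Fin m → Fin (k + 1) → Fin r) (x : Fin m × Fin (k + 1) × Fin r → Bool)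
    (z : Fin (k + 1) → Fin m → Bool) : Fin m × Fin (k + 1) × Fin r → Bool :=
  fun v => xor (x v) (decide (v.2.2 = e v.1 v.2.1) && z v.2.1 v.1)

theorem shiftZ_invol (e : Fin m → Fin (k + 1) → Fin r) (z : Fin (k + 1) → Fin m → Bool) :
    Function.Involutive (fun x => shiftZ e x z) := by
  intro x
  funext v
  simp [shiftZ, Bool.xor_assoc]

theorem bparity_shift (e : Fin m → Fin (k + 1) → Fin r) (x : Fin m × Fin (k + 1) × Fin r → Bool)
    (z : Fin (k + 1) → Fin m → Bool) (i : Fin m) (j : Fin (k + 1)) :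
    bparity (fun ℓ : Fin r => shiftZ e x z (i, j, ℓ)) =
      xor (bparity (fun ℓ : Fin r => x (i, j, ℓ))) (z j i) := by
  apply chi_inj
  rw [chi_xor, chi_bparity, chi_bparity]
  simp only [shiftZ, chi_xor]
  rw [prod_mul_distrib]
  congr 1
  rw [prod_eq_single (e i j)]
  · simp
  · intro l _ hl
    simp [hl, chi]
  · simp

theorem chi_RW_shift (e : Fin m → Fin (k + 1) → Fin r)
    (x : Fin m × Fin (k + 1) × Fin r → Bool) (z : Fin (k + 1) → Fin m → Bool) :
    chi (RW m k r (shiftZ e x z)) =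
      mgip (fun _ => true) (fun j i => bparity (fun ℓ : Fin r => x (i, j, ℓ))) z := by
  unfold RW
  rw [chi_bparity]
  unfold mgip
  refine prod_congr rfl fun i _ => ?_
  simp only [bparity_shift, chi, decide_eq_true_eq, true_and]

theorem applyR_shift (e : Fin m → Fin (k + 1) → Fin r) (σ : Fin m × Fin (k + 1) × Fin r → Option Bool)
    (he : ∀ i j, σ (i, j, e i j) = none) (x : Fin m × Fin (k + 1) × Fin r → Bool)
    (z : Fin (k + 1) → Fin m → Bool) :
    applyR σ (shiftZ e x z) = shiftZ e (applyR σ x) z := by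
  funext v
  obtain ⟨i, j, l⟩ := v
  by_cases h : l = e i j
  · subst h; simp [applyR, shiftZ, he]
  · simp [applyR, shiftZ, h]

theorem prod_zpow_eq {K : ℕ} {w : ℂ} (hw : w ≠ 0) (s : Fin K → ℤ) :
    ∏ j, w ^ (s j) = w ^ (∑ j, s j) := by
  have : ∀ A : Finset (Fin K), ∏ j ∈ A, w ^ (s j) = w ^ (∑ j ∈ A, s j) := by
    intro A
    induction A using Finset.induction_on with
    | empty => simp
    | insert a A ha ih => rw [prod_insert ha, sum_insert ha, zpow_add₀ hw, ih]
  exact this univ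

set_option maxHeartbeats 1000000 in
theorem leaf_complex {a : ℕ} (f : Fin a → (Fin m × Fin (k + 1) × Fin r → Bool) → Bool)
    {g : (Fin a → Bool) → Bool} {K : ℝ} (hg : IsExpSum g K)
    (σ : Fin m × Fin (k + 1) × Fin r → Option Bool)
    (hσ : ∀ i j, ∃ l, σ (i, j, l) = none) (hf : ∀ i, DD (f i) k σ) :
    ‖∑ x, chi (RW m k r (applyR σ x)) * chi (g fun i => f i (applyR σ x))‖ ≤
      2 ^ Fintype.card (Fin m × Fin (k + 1) × Fin r) * (K * Real.exp (-((m:ℝ) / 4 ^ k))) := by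
  choose e he using hσ
  obtain ⟨M, c, ω, w, hω, hc, hg⟩ := hg
  have hs := fun i => tree_decomp (fun v : Fin m × Fin (k + 1) × Fin r => v.2.1) (f i) k σ (hf i) ∅ (by simp)
    (fun _ => 1) (fun _ _ _ _ _ => rfl)
  choose s hs1 hs2 using hs
  simp only [one_mul] at hs2
  set H : (Fin m × Fin (k + 1) × Fin r → Bool) → ℂ := fun x =>
    chi (RW m k r (applyR σ x)) * chi (g fun i => f i (applyR σ x)) with hH
  have hω0 : ∀ ξ, ω ξ ≠ 0 := fun ξ h => by simpa [h] using hω ξ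
  have inner : ∀ x, ‖∑ z, H (shiftZ e x z)‖ ≤
      (2 ^ m) ^ (k + 1) * (K * Real.exp (-((m:ℝ) / 4 ^ k))) := by
    intro x
    set b : Fin (k + 1) → Fin m → Bool :=
      fun j i => bparity (fun ℓ : Fin r => applyR σ x (i, j, ℓ)) with hb
    have e1 : ∑ z, H (shiftZ e x z) = ∑ ξ ∈ range M, c ξ * ∑ z, mgip (fun _ => true) b z *
        ∏ j, (ω ξ) ^ (∑ i, w i * s i j (shiftZ e x z)) := by
      simp_rw [mul_sum]
      rw [sum_comm]
      refine sum_congr rfl fun z _ => ?_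
      rw [hH]
      simp only
      rw [hg, mul_sum, applyR_shift e σ he, chi_RW_shift]
      refine sum_congr rfl fun ξ _ => ?_
      rw [prod_zpow_eq (hω0 ξ)]
      have : (∑ i, if f i (shiftZ e (applyR σ x) z) = true then w i else 0) =
          ∑ j, ∑ i, w i * s i j (shiftZ e x z) := by
        rw [sum_comm]
        refine sum_congr rfl fun i _ => ?_
        rw [← mul_sum, ← hs2 i, applyR_shift e σ he]
        simp
      rw [this]; ring
    rw [e1]
    refine (norm_sum_le _ _).trans ?_
    have e2 : ∀ ξ ∈ range M, ‖c ξ * ∑ z, mgip (fun _ => true) b z *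
        ∏ j, (ω ξ) ^ (∑ i, w i * s i j (shiftZ e x z))‖ ≤
        ‖c ξ‖ * ((2 ^ m) ^ (k + 1) * Real.exp (-((m:ℝ) / 4 ^ k))) := by
      intro ξ _
      rw [norm_mul]
      refine mul_le_mul_of_nonneg_left ?_ (norm_nonneg _)
      refine (bns k (fun _ => true) b
        (fun j z => (ω ξ) ^ (∑ i, w i * s i j (shiftZ e x z))) ?_ ?_).trans ?_
      · intro j z
        rw [norm_zpow, hω, one_zpow]
      · intro j z y
        congr 1
        refine sum_congr rfl fun i _ => ?_
        congr 1
        refine hs1 i j _ _ ?_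
        intro v hv
        simp only [shiftZ]
        rw [Function.update_of_ne hv]
      · exact mul_le_mul_of_nonneg_left (betW_one_le k) (by positivity)
    refine (sum_le_sum e2).trans ?_
    rw [← sum_mul]
    calc _ ≤ K * ((2 ^ m) ^ (k + 1) * Real.exp (-((m:ℝ) / 4 ^ k))) :=
          mul_le_mul_of_nonneg_right hc (by positivity)
      _ = _ := by ring
  have hshift : ∀ z, ∑ x, H (shiftZ e x z) = ∑ x, H x := fun z =>
    Equiv.sum_comp (shiftZ_invol e z).toPerm H
  have tot : ((2:ℝ) ^ m) ^ (k + 1) * ‖∑ x, H x‖ ≤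
      2 ^ Fintype.card (Fin m × Fin (k + 1) × Fin r) * ((2 ^ m) ^ (k + 1) * (K * Real.exp (-((m:ℝ) / 4 ^ k)))) := by
    have : ((2:ℝ) ^ m) ^ (k + 1) * ‖∑ x, H x‖ = ‖∑ x, ∑ z, H (shiftZ e x z)‖ := by
      rw [sum_comm]
      simp_rw [hshift]
      rw [sum_const, card_univ, nsmul_eq_mul, norm_mul]
      congr 1
      simp
    rw [this]
    refine (norm_sum_le _ _).trans ((sum_le_sum fun x _ => inner x).trans (le_of_eq ?_))
    rw [sum_const, card_univ, nsmul_eq_mul]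
    congr 1
    simp
  have hp : (0:ℝ) < ((2:ℝ) ^ m) ^ (k + 1) := by positivity
  refine le_of_mul_le_mul_left (tot.trans (le_of_eq ?_)) hp
  ring

def sg (b : Bool) : ℝ := if b = true then -1 else 1

theorem sg_chi (b : Bool) : ((sg b : ℝ) : ℂ) = chi b := by
  cases b <;> simp [sg, chi]

theorem leaf_real {a : ℕ} (f : Fin a → (Fin m × Fin (k + 1) × Fin r → Bool) → Bool)
    {g : (Fin a → Bool) → Bool} {K : ℝ} (hg : IsExpSum g K)
    (σ : Fin m × Fin (k + 1) × Fin r → Option Bool)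
    (hσ : ∀ i j, ∃ l, σ (i, j, l) = none) (hf : ∀ i, DD (f i) k σ) :
    |avg (fun x => sg (RW m k r (applyR σ x)) * sg (g fun i => f i (applyR σ x)))| ≤
      K * Real.exp (-((m:ℝ) / 4 ^ k)) := by
  have h := leaf_complex f hg σ hσ hf
  unfold avg
  rw [← mul_sum, abs_mul, abs_of_nonneg (by positivity)]
  have e : |∑ x, sg (RW m k r (applyR σ x)) * sg (g fun i => f i (applyR σ x))| =
      ‖∑ x, chi (RW m k r (applyR σ x)) * chi (g fun i => f i (applyR σ x))‖ := by
    rw [← Real.norm_eq_abs, ← Complex.norm_real]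
    push_cast
    simp only [sg_chi]
  rw [e]
  calc _ ≤ (1 / 2 : ℝ) ^ Fintype.card (Fin m × Fin (k + 1) × Fin r) *
        (2 ^ Fintype.card (Fin m × Fin (k + 1) × Fin r) * (K * Real.exp (-((m:ℝ) / 4 ^ k)))) :=
        mul_le_mul_of_nonneg_left h (by positivity)
    _ = _ := by
        rw [← mul_assoc, ← mul_pow]; norm_num

theorem avg_split {ι : Type} [Fintype ι] [DecidableEq ι] (G : (ι → Bool) → ℝ)
    (σ : ι → Option Bool) {v : ι} (hv : σ v = none) :
    avg (fun x => G (applyR σ x)) =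
      (avg (fun x => G (applyR (Function.update σ v (some false)) x)) +
       avg (fun x => G (applyR (Function.update σ v (some true)) x))) / 2 := by
  have hinv : Function.Involutive (fun x : ι → Bool => Function.update x v (!(x v))) := by
    intro x
    simp
  have e1 : avg (fun x => G (applyR σ x)) =
      avg (fun x => G (applyR σ (Function.update x v (!(x v))))) := by
    unfold avg
    exact (Equiv.sum_comp hinv.toPerm (fun x => (1/2 : ℝ) ^ Fintype.card ι * G (applyR σ x))).symm
  have e2 : avg (fun x => G (applyR σ x)) + avg (fun x => G (applyR σ (Function.update x v (!(x v))))) =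
      avg (fun x => G (applyR (Function.update σ v (some false)) x)) +
       avg (fun x => G (applyR (Function.update σ v (some true)) x)) := by
    unfold avg
    rw [← sum_add_distrib, ← sum_add_distrib]
    refine sum_congr rfl fun x _ => ?_
    have a1 : ∀ b, applyR (Function.update σ v (some b)) x = applyR σ (Function.update x v b) := by
      intro b
      funext u
      by_cases h : u = v
      · subst h; simp [applyR, hv]
      · simp [applyR, h]
    simp only
    rw [a1, a1]
    have a2 : Function.update x v (x v) = x := by simp
    cases hx : x v with
    | false =>
      rw [hx] at a2
      rw [a2]; simp
    | true =>
      rw [hx] at a2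
      rw [a2]; simp; ring
  linarith

theorem tree_corr {a : ℕ} (f : Fin a → (Fin m × Fin (k + 1) × Fin r → Bool) → Bool)
    {g : (Fin a → Bool) → Bool} {K : ℝ} (hg : IsExpSum g K) (D : ℕ) :
    ∀ (σ : Fin m × Fin (k + 1) × Fin r → Option Bool)
    (_ : ∀ i j, D < (univ.filter fun l => σ (i, j, l) = none).card)
    (_ : CT (fun σ => ∀ i, DD (f i) k σ) D σ),
    |avg (fun x => sg (RW m k r (applyR σ x)) * sg (g fun i => f i (applyR σ x)))| ≤
      K * Real.exp (-((m:ℝ) / 4 ^ k)) := by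
  have base : ∀ (D : ℕ) (σ : Fin m × Fin (k + 1) × Fin r → Option Bool)
    (_ : ∀ i j, D < (univ.filter fun l => σ (i, j, l) = none).card)
    (_ : ∀ i, DD (f i) k σ),
    |avg (fun x => sg (RW m k r (applyR σ x)) * sg (g fun i => f i (applyR σ x)))| ≤
      K * Real.exp (-((m:ℝ) / 4 ^ k)) := by
    intro D σ h1 h2
    refine leaf_real f hg σ ?_ h2
    intro i j
    obtain ⟨l, hl⟩ := card_pos.1 ((Nat.zero_le _).trans_lt (h1 i j))
    exact ⟨l, by simpa using hl⟩
  induction D with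
  | zero => intro σ h1 h2; exact base 0 σ h1 h2
  | succ D ih =>
    rintro σ h1 (h | ⟨v, hv, h⟩)
    · exact base _ σ h1 h
    · have hb : ∀ b, |avg (fun x => sg (RW m k r (applyR (Function.update σ v (some b)) x)) *
          sg (g fun i => f i (applyR (Function.update σ v (some b)) x)))| ≤
          K * Real.exp (-((m:ℝ) / 4 ^ k)) := by
        intro b
        refine ih _ ?_ (h b)
        intro i j
        have := h1 i j
        have hsub : (univ.filter fun l => σ (i, j, l) = none) ⊆
            insert v.2.2 (univ.filter fun l => Function.update σ v (some b) (i, j, l) = none) := by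
          intro l hl
          rw [mem_insert]
          by_cases hlv : l = v.2.2
          · exact Or.inl hlv
          · right
            have : (i, j, l) ≠ v := by rintro rfl; exact hlv rfl
            simpa [this] using hl
        have := (card_le_card hsub).trans (card_insert_le _ _)
        omega
      have e := avg_split (fun y => sg (RW m k r y) * sg (g fun i => f i y)) σ hv
      rw [e]
      have h0 := abs_le.1 (hb false)
      have h1 := abs_le.1 (hb true)
      rw [abs_le]
      constructor <;> linarith [h0.1, h0.2, h1.1, h1.2]

end Leaf

/-! ### Assembly -/

section Assemble

theorem sg_mul_abs (a b : Bool) : sg a * sg b ≤ 1 := by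
  cases a <;> cases b <;> simp [sg]

theorem agree_eq {ι : Type} [Fintype ι] [DecidableEq ι] (F H : (ι → Bool) → Bool) :
    agreePr F H = 1 / 2 + 1 / 2 * avg (fun x => sg (F x) * sg (H x)) := by
  unfold agreePr avg
  have h1 : ((univ.filter fun x : ι → Bool => F x = H x).card : ℝ) =
      ∑ x : ι → Bool, (1 / 2 + 1 / 2 * (sg (F x) * sg (H x))) := by
    rw [← sum_boole]
    refine sum_congr rfl fun x _ => ?_
    cases F x <;> cases H x <;> simp [sg] <;> norm_num
  rw [h1, sum_add_distrib, sum_const, card_univ, ← mul_sum, ← mul_sum]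
  have h2 : ((Fintype.card (ι → Bool) : ℕ) : ℝ) = 2 ^ Fintype.card ι := by simp
  rw [nsmul_eq_mul, h2, one_div_pow]
  field_simp

theorem assemble {m k r a : ℕ} (C : Fin a → AC0 (Fin m × Fin (k + 1) × Fin r)) {d : ℕ}
    (hd : ∀ i, (C i).depth ≤ d) {N : ℕ} (hN : ∑ i, (C i).size ≤ N)
    {g : (Fin a → Bool) → Bool} {K : ℝ} (hg : IsExpSum g K) (hK : 0 ≤ K)
    {w : ℕ} (hw : 0 < w) {p q : ℝ} (hp0 : 0 < p)
    (hp : p ≤ 1 / 2) (hpw : 32 * w * p ≤ 1) (hq0 : 0 < q) (hq : q ≤ 1 / 2) (hqw : 32 * w * q ≤ 1)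
    {t j j' : ℕ} (hj : t + 1 ≤ (w + 1) * j) (hj' : t + 1 ≤ (k + 1) * j') :
    agreePr (RW m k r) (fun x => g fun i => (C i).eval x) ≤ 1 / 2 +
      (d * (2 ^ (d * t) * ((32 * w * p) ^ (t + 1) * (3 * (N : ℝ) + 1) ^ j)) +
      2 ^ (d * t) * ((32 * w * q) ^ (t + 1) * (3 * (N : ℝ) + 1) ^ j') +
      m * (k + 1) * (2 ^ (d * t + t) * Real.exp (-(p ^ d * q * r / 2))) +
      K * Real.exp (-((m:ℝ) / 4 ^ k))) := by
  classical
  set D := d * t + t with hD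
  set P := p ^ d * q with hP
  have hP0 : 0 ≤ P := by positivity
  have hP1 : P ≤ 1 := by
    have : p ^ d ≤ 1 := pow_le_one₀ hp0.le (by linarith)
    rw [hP]
    exact mul_le_one₀ this hq0.le (by linarith)
  have hR := Rp_nonneg (ι := Fin m × Fin (k + 1) × Fin r) hP0 hP1
  set G : (Fin m × Fin (k + 1) × Fin r → Bool) → ℝ :=
    fun y => sg (RW m k r y) * sg (g fun i => (C i).eval y) with hG
  set E3 := K * Real.exp (-((m:ℝ) / 4 ^ k)) with hE3
  have hE30 : 0 ≤ E3 := by positivity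
  set Q1 : (Fin m × Fin (k + 1) × Fin r → Option Bool) → Prop :=
    fun ρ => ¬ CT (fun σ => ∀ i, DD (C i).eval k σ) D ρ with hQ1
  set Q2 : Fin m × Fin (k + 1) → (Fin m × Fin (k + 1) × Fin r → Option Bool) → Prop :=
    fun ij ρ => (univ.filter fun l => ρ (ij.1, ij.2, l) = none).card ≤ D with hQ2
  have s1 := switch_total C hd hN hw hp0 hp hpw hq0 hq hqw hj hj'
  have s2 : ∀ ij, prOf (RpDensity P) (Q2 ij) ≤ 2 ^ D * Real.exp (-(P * r / 2)) := by
    rintro ⟨i, j⟩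
    have := star_lemma hP0 hP1
      ((univ : Finset (Fin r)).map ⟨fun l => ((i, j, l) : Fin m × Fin (k + 1) × Fin r),
        fun l l' h => by simpa using h⟩) D
    rw [card_map, card_univ, Fintype.card_fin] at this
    refine le_trans (le_of_eq ?_) this
    congr 1
    funext ρ
    rw [hQ2]
    simp only
    rw [filter_map, card_map]
    rfl
  have s3 : avg G ≤ E3 + prOf (RpDensity P) (fun ρ => Q1 ρ ∨ ∃ ij, Q2 ij ρ) := by
    rw [← Rp_fair P G]
    unfold prOf
    have : E3 = ∑ ρ : Fin m × Fin (k + 1) × Fin r → Option Bool, RpDensity P ρ * E3 := by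
      rw [← sum_mul, Rp_sum, one_mul]
    rw [this, ← sum_add_distrib]
    refine sum_le_sum fun ρ _ => ?_
    by_cases hbad : Q1 ρ ∨ ∃ ij, Q2 ij ρ
    · rw [if_pos hbad]
      have h1 : avg (fun x => G (applyR ρ x)) ≤ 1 := by
        unfold avg
        calc _ ≤ ∑ x : Fin m × Fin (k + 1) × Fin r → Bool,
              (1/2 : ℝ) ^ Fintype.card (Fin m × Fin (k + 1) × Fin r) * 1 :=
              sum_le_sum fun x _ => mul_le_mul_of_nonneg_left (sg_mul_abs _ _) (by positivity)
          _ = 1 := by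
              rw [sum_const, card_univ, nsmul_eq_mul, Fintype.card_fun, Fintype.card_bool, mul_one]
              push_cast
              rw [← mul_pow]; norm_num
      have := mul_le_mul_of_nonneg_left h1 (hR ρ)
      have := mul_nonneg (hR ρ) hE30
      linarith
    · rw [if_neg hbad, add_zero]
      refine mul_le_mul_of_nonneg_left ?_ (hR ρ)
      push Not at hbad
      obtain ⟨h1, h2⟩ := hbad
      rw [hQ1] at h1
      simp only [not_not] at h1
      refine (le_abs_self _).trans (tree_corr (fun i => (C i).eval) hg D ρ ?_ h1)
      intro i j
      have := h2 (i, j)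
      rw [hQ2] at this
      simpa using this
  have s4 := prOf_or hR Q1 (fun ρ => ∃ ij, Q2 ij ρ)
  have s5 := prOf_exists hR Q2
  have s6 : ∑ ij, prOf (RpDensity P) (Q2 ij) ≤ m * (k + 1) * (2 ^ D * Real.exp (-(P * r / 2))) := by
    refine (sum_le_sum fun ij _ => s2 ij).trans (le_of_eq ?_)
    rw [sum_const, card_univ, nsmul_eq_mul]
    simp
  rw [agree_eq]
  have h0 : 0 ≤ d * (2 ^ (d * t) * ((32 * w * p) ^ (t + 1) * (3 * (N : ℝ) + 1) ^ j)) +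
      2 ^ (d * t) * ((32 * w * q) ^ (t + 1) * (3 * (N : ℝ) + 1) ^ j') := by positivity
  have h00 : 0 ≤ m * (k + 1) * (2 ^ D * Real.exp (-(P * r / 2))) := by positivity
  change _ + 1 / 2 * avg G ≤ _
  linarith

end Assemble

/-! ### Numerics -/

section Num

theorem fin_bound {t : ℕ} {X : ℝ} (hX : 0 ≤ X) (h : X + 2 ≤ t) :
    ((2:ℝ) ^ (2 * t))⁻¹ ≤ 1 / 4 * Real.exp (-X) := by
  have h2 := Real.log_two_gt_d9
  have h3 := Real.log_two_lt_d9
  have e1 : ((2:ℝ) ^ (2 * t))⁻¹ = Real.exp (-(2 * t * Real.log 2)) := by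
    rw [Real.exp_neg]
    congr 1
    have : (2 * (t:ℝ) * Real.log 2) = ((2 * t : ℕ) : ℝ) * Real.log 2 := by push_cast; ring
    rw [this, Real.exp_nat_mul, Real.exp_log (by norm_num)]
  have e2 : (1 / 4 : ℝ) = Real.exp (-(2 * Real.log 2)) := by
    rw [Real.exp_neg]
    have : 2 * Real.log 2 = ((2:ℕ):ℝ) * Real.log 2 := by norm_num
    rw [this, Real.exp_nat_mul, Real.exp_log (by norm_num)]
    norm_num
  rw [e1, e2, ← Real.exp_add]
  apply Real.exp_le_exp.2
  nlinarith

theorem exp_neg_le_two (s : ℕ) : Real.exp (-(s:ℝ)) ≤ ((2:ℝ) ^ s)⁻¹ := by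
  rw [Real.exp_neg]
  apply inv_anti₀ (by positivity)
  have : Real.exp (s:ℝ) = Real.exp 1 ^ s := by rw [← Real.exp_nat_mul]; simp
  rw [this]
  have := Real.add_one_le_exp (1:ℝ)
  exact pow_le_pow_left₀ (by norm_num) (by linarith) _

theorem le_inv_of_pow {Y : ℝ} {A B T : ℕ} (hY : Y ≤ 2 ^ A * ((2:ℝ) ^ B)⁻¹) (h : A + T ≤ B) :
    Y ≤ ((2:ℝ) ^ T)⁻¹ := by
  refine hY.trans ?_
  rw [← div_eq_mul_inv, div_le_iff₀ (by positivity), ← div_eq_inv_mul, le_div_iff₀ (by positivity),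
    ← pow_add]
  exact pow_le_pow_right₀ (by norm_num) h

theorem term1 {d t w j : ℕ} {A : ℝ} (hA0 : 0 ≤ A) (hA : A ≤ 2 ^ (w + 1))
    (hj : (w + 1) * j ≤ t + (w + 1)) (hw : w ≤ t) {x : ℝ} (hx : x = ((2:ℝ) ^ (d + 4))⁻¹) :
    d * (2 ^ (d * t) * (x ^ (t + 1) * A ^ j)) ≤ ((2:ℝ) ^ (2 * t))⁻¹ := by
  have hd : (d:ℝ) ≤ 2 ^ d := by exact_mod_cast Nat.lt_two_pow_self.le
  have hAj : A ^ j ≤ 2 ^ ((w + 1) * j) := by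
    rw [pow_mul]; exact pow_le_pow_left₀ hA0 hA _
  have hx' : x ^ (t + 1) = ((2:ℝ) ^ ((d + 4) * (t + 1)))⁻¹ := by
    rw [hx, inv_pow, ← pow_mul]
  refine le_inv_of_pow (A := d + d * t + (w + 1) * j) (B := (d + 4) * (t + 1)) ?_ ?_
  · rw [hx', pow_add, pow_add]
    calc _ ≤ (2:ℝ) ^ d * (2 ^ (d * t) * (((2:ℝ) ^ ((d + 4) * (t + 1)))⁻¹ * 2 ^ ((w + 1) * j))) := by
          gcongr
      _ = _ := by ring
  · nlinarith

theorem term2 {d t k j : ℕ} {A u L : ℝ} (hA0 : 0 ≤ A) (hA : A ≤ (2:ℝ) ^ u) (hu0 : 0 ≤ u)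
    (hL : 0 ≤ L) (hj : j = t / (k + 1) + 1) (hu : u ≤ 0.0001 * L * (k + 1)) (hut : u ≤ t)
    {x : ℝ} (hx : x = ((2:ℝ) ^ (d + 4))⁻¹) :
    2 ^ (d * t) * ((x * (2:ℝ) ^ (-(0.0001 * L))) ^ (t + 1) * A ^ j) ≤ ((2:ℝ) ^ (2 * t))⁻¹ := by
  have hAj : A ^ j ≤ (2:ℝ) ^ (u * j) := by
    rw [Real.rpow_mul (by norm_num), Real.rpow_natCast]
    exact pow_le_pow_left₀ hA0 hA _
  have hy : ((2:ℝ) ^ (-(0.0001 * L))) ^ (t + 1) = (2:ℝ) ^ (-(0.0001 * L) * ((t + 1 : ℕ) : ℝ)) := by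
    rw [Real.rpow_mul (by norm_num), Real.rpow_natCast]
  have hx' : x ^ (t + 1) = ((2:ℝ) ^ ((d + 4) * (t + 1)))⁻¹ := by
    rw [hx, inv_pow, ← pow_mul]
  have hjr : (j:ℝ) ≤ t / (k + 1) + 1 := by
    rw [hj]; push_cast
    have := Nat.cast_div_le (α := ℝ) (m := t) (n := k + 1)
    push_cast at this
    linarith
  have hk : (0:ℝ) < (k:ℝ) + 1 := by positivity
  have hexp : -(0.0001 * L) * ((t + 1 : ℕ) : ℝ) + u * j ≤ t := by
    have h1 : u * j ≤ u * (t / (k + 1)) + u := by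
      have := mul_le_mul_of_nonneg_left hjr hu0
      linarith
    have h2 : u * ((t:ℝ) / (k + 1)) ≤ 0.0001 * L * t := by
      calc u * ((t:ℝ) / (k + 1)) ≤ (0.0001 * L * (k + 1)) * ((t:ℝ) / (k + 1)) :=
            mul_le_mul_of_nonneg_right hu (by positivity)
        _ = _ := by field_simp
    push_cast
    nlinarith
  have hyA : ((2:ℝ) ^ (-(0.0001 * L))) ^ (t + 1) * A ^ j ≤ 2 ^ t := by
    rw [hy]
    calc _ ≤ (2:ℝ) ^ (-(0.0001 * L) * ((t + 1 : ℕ) : ℝ)) * (2:ℝ) ^ (u * j) := by gcongr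
      _ = (2:ℝ) ^ (-(0.0001 * L) * ((t + 1 : ℕ) : ℝ) + u * j) := by
          rw [Real.rpow_add (by norm_num)]
      _ ≤ (2:ℝ) ^ (t:ℝ) := Real.rpow_le_rpow_of_exponent_le (by norm_num) hexp
      _ = 2 ^ t := Real.rpow_natCast _ _
  refine le_inv_of_pow (A := d * t + t) (B := (d + 4) * (t + 1)) ?_ ?_
  · rw [mul_pow, hx', pow_add]
    calc _ = (2:ℝ) ^ (d * t) * ((2:ℝ) ^ ((d + 4) * (t + 1)))⁻¹ *
            (((2:ℝ) ^ (-(0.0001 * L))) ^ (t + 1) * A ^ j) := by ring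
      _ ≤ (2:ℝ) ^ (d * t) * ((2:ℝ) ^ ((d + 4) * (t + 1)))⁻¹ * 2 ^ t := by gcongr
      _ = _ := by ring
  · nlinarith

theorem term3 {d t m k : ℕ} {R : ℝ} (hm : (m:ℝ) * (k + 1) ≤ 2 ^ t) (hR : 2 * ((d:ℝ) + 4) * t ≤ R) :
    (m:ℝ) * (k + 1) * (2 ^ (d * t + t) * Real.exp (-(R / 2))) ≤ ((2:ℝ) ^ (2 * t))⁻¹ := by
  have he : Real.exp (-(R / 2)) ≤ ((2:ℝ) ^ ((d + 4) * t))⁻¹ := by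
    refine le_trans (Real.exp_le_exp.2 ?_) (exp_neg_le_two _)
    push_cast
    linarith
  refine le_inv_of_pow (A := t + (d * t + t)) (B := (d + 4) * t) ?_ ?_
  · rw [pow_add _ t]
    calc _ ≤ (2:ℝ) ^ t * (2 ^ (d * t + t) * ((2:ℝ) ^ ((d + 4) * t))⁻¹) := by gcongr
      _ = _ := by ring
  · nlinarith

theorem term4 {t : ℕ} {K Y : ℝ} (hK : K ≤ 2 ^ (4 * t)) (hY : 6 * (t:ℝ) ≤ Y) :
    K * Real.exp (-Y) ≤ ((2:ℝ) ^ (2 * t))⁻¹ := by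
  have he : Real.exp (-Y) ≤ ((2:ℝ) ^ (6 * t))⁻¹ := by
    refine le_trans (Real.exp_le_exp.2 ?_) (exp_neg_le_two _)
    push_cast
    linarith
  refine le_inv_of_pow (A := 4 * t) (B := 6 * t) ?_ (by omega)
  calc _ ≤ (2:ℝ) ^ (4 * t) * Real.exp (-Y) := by gcongr
    _ ≤ _ := by gcongr

/-- the conditions on `m` that hold eventually -/
def Good (d m : ℕ) : Prop :=
  10000 ≤ Real.logb 2 m ∧ Real.logb 2 m + 3 ≤ (m:ℝ) ^ (0.0005 : ℝ) ∧
  4 * ((d:ℝ) + 4) * (2 ^ (d + 9) * (2 * Real.logb 2 m ^ 2)) ^ (d + 1) ≤ (m:ℝ) ^ (0.0014 : ℝ) ∧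
  Real.logb 2 m ^ 2 + 10 ≤ (m:ℝ) ^ (0.5 : ℝ)

open Filter in
theorem good_eventually (d : ℕ) : ∀ᶠ m : ℕ in atTop, Good d m := by
  have hc : Tendsto (fun m : ℕ => (m:ℝ)) atTop atTop := tendsto_natCast_atTop_atTop
  have hlog : ∀ (e : ℕ) (s : ℝ), 0 < s → ∀ A B : ℝ, 
      ∀ᶠ x : ℝ in atTop, A * (Real.log x) ^ e + B ≤ x ^ s := by
    intro e s hs A B
    have h1 : (fun x : ℝ => Real.log x ^ e) =o[atTop] fun x => x ^ s := by
      have := isLittleO_log_rpow_rpow_atTop (e:ℝ) hs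
      simpa using this
    have h2 : (fun _ : ℝ => (B:ℝ)) =o[atTop] fun x : ℝ => x ^ s := by
      rw [Asymptotics.isLittleO_const_left]
      right
      exact tendsto_norm_atTop_atTop.comp (tendsto_rpow_atTop hs)
    have h3 := ((h1.const_mul_left A).add h2).bound (c := 1) one_pos
    filter_upwards [h3, eventually_ge_atTop 0] with x hx hx0
    rw [one_mul, Real.norm_of_nonneg (Real.rpow_nonneg hx0 _)] at hx
    exact (le_abs_self _).trans hx
  have a1 : ∀ᶠ x : ℝ in atTop, 10000 ≤ Real.logb 2 x :=
    (Real.tendsto_logb_atTop (by norm_num)).eventually_ge_atTop _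
  have a2 := hlog 1 0.0005 (by norm_num) (1 / Real.log 2) 3
  have a3 := hlog (2 * (d + 1)) 0.0014 (by norm_num)
    (4 * ((d:ℝ) + 4) * (2 ^ (d + 9) * (2 * (1 / Real.log 2) ^ 2)) ^ (d + 1)) 0
  have a4 := hlog 2 0.5 (by norm_num) ((1 / Real.log 2) ^ 2) 10
  filter_upwards [hc.eventually a1, hc.eventually a2, hc.eventually a3, hc.eventually a4]
    with m h1 h2 h3 h4
  have el : Real.logb 2 m = 1 / Real.log 2 * Real.log m := by
    unfold Real.logb; ring
  refine ⟨h1, ?_, ?_, ?_⟩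
  · rw [el]; simpa using h2
  · refine le_trans (le_of_eq ?_) h3
    rw [el, pow_mul]
    simp only [mul_pow]
    ring
  · rw [el, mul_pow]; exact h4

end Num

/-! ### Choice of parameters -/

section Core

theorem k_lt {m k : ℕ} (hm : 1 ≤ m) (hk : k = ⌊(0.0005 : ℝ) * Real.logb 2 (m : ℝ)⌋₊) :
    k + 1 ≤ m := by
  have hm' : (1:ℝ) ≤ m := by exact_mod_cast hm
  have hL0 : 0 ≤ Real.logb 2 (m:ℝ) := Real.logb_nonneg (by norm_num) hm'
  have h1 : Real.logb 2 (m:ℝ) ≤ m := by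
    rw [Real.logb_le_iff_le_rpow (by norm_num) (by linarith), Real.rpow_natCast]
    exact_mod_cast Nat.lt_two_pow_self.le
  have h2 : (k:ℝ) < m := by
    have : (k:ℝ) ≤ 0.0005 * Real.logb 2 (m:ℝ) := by
      rw [hk]; exact Nat.floor_le (by positivity)
    nlinarith
  have : k < m := by exact_mod_cast h2
  omega

set_option maxHeartbeats 1000000 in
theorem core {d m k n : ℕ} (hG : Good d m)
    (hk : k = ⌊(0.0005 : ℝ) * Real.logb 2 (m : ℝ)⌋₊) (hn : n = m * (k + 1) * m)
    {a : ℕ} (C : Fin a → AC0 (Fin m × Fin (k + 1) × Fin m)) (hd : ∀ i, (C i).depth ≤ d)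
    {g : (Fin a → Bool) → Bool} (hg : IsExpSum g (((a:ℝ) + 10) ^ 4))
    (hS : ((1 + ∑ i, (C i).size : ℕ) : ℝ) ≤ (n:ℝ) ^ ((1/1000000000 : ℝ) * Real.logb 2 (n:ℝ))) :
    agreePr (RW m k m) (fun x => g fun i => (C i).eval x) ≤
      1 / 2 + Real.exp (-(1 * (n:ℝ) ^ (0.499 : ℝ))) := by
  obtain ⟨g1, g2, g3, g4⟩ := hG
  set L := Real.logb 2 (m:ℝ) with hL
  have hm1 : 1 ≤ m := by
    rcases Nat.eq_zero_or_pos m with h | h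
    · rw [hL, h] at g1; norm_num at g1
    · exact h
  have hkm := k_lt hm1 hk
  have hm0 : (0:ℝ) < m := by exact_mod_cast hm1
  have hm1' : (1:ℝ) ≤ m := by exact_mod_cast hm1
  have hkm' : (k:ℝ) + 1 ≤ m := by exact_mod_cast hkm
  have h2L : (2:ℝ) ^ L = m := Real.rpow_logb (by norm_num) (by norm_num) hm0
  have hpowL : ∀ s : ℝ, (m:ℝ) ^ s = 2 ^ (L * s) := by
    intro s; rw [Real.rpow_mul (by norm_num), h2L]
  -- bounds on k
  have hk1 : (k:ℝ) ≤ 0.0005 * L := by rw [hk]; exact Nat.floor_le (by positivity)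
  have hk2 : 0.0005 * L ≤ (k:ℝ) + 1 := by
    rw [hk]; exact (Nat.lt_floor_add_one _).le
  -- n
  have hnr : (n:ℝ) = m * (k + 1) * m := by rw [hn]; push_cast; ring
  have hn1 : (1:ℝ) ≤ n := by
    have : 1 ≤ n := by
      rw [hn]
      exact Nat.mul_pos (Nat.mul_pos hm1 (by omega)) hm1
    exact_mod_cast this
  have hn3 : (n:ℝ) ≤ (m:ℝ) ^ 3 := by
    rw [hnr]
    calc (m:ℝ) * (k + 1) * m ≤ (m:ℝ) * m * m := by gcongr
      _ = _ := by ring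
  have hlogn : Real.logb 2 (n:ℝ) ≤ 3 * L := by
    have := Real.logb_le_logb_of_le (b := 2) (by norm_num) (by linarith) hn3
    rwa [Real.logb_pow] at this
  have hlogn0 : 0 ≤ Real.logb 2 (n:ℝ) := Real.logb_nonneg (by norm_num) hn1
  -- size
  set u : ℝ := 1/100000000 * L ^ 2 + 3 with hu
  have hS2 : (n:ℝ) ^ ((1/1000000000 : ℝ) * Real.logb 2 (n:ℝ)) ≤ (2:ℝ) ^ (u - 3) := by
    have e : (n:ℝ) ^ ((1/1000000000 : ℝ) * Real.logb 2 (n:ℝ)) =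
        (2:ℝ) ^ (Real.logb 2 (n:ℝ) * ((1/1000000000 : ℝ) * Real.logb 2 (n:ℝ))) := by
      rw [Real.rpow_mul (by norm_num : (0:ℝ) ≤ 2) (Real.logb 2 (n:ℝ)), Real.rpow_logb (by norm_num) (by norm_num) (by linarith)]
    rw [e]
    apply Real.rpow_le_rpow_of_exponent_le (by norm_num)
    rw [hu]
    nlinarith
  set N := ∑ i, (C i).size with hN
  have hNS : (N:ℝ) + 1 ≤ (2:ℝ) ^ (u - 3) := by
    have := hS.trans hS2
    rw [Nat.cast_add, Nat.cast_one] at this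
    linarith
  have hN0 : (0:ℝ) ≤ N := Nat.cast_nonneg _
  have h2u : (2:ℝ) ^ u = 8 * (2:ℝ) ^ (u - 3) := by
    rw [Real.rpow_sub (by norm_num)]; norm_num; ring
  have hA : 3 * (N:ℝ) + 1 ≤ (2:ℝ) ^ u := by rw [h2u]; linarith
  have haN : (a:ℝ) ≤ N := by
    have : a ≤ N := by
      calc a = ∑ _i : Fin a, 1 := by simp
        _ ≤ N := sum_le_sum fun i _ => size_pos (C i)
    exact_mod_cast this
  have ha10 : (a:ℝ) + 10 ≤ (2:ℝ) ^ (u + 1) := by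
    rw [Real.rpow_add (by norm_num), h2u]; norm_num; nlinarith
  -- t
  set T : ℝ := (m:ℝ) ^ (0.9985 : ℝ) with hT
  set t : ℕ := ⌈T⌉₊ with ht
  have hTt : T ≤ t := Nat.le_ceil _
  have hT1 : 1 ≤ T := Real.one_le_rpow hm1' (by norm_num)
  have htT : (t:ℝ) ≤ 2 * T := by
    have := Nat.ceil_lt_add_one (a := T) (by linarith)
    linarith
  have hhalf : (m:ℝ) ^ (0.5:ℝ) ≤ T := Real.rpow_le_rpow_of_exponent_le hm1' (by norm_num)
  have hLt : L ^ 2 + 10 ≤ t := g4.trans (hhalf.trans hTt)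
  have hut : u + 1 ≤ t := by rw [hu]; nlinarith
  -- w
  set w : ℕ := ⌈L ^ 2⌉₊ with hw
  have hw1 : L ^ 2 ≤ w := Nat.le_ceil _
  have hw2 : (w:ℝ) < L ^ 2 + 1 := Nat.ceil_lt_add_one (by positivity)
  have hwpos : 0 < w := by
    have : (0:ℝ) < w := by nlinarith
    exact_mod_cast this
  have hwr : (0:ℝ) < w := by exact_mod_cast hwpos
  have hwt : w ≤ t := by
    have : (w:ℝ) ≤ t := by linarith
    exact_mod_cast this
  -- p, q
  set x : ℝ := ((2:ℝ) ^ (d + 4))⁻¹ with hx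
  have hx0 : 0 < x := by positivity
  have hx1 : x ≤ 1 := by
    rw [hx]; exact inv_le_one_of_one_le₀ (one_le_pow₀ (by norm_num))
  set y : ℝ := (2:ℝ) ^ (-(0.0001 * L)) with hy
  have hy0 : 0 < y := by positivity
  have hy1 : y ≤ 1 := by
    rw [hy]; exact Real.rpow_le_one_of_one_le_of_nonpos (by norm_num) (by linarith)
  set p : ℝ := x / (32 * w) with hp
  have hp0 : 0 < p := by positivity
  have hw1' : (1:ℝ) ≤ w := by exact_mod_cast hwpos
  have hp2 : p ≤ 1 / 2 := by
    rw [hp, div_le_iff₀ (by positivity)]; linarith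
  have hpw : 32 * w * p = x := by rw [hp]; field_simp
  set q : ℝ := p * y with hq
  have hq0 : 0 < q := by positivity
  have hqp : q ≤ p := mul_le_of_le_one_right hp0.le hy1
  have hqw : 32 * w * q = x * y := by rw [hq, ← mul_assoc, hpw]
  -- j
  set j := t / (w + 1) + 1 with hj
  set j' := t / (k + 1) + 1 with hj'
  have hj1 : t + 1 ≤ (w + 1) * j := by
    have := Nat.lt_mul_div_succ t (Nat.succ_pos w)
    rw [hj]; exact this
  have hj2 : t + 1 ≤ (k + 1) * j' := by
    have := Nat.lt_mul_div_succ t (Nat.succ_pos k)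
    rw [hj']; exact this
  have hj3 : (w + 1) * j ≤ t + (w + 1) := by
    have := Nat.mul_div_le t (w + 1)
    rw [hj, mul_add, mul_one]; omega
  -- main
  have key := assemble C hd (le_refl N) hg (by positivity) hwpos hp0 hp2 (by rw [hpw]; exact hx1)
    hq0 (hqp.trans hp2) (by rw [hqw]; exact mul_le_one₀ hx1 hy0.le hy1) hj1 hj2
  rw [hpw, hqw] at key
  -- the target exponent
  set X : ℝ := (n:ℝ) ^ (0.499 : ℝ) with hX
  have hX0 : 0 ≤ X := by positivity
  have hXt : X + 2 ≤ t := by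
    have e1 : X ≤ (m:ℝ) ^ (0.998 : ℝ) * (k + 1) := by
      have e0 : (n:ℝ) = (m:ℝ) ^ (2:ℝ) * (k + 1) := by
        rw [hnr]
        have : (m:ℝ) ^ (2:ℝ) = m ^ 2 := by exact_mod_cast Real.rpow_natCast (m:ℝ) 2
        rw [this]; ring
      rw [hX, e0, Real.mul_rpow (by positivity) (by positivity), ← Real.rpow_mul hm0.le]
      have : (2:ℝ) * 0.499 = 0.998 := by norm_num
      rw [this]
      refine mul_le_mul_of_nonneg_left ?_ (by positivity)
      calc ((k:ℝ) + 1) ^ (0.499:ℝ) ≤ ((k:ℝ) + 1) ^ (1:ℝ) :=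
            Real.rpow_le_rpow_of_exponent_le (by linarith [Nat.cast_nonneg (α := ℝ) k]) (by norm_num)
        _ = _ := Real.rpow_one _
    have e2 : T = (m:ℝ) ^ (0.998 : ℝ) * (m:ℝ) ^ (0.0005 : ℝ) := by
      rw [hT, ← Real.rpow_add hm0]; norm_num
    have e3 : 1 ≤ (m:ℝ) ^ (0.998 : ℝ) := Real.one_le_rpow hm1' (by norm_num)
    have e4 : (m:ℝ) ^ (0.998 : ℝ) * ((k:ℝ) + 1 + 2) ≤ T := by
      rw [e2]
      refine mul_le_mul_of_nonneg_left ?_ (by positivity)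
      linarith
    linarith
  have hLL : 100000000 ≤ L ^ 2 := by nlinarith only [g1]
  have huk : u ≤ 0.0001 * L * (k + 1) := by
    have := mul_le_mul_of_nonneg_left hk2 (by positivity : (0:ℝ) ≤ 0.0001 * L)
    rw [hu]; nlinarith only [this, hLL]
  have hu0 : 0 ≤ u := by positivity
  clear_value X x y p q T t w j j' u N
  have F := fin_bound hX0 hXt
  have T1 := term1 (d := d) (A := 3 * (N:ℝ) + 1) (by positivity) (hA.trans (by
    rw [← Real.rpow_natCast]
    apply Real.rpow_le_rpow_of_exponent_le (by norm_num)
    push_cast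
    rw [hu]; linarith only [hw1, sq_nonneg L, hLL])) hj3 hwt hx
  have T2 := term2 (d := d) (A := 3 * (N:ℝ) + 1) (t := t) (k := k) (u := u) (L := L)
    (by positivity) hA hu0 (by linarith) hj'
    huk (by linarith) hx
  rw [← hy] at T2
  have hLLt : L + L ≤ t := by nlinarith only [hLt, g1]
  have hmk2 : (m:ℝ) * (k + 1) ≤ 2 ^ t := by
    calc (m:ℝ) * (k + 1) ≤ m * m := by gcongr
      _ = (2:ℝ) ^ (L + L) := by rw [Real.rpow_add (by norm_num), h2L]
      _ ≤ (2:ℝ) ^ (t:ℝ) := Real.rpow_le_rpow_of_exponent_le (by norm_num) hLLt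
      _ = _ := Real.rpow_natCast _ _
  have hPm : 2 * ((d:ℝ) + 4) * t ≤ p ^ d * q * m := by
    have e1 : p ^ d * q * m = p ^ (d + 1) * (m:ℝ) ^ (0.9999 : ℝ) := by
      have : y * m = (m:ℝ) ^ (0.9999 : ℝ) := by
        rw [hpowL, hy]
        conv_lhs => rw [← h2L]
        rw [← Real.rpow_add (by norm_num)]
        congr 1; ring
      rw [← this, hq, pow_succ]; ring
    have e2 : (m:ℝ) ^ (0.9999 : ℝ) = (m:ℝ) ^ (0.0014 : ℝ) * T := by
      rw [hT, ← Real.rpow_add hm0]; norm_num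
    set W : ℝ := 2 ^ (d + 9) * (2 * L ^ 2) with hW
    have hW0 : 0 < W := by positivity
    have e3 : 1 / W ≤ p := by
      rw [hp, hx, hW, ← one_div, div_div]
      apply one_div_le_one_div_of_le (by positivity)
      have : (2:ℝ) ^ (d + 9) = 2 ^ (d + 4) * 32 := by rw [show d + 9 = d + 4 + 5 by ring, pow_add]; norm_num
      rw [this, mul_assoc]
      gcongr
      linarith only [hw2, hLL]
    have e4 : (1 / W) ^ (d + 1) ≤ p ^ (d + 1) := pow_le_pow_left₀ (by positivity) e3 _
    rw [e1, e2]
    calc 2 * ((d:ℝ) + 4) * t ≤ 2 * ((d:ℝ) + 4) * (2 * T) := by gcongr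
      _ = (1 / W) ^ (d + 1) * (4 * ((d:ℝ) + 4) * W ^ (d + 1) * T) := by
          rw [div_pow, one_pow]; field_simp; ring
      _ ≤ p ^ (d + 1) * ((m:ℝ) ^ (0.0014 : ℝ) * T) := by gcongr
  have T3 := term3 (d := d) (t := t) (m := m) (k := k) hmk2 hPm
  have hK : ((a:ℝ) + 10) ^ 4 ≤ 2 ^ (4 * t) := by
    have : (a:ℝ) + 10 ≤ 2 ^ t := by
      refine ha10.trans ?_
      rw [← Real.rpow_natCast]
      exact Real.rpow_le_rpow_of_exponent_le (by norm_num) hut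
    calc ((a:ℝ) + 10) ^ 4 ≤ (2 ^ t) ^ 4 := by gcongr
      _ = _ := by rw [← pow_mul, mul_comm]
  have hY : 6 * (t:ℝ) ≤ (m:ℝ) / 4 ^ k := by
    have e1 : (4:ℝ) ^ k ≤ (m:ℝ) ^ (0.001 : ℝ) := by
      rw [hpowL]
      have : (4:ℝ) ^ k = (2:ℝ) ^ (2 * (k:ℝ)) := by
        rw [Real.rpow_mul (by norm_num), Real.rpow_natCast]; norm_num
      rw [this]
      apply Real.rpow_le_rpow_of_exponent_le (by norm_num)
      linarith
    have e2 : (m:ℝ) = (m:ℝ) ^ (0.001 : ℝ) * ((m:ℝ) ^ (0.0005 : ℝ) * T) := by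
      rw [hT, ← Real.rpow_add hm0, ← Real.rpow_add hm0]
      norm_num
    rw [le_div_iff₀ (by positivity)]
    calc 6 * (t:ℝ) * 4 ^ k ≤ 6 * (2 * T) * (m:ℝ) ^ (0.001 : ℝ) := by gcongr
      _ = (m:ℝ) ^ (0.001 : ℝ) * (12 * T) := by ring
      _ ≤ (m:ℝ) ^ (0.001 : ℝ) * ((m:ℝ) ^ (0.0005 : ℝ) * T) := by
          gcongr
          linarith
      _ = m := e2.symm
  have T4 := term4 hK hY
  rw [one_mul]
  linarith

end Core

/-- **Theorem 1.3 (main correlation bound).** There are absolute constants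
`τ, c > 0` so that for every depth `d`, for all sufficiently large
`n = m(k+1)r` with `m = r` and `k = ⌊0.0005·log₂ m⌋`, every circuit of size at
most `n^{τ·log₂ n}` and depth `d` whose top gate is SYM or THR (fed by
depth-`(d-1)` AC⁰ circuits) agrees with `RW_{m,k,r}` on at most a
`1/2 + exp(-c·n^{0.499})` fraction of inputs. -/
theorem main_correlation_bound :
    ∃ τ c : ℝ, 0 < τ ∧ 0 < c ∧
      ∀ d : ℕ, ∃ n₀ : ℕ, ∀ m k r n : ℕ,
        n₀ ≤ n → m = r → k = ⌊(0.0005 : ℝ) * Real.logb 2 (m : ℝ)⌋₊ →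
        n = m * (k + 1) * r →
        ∀ F : (Fin m × Fin (k + 1) × Fin r → Bool) → Bool,
          (SymOnAC0 ((n : ℝ) ^ (τ * Real.logb 2 (n : ℝ))) (d - 1) F ∨
            ThrOnAC0 ((n : ℝ) ^ (τ * Real.logb 2 (n : ℝ))) (d - 1) F) →
          agreePr (RW m k r) F ≤ 1 / 2 + Real.exp (-(c * (n : ℝ) ^ (0.499 : ℝ))) := by
  refine ⟨1/1000000000, 1, by norm_num, by norm_num, fun d => ?_⟩
  obtain ⟨m₀, hm₀⟩ := Filter.eventually_atTop.1 (good_eventually d)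
  refine ⟨m₀ ^ 3, ?_⟩
  intro m k r n hn hmr hk hnm F hF
  subst hmr
  have hm : m₀ ≤ m := by
    by_contra hlt
    push Not at hlt
    have h1 : n ≤ m ^ 3 := by
      rcases Nat.eq_zero_or_pos m with h | h
      · subst h; simp at hnm; omega
      · have := k_lt h hk
        rw [hnm]
        calc m * (k + 1) * m ≤ m * m * m := by gcongr
          _ = m ^ 3 := by ring
    have h2 : m ^ 3 < m₀ ^ 3 := Nat.pow_lt_pow_left hlt (by norm_num)
    omega
  have hG := hm₀ m hm
  rcases hF with ⟨a, g, C, hg, hd, hS, hFe⟩ | ⟨a, g, C, hg, hd, hS, hFe⟩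
  · have e : F = fun x => g fun i => (C i).eval x := funext hFe
    rw [e]
    exact core hG hk hnm C (fun i => (hd i).trans (Nat.sub_le d 1)) (sym_expSum hg) hS
  · have e : F = fun x => g fun i => (C i).eval x := funext hFe
    rw [e]
    exact core hG hk hnm C (fun i => (hd i).trans (Nat.sub_le d 1)) (thr_expSum hg) hS
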